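/- Let x_1, …, x_d and s be algebraic numbers (elements of ℂ algebraic over ℚ) such that s is not contained in the ℚ-linear span of x_1, …, x_d, and let C, δ > 0. Then there are only finitely many tuples (p_1, …, p_d, q) ∈ ℤ^d × ℕ with q ≥ 1 and |p_i| ≤ q^C for all i that satisfy the inequality |q s − Σ_{i=1}^d p_i x_i| · ∏_{i=1}^d max{1, |p_i|} < q^{−δ}. -/

import Mathlib

namespace SubspaceThm

open MvPolynomial

section LOne

variable {σ τ R : Type*} [CommRing R]

/-- The `ℓ¹`-norm of the coefficient vector of a polynomial, with respect to a ring seminorm. -/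
noncomputable def lOne (N : RingSeminorm R) (p : MvPolynomial σ R) : ℝ :=
  ∑ i ∈ p.support, N (coeff i p)

variable (N : RingSeminorm R)

theorem lOne_eq_sum_of_subset {p : MvPolynomial σ R} {s : Finset (σ →₀ ℕ)} (h : p.support ⊆ s) :
    lOne N p = ∑ i ∈ s, N (coeff i p) := by
  refine Finset.sum_subset h fun i _ hi => ?_
  rw [notMem_support_iff.mp hi, map_zero]

theorem lOne_nonneg (p : MvPolynomial σ R) : 0 ≤ lOne N p :=
  Finset.sum_nonneg fun _ _ => apply_nonneg N _

@[simp]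
theorem lOne_zero : lOne N (0 : MvPolynomial σ R) = 0 := by simp [lOne]

theorem coeff_le_lOne (p : MvPolynomial σ R) (i : σ →₀ ℕ) : N (coeff i p) ≤ lOne N p := by
  by_cases hi : i ∈ p.support
  · exact Finset.single_le_sum (f := fun i => N (coeff i p)) (fun _ _ => apply_nonneg N _) hi
  · rw [notMem_support_iff.mp hi, map_zero]
    exact lOne_nonneg N p

theorem lOne_add_le (p q : MvPolynomial σ R) : lOne N (p + q) ≤ lOne N p + lOne N q := by
  classical
  rw [lOne_eq_sum_of_subset N (support_add (p := p) (q := q)),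
    lOne_eq_sum_of_subset N (Finset.subset_union_left (s₁ := p.support) (s₂ := q.support)),
    lOne_eq_sum_of_subset N (Finset.subset_union_right (s₁ := p.support) (s₂ := q.support)),
    ← Finset.sum_add_distrib]
  exact Finset.sum_le_sum fun i _ => by simpa using map_add_le_add N _ _

theorem lOne_neg (p : MvPolynomial σ R) : lOne N (-p) = lOne N p := by
  simp [lOne, support_neg]

theorem lOne_sum_le {ι : Type*} (s : Finset ι) (f : ι → MvPolynomial σ R) :
    lOne N (∑ i ∈ s, f i) ≤ ∑ i ∈ s, lOne N (f i) := by
  classical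
  induction s using Finset.induction_on with
  | empty => simp
  | insert a s ha ih =>
    rw [Finset.sum_insert ha, Finset.sum_insert ha]
    exact (lOne_add_le N _ _).trans (by gcongr)

theorem lOne_monomial (i : σ →₀ ℕ) (a : R) : lOne N (monomial i a) = N a := by
  classical
  rw [lOne_eq_sum_of_subset N (support_monomial_subset (s := i) (a := a))]
  simp

theorem lOne_C (a : R) : lOne N (C a : MvPolynomial σ R) = N a := lOne_monomial N 0 a

theorem lOne_mul_le (p q : MvPolynomial σ R) : lOne N (p * q) ≤ lOne N p * lOne N q := by
  rw [mul_def, Finsupp.sum]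
  refine (lOne_sum_le N _ _).trans ?_
  rw [lOne, Finset.sum_mul]
  refine Finset.sum_le_sum fun i _ => ?_
  rw [Finsupp.sum]
  refine (lOne_sum_le N _ _).trans ?_
  rw [lOne, Finset.mul_sum]
  refine Finset.sum_le_sum fun j _ => ?_
  rw [lOne_monomial]
  exact map_mul_le_mul N _ _

variable {N}

theorem lOne_pow_le (hN : N 1 ≤ 1) (p : MvPolynomial σ R) (k : ℕ) :
    lOne N (p ^ k) ≤ lOne N p ^ k := by
  induction k with
  | zero => rw [pow_zero, pow_zero, ← C_1, lOne_C]; exact hN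
  | succ k ih =>
    rw [pow_succ, pow_succ]
    exact (lOne_mul_le N _ _).trans
      (mul_le_mul_of_nonneg_right ih (lOne_nonneg N p))

theorem lOne_prod_le (hN : N 1 ≤ 1) {ι : Type*} (s : Finset ι) (f : ι → MvPolynomial σ R) :
    lOne N (∏ i ∈ s, f i) ≤ ∏ i ∈ s, lOne N (f i) := by
  classical
  induction s using Finset.induction_on with
  | empty => rw [Finset.prod_empty, Finset.prod_empty, ← C_1, lOne_C]; exact hN
  | insert a s ha ih =>
    rw [Finset.prod_insert ha, Finset.prod_insert ha]
    exact (lOne_mul_le N _ _).trans (mul_le_mul_of_nonneg_left ih (lOne_nonneg N _))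

/-- Bound for the `ℓ¹`-norm of a polynomial after substitution. -/
theorem lOne_aeval_le [Fintype τ] (hN : N 1 ≤ 1) (f : τ → MvPolynomial σ R) (p : MvPolynomial τ R)
    (B : ℝ) (hB : ∀ i ∈ p.support, ∏ k, lOne N (f k) ^ i k ≤ B) :
    lOne N (aeval f p) ≤ lOne N p * B := by
  rw [aeval_eq_eval₂Hom, coe_eval₂Hom, eval₂_eq']
  refine (lOne_sum_le N _ _).trans ?_
  rw [lOne, Finset.sum_mul]
  refine Finset.sum_le_sum fun i hi => (lOne_mul_le N _ _).trans ?_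
  rw [algebraMap_eq, lOne_C]
  refine mul_le_mul_of_nonneg_left ?_ (apply_nonneg N _)
  refine (lOne_prod_le hN _ _).trans (le_trans ?_ (hB i hi))
  exact Finset.prod_le_prod (fun _ _ => lOne_nonneg N _) fun k _ => lOne_pow_le hN _ _

end LOne

section WtGE

variable {σ R : Type*} [Fintype σ] [CommRing R]

/-- All monomials of `p` have weight at least `B`, the variable `X j` having weight `w j`. -/
def WtGE (w : σ → ℝ) (B : ℝ) (p : MvPolynomial σ R) : Prop :=
  ∀ i ∈ p.support, B ≤ ∑ j, (i j : ℝ) * w j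

theorem wtGE_zero (w : σ → ℝ) (B : ℝ) : WtGE w B (0 : MvPolynomial σ R) := by
  simp [WtGE]

theorem WtGE.mono {w : σ → ℝ} {B B' : ℝ} {p : MvPolynomial σ R} (h : WtGE w B p) (hB : B' ≤ B) :
    WtGE w B' p := fun i hi => hB.trans (h i hi)

theorem wtGE_of_nonpos {w : σ → ℝ} (hw : ∀ j, 0 ≤ w j) {B : ℝ} (hB : B ≤ 0)
    (p : MvPolynomial σ R) : WtGE w B p := fun _ _ =>
  hB.trans (Finset.sum_nonneg fun j _ => mul_nonneg (Nat.cast_nonneg _) (hw j))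

theorem WtGE.add {w : σ → ℝ} {B : ℝ} {p q : MvPolynomial σ R} (hp : WtGE w B p)
    (hq : WtGE w B q) : WtGE w B (p + q) := by
  classical
  intro i hi
  rcases Finset.mem_union.mp (support_add hi) with h | h
  exacts [hp i h, hq i h]

theorem WtGE.sum {w : σ → ℝ} {B : ℝ} {ι : Type*} {s : Finset ι} {f : ι → MvPolynomial σ R}
    (h : ∀ i ∈ s, WtGE w B (f i)) : WtGE w B (∑ i ∈ s, f i) := by
  classical
  induction s using Finset.induction_on with
  | empty => simpa using wtGE_zero w B
  | insert a s ha ih =>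
    rw [Finset.sum_insert ha]
    exact (h a (by simp)).add (ih fun i hi => h i (by simp [hi]))

theorem WtGE.mul {w : σ → ℝ} {B B' : ℝ} {p q : MvPolynomial σ R} (hp : WtGE w B p)
    (hq : WtGE w B' q) : WtGE w (B + B') (p * q) := by
  classical
  intro i hi
  obtain ⟨a, ha, b, hb, rfl⟩ := Finset.mem_add.mp (support_mul p q hi)
  simp only [Finsupp.add_apply, Nat.cast_add, add_mul, Finset.sum_add_distrib]
  exact add_le_add (hp a ha) (hq b hb)

theorem wtGE_C {w : σ → ℝ} (hw : ∀ j, 0 ≤ w j) (a : R) : WtGE w 0 (C a) :=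
  wtGE_of_nonpos hw le_rfl _

theorem WtGE.prod {w : σ → ℝ} (hw : ∀ j, 0 ≤ w j) {ι : Type*} {s : Finset ι} {B : ι → ℝ}
    {f : ι → MvPolynomial σ R} (h : ∀ i ∈ s, WtGE w (B i) (f i)) :
    WtGE w (∑ i ∈ s, B i) (∏ i ∈ s, f i) := by
  classical
  induction s using Finset.induction_on with
  | empty => simpa using wtGE_C hw (1 : R)
  | insert a s ha ih =>
    rw [Finset.prod_insert ha, Finset.sum_insert ha]
    exact (h a (by simp)).mul (ih fun i hi => h i (by simp [hi]))

end WtGE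

end SubspaceThm

namespace SubspaceThm

open MvPolynomial

section Hasse

variable {σ R : Type*} [Fintype σ] [CommRing R]

/-- Product of binomial coefficients of two multi-indices. -/
def multiChoose (a i : σ →₀ ℕ) : ℕ := ∏ j, (a j).choose (i j)

theorem multiChoose_zero (a : σ →₀ ℕ) : multiChoose a 0 = 1 := by simp [multiChoose]

theorem multiChoose_eq_zero {a i : σ →₀ ℕ} (h : ¬ i ≤ a) : multiChoose a i = 0 := by
  obtain ⟨j, hj⟩ : ∃ j, ¬ i j ≤ a j := by
    by_contra hcon
    push Not at hcon
    exact h hcon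
  exact Finset.prod_eq_zero (Finset.mem_univ j) (Nat.choose_eq_zero_of_lt (not_le.mp hj))

theorem multiChoose_le (a i : σ →₀ ℕ) : multiChoose a i ≤ 2 ^ ∑ j, a j := by
  rw [← Finset.prod_pow_eq_pow_sum]
  exact Finset.prod_le_prod' fun j _ => Nat.choose_le_two_pow _ _

theorem multiChoose_add_single [DecidableEq σ] (b i : σ →₀ ℕ) (j : σ) :
    multiChoose (b + Finsupp.single j 1 + i) i * (b j + 1) =
      (i j + 1) * multiChoose (b + (i + Finsupp.single j 1)) (i + Finsupp.single j 1) := by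
  unfold multiChoose
  rw [← Finset.mul_prod_erase _ _ (Finset.mem_univ j), ← Finset.mul_prod_erase _ _
    (Finset.mem_univ j)]
  have h1 : ∏ k ∈ Finset.univ.erase j, ((b + Finsupp.single j 1 + i : σ →₀ ℕ) k).choose (i k) =
      ∏ k ∈ Finset.univ.erase j, ((b + (i + Finsupp.single j 1) : σ →₀ ℕ) k).choose
        ((i + Finsupp.single j 1 : σ →₀ ℕ) k) := by
    refine Finset.prod_congr rfl fun k hk => ?_
    have hk' : j ≠ k := (Finset.ne_of_mem_erase hk).symm
    simp [hk']
  rw [h1]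
  have h2 := Nat.choose_succ_right_eq (b j + 1 + i j) (i j)
  have h3 : b j + 1 + i j - i j = b j + 1 := by omega
  rw [h3] at h2
  simp only [Finsupp.add_apply, Finsupp.single_eq_same]
  rw [show b j + (i j + 1) = b j + 1 + i j by ring]
  rw [mul_right_comm, ← h2]
  ring

/-- The Hasse derivative `(1 / i!) ∂^i` of a polynomial in several variables. -/
noncomputable def hasse (i : σ →₀ ℕ) (p : MvPolynomial σ R) : MvPolynomial σ R :=
  ∑ a ∈ p.support, monomial (a - i) ((multiChoose a i : R) * coeff a p)

theorem coeff_hasse (i b : σ →₀ ℕ) (p : MvPolynomial σ R) :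
    coeff b (hasse i p) = multiChoose (b + i) i * coeff (b + i) p := by
  classical
  rw [hasse, coeff_sum]
  simp only [coeff_monomial]
  rw [Finset.sum_eq_single (b + i)]
  · simp
  · intro a _ ha
    split_ifs with h
    · rw [multiChoose_eq_zero, Nat.cast_zero, zero_mul]
      intro hle
      exact ha (by rw [← h, tsub_add_cancel_of_le hle])
    · rfl
  · intro h
    rw [notMem_support_iff.mp h]
    simp

theorem hasse_zero (p : MvPolynomial σ R) : hasse 0 p = p := by
  ext b; simp [coeff_hasse, multiChoose_zero]

theorem hasse_sum {ι : Type*} (i : σ →₀ ℕ) (s : Finset ι) (f : ι → MvPolynomial σ R) :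
    hasse i (∑ k ∈ s, f k) = ∑ k ∈ s, hasse i (f k) := by
  ext b; simp [coeff_hasse, coeff_sum, Finset.mul_sum]

theorem map_hasse {S : Type*} [CommRing S] (f : R →+* S) (i : σ →₀ ℕ) (p : MvPolynomial σ R) :
    map f (hasse i p) = hasse i (map f p) := by
  ext b; simp [coeff_hasse, coeff_map]

theorem pderiv_hasse [DecidableEq σ] (i : σ →₀ ℕ) (j : σ) (p : MvPolynomial σ R) :
    pderiv j (hasse i p) = C ((i j : R) + 1) * hasse (i + Finsupp.single j 1) p := by
  ext b
  rw [coeff_pderiv, coeff_hasse, coeff_C_mul, coeff_hasse]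
  have h := congrArg (Nat.cast (R := R)) (multiChoose_add_single b i j)
  push_cast at h
  rw [mul_right_comm, h, show b + Finsupp.single j 1 + i = b + (i + Finsupp.single j 1) by abel]
  ring

theorem WtGE.hasse {w : σ → ℝ} {B : ℝ} {p : MvPolynomial σ R} (h : WtGE w B p) (i : σ →₀ ℕ) :
    WtGE w (B - ∑ j, (i j : ℝ) * w j) (hasse i p) := by
  intro b hb
  rw [mem_support_iff, coeff_hasse] at hb
  have := h (b + i) (mem_support_iff.mpr (right_ne_zero_of_mul hb))
  simp only [Finsupp.add_apply, Nat.cast_add, add_mul, Finset.sum_add_distrib] at this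
  linarith

theorem degreeOf_hasse_le (i : σ →₀ ℕ) (j : σ) (p : MvPolynomial σ R) :
    degreeOf j (hasse i p) ≤ degreeOf j p := by
  rw [degreeOf_le_iff]
  intro b hb
  rw [mem_support_iff, coeff_hasse] at hb
  have := monomial_le_degreeOf j (mem_support_iff.mpr (right_ne_zero_of_mul hb))
  simp only [Finsupp.add_apply] at this
  omega

theorem lOne_hasse_le (i : σ →₀ ℕ) (p : MvPolynomial σ ℤ) (r : σ → ℕ)
    (hr : ∀ j, degreeOf j p ≤ r j) :
    lOne (normRingSeminorm ℤ) (hasse i p) ≤ 2 ^ (∑ j, r j) * lOne (normRingSeminorm ℤ) p := by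
  rw [hasse]
  refine (lOne_sum_le _ _ _).trans ?_
  rw [lOne, Finset.mul_sum]
  refine Finset.sum_le_sum fun a ha => ?_
  rw [lOne_monomial]
  refine (map_mul_le_mul _ _ _).trans (mul_le_mul_of_nonneg_right ?_ (apply_nonneg _ _))
  change ‖((multiChoose a i : ℕ) : ℤ)‖ ≤ _
  rw [Int.norm_natCast]
  have h1 : multiChoose a i ≤ 2 ^ ∑ j, r j :=
    (multiChoose_le a i).trans (Nat.pow_le_pow_right (by norm_num)
      (Finset.sum_le_sum fun j _ => (monomial_le_degreeOf j ha).trans (hr j)))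
  exact_mod_cast h1

end Hasse

section Translate

variable {σ R : Type*} [CommRing R]

/-- Translation of the variables of a polynomial by a vector. -/
noncomputable def translate (ξ : σ → R) : MvPolynomial σ R →ₐ[R] MvPolynomial σ R :=
  aeval fun j => X j + C (ξ j)

theorem translate_X (ξ : σ → R) (j : σ) : translate ξ (X j) = X j + C (ξ j) := by
  simp [translate]

theorem pderiv_translate (ξ : σ → R) (j : σ) (p : MvPolynomial σ R) :
    pderiv j (translate ξ p) = translate ξ (pderiv j p) := by
  classical
  induction p using MvPolynomial.induction_on with
  | C a => simp [translate]
  | add p q hp hq => simp [hp, hq]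
  | mul_X p k hp =>
    rw [map_mul, pderiv_mul, hp, pderiv_mul, translate_X]
    simp only [map_add, map_mul, pderiv_X, pderiv_C, add_zero, translate_X]
    by_cases hjk : k = j
    · subst hjk; simp
    · simp [hjk]

theorem translate_neg_translate (ξ : σ → R) (p : MvPolynomial σ R) :
    translate (-ξ) (translate ξ p) = p := by
  have : (translate (-ξ)).comp (translate ξ) = AlgHom.id R (MvPolynomial σ R) := by
    ext j; simp [translate]
  exact DFunLike.congr_fun this p

theorem translate_injective (ξ : σ → R) : Function.Injective (translate ξ) :=
  Function.LeftInverse.injective (translate_neg_translate ξ)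

theorem hasse_translate [Fintype σ] [CharZero R] [IsDomain R] (ξ : σ → R) (i : σ →₀ ℕ)
    (p : MvPolynomial σ R) : hasse i (translate ξ p) = translate ξ (hasse i p) := by
  classical
  have key : ∀ n : ℕ, ∀ i : σ →₀ ℕ, ∑ j, i j = n →
      hasse i (translate ξ p) = translate ξ (hasse i p) := by
    intro n
    induction n with
    | zero =>
      intro i hi
      have : i = 0 := by
        ext j
        simpa using (Finset.sum_eq_zero_iff.mp hi) j (Finset.mem_univ j)
      subst this
      simp [hasse_zero]
    | succ n ih =>
      intro i hi
      obtain ⟨j, -, hj⟩ : ∃ j ∈ Finset.univ, i j ≠ 0 :=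
        Finset.exists_ne_zero_of_sum_ne_zero (by omega)
      obtain ⟨k, rfl⟩ : ∃ k, i = k + Finsupp.single j 1 := by
        refine ⟨i - Finsupp.single j 1, (tsub_add_cancel_of_le ?_).symm⟩
        exact Finsupp.single_le_iff.mpr (Nat.one_le_iff_ne_zero.mpr hj)
      have hk : ∑ l, k l = n := by
        simp only [Finsupp.add_apply, Finset.sum_add_distrib] at hi
        have : ∑ l, (Finsupp.single j 1 : σ →₀ ℕ) l = 1 := by
          simp [Finsupp.single_apply]
        omega
      have h1 := pderiv_hasse k j (translate ξ p)
      rw [ih k hk, pderiv_translate, pderiv_hasse, map_mul] at h1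
      have h2 : translate ξ (C ((k j : R) + 1)) = C ((k j : R) + 1) := by simp [translate]
      rw [h2] at h1
      refine (mul_left_cancel₀ ?_ h1).symm
      rw [Ne, C_eq_zero]
      exact_mod_cast Nat.succ_ne_zero (k j)
  exact key _ i rfl

end Translate

end SubspaceThm

namespace SubspaceThm

open MvPolynomial

section Wronskian

variable {σ : Type*}

theorem totalDegree_pderiv_le (k : σ) (p : MvPolynomial σ ℚ) :
    (pderiv k p).totalDegree ≤ p.totalDegree - 1 := by
  classical
  refine Finset.sup_le fun b hb => ?_
  rw [mem_support_iff, coeff_pderiv] at hb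
  have h1 := le_totalDegree (mem_support_iff.mpr (left_ne_zero_of_mul hb))
  rw [Finsupp.sum_add_index' (fun _ => rfl) (fun _ _ _ => rfl),
    Finsupp.sum_single_index rfl] at h1
  omega

theorem eq_C_of_pderiv_eq_zero {p : MvPolynomial σ ℚ} (h : ∀ k, pderiv k p = 0) :
    p = C (coeff 0 p) := by
  classical
  ext m
  rw [coeff_C]
  split_ifs with hm
  · rw [hm]
  · obtain ⟨k, hk⟩ : ∃ k, m k ≠ 0 := by
      by_contra hcon
      push Not at hcon
      exact hm (by ext k; simp [hcon k])
    have h1 := congrArg (coeff (m - Finsupp.single k 1)) (h k)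
    rw [coeff_pderiv, tsub_add_cancel_of_le
      (Finsupp.single_le_iff.mpr (Nat.one_le_iff_ne_zero.mpr hk)), coeff_zero] at h1
    refine (mul_eq_zero.mp h1).resolve_right ?_
    exact Nat.cast_add_one_ne_zero _

variable [Fintype σ]

theorem exists_wronskian_ne_zero (s : ℕ) (φ : Fin s → MvPolynomial σ ℚ)
    (hφ : LinearIndependent ℚ φ) : ∃ a : Fin s → (σ →₀ ℕ), (∀ i, ∑ j, a i j ≤ i) ∧
      (Matrix.of fun i j => hasse (a i) (φ j)).det ≠ 0 := by
  classical
  induction s with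
  | zero => exact ⟨Fin.elim0, fun i => i.elim0, by simp⟩
  | succ s ih =>
    obtain ⟨a, ha, hdet⟩ := ih (fun j => φ j.castSucc)
      (hφ.comp _ (Fin.castSucc_injective s))
    by_contra hcon
    push Not at hcon
    have hz : ∀ c : σ →₀ ℕ, ∑ j, c j ≤ s →
        (Matrix.of fun i j => hasse (Fin.snoc (α := fun _ => σ →₀ ℕ) a c i) (φ j)).det = 0 := by
      intro c hc
      refine hcon _ fun i => ?_
      refine Fin.lastCases ?_ (fun i => ?_) i
      · simpa using hc
      · simpa using ha i
    have key : ∀ b : Fin (s + 1) → MvPolynomial σ ℚ,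
        (∀ i, ∑ j, b j * hasse (a i) (φ j) = 0) → ∀ c : σ →₀ ℕ, ∑ j, c j ≤ s →
          ∑ j, b j * hasse c (φ j) = 0 := by
      intro b hb c hc
      obtain ⟨w, hw0, hw⟩ := Matrix.exists_vecMul_eq_zero_iff.mpr (hz c hc)
      have hw' : ∀ j, ∑ i : Fin s, w i.castSucc * hasse (a i) (φ j) +
          w (Fin.last s) * hasse c (φ j) = 0 := by
        intro j
        have := congrFun hw j
        simpa [Matrix.vecMul, dotProduct, Fin.sum_univ_castSucc] using this
      have hlast : w (Fin.last s) ≠ 0 := by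
        intro h0
        have h1 : (fun i : Fin s => w i.castSucc) = 0 := by
          refine Matrix.eq_zero_of_vecMul_eq_zero hdet ?_
          ext1 j
          have := hw' j.castSucc
          rw [h0, zero_mul, add_zero] at this
          simpa [Matrix.vecMul, dotProduct] using this
        apply hw0
        ext1 i
        refine Fin.lastCases h0 (fun i => congrFun h1 i) i
      refine (mul_eq_zero.mp (?_ : w (Fin.last s) * _ = 0)).resolve_left hlast
      have h2 : ∑ j, b j * (∑ i : Fin s, w i.castSucc * hasse (a i) (φ j) +
          w (Fin.last s) * hasse c (φ j)) = 0 := by simp [hw']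
      have h3 : ∑ j, b j * ∑ i : Fin s, w i.castSucc * hasse (a i) (φ j) = 0 := by
        simp only [Finset.mul_sum]
        rw [Finset.sum_comm]
        refine Finset.sum_eq_zero fun i _ => ?_
        rw [← mul_zero (w i.castSucc), ← hb i, Finset.mul_sum]
        exact Finset.sum_congr rfl fun j _ => by ring
      simp only [mul_add, Finset.sum_add_distrib, h3, zero_add] at h2
      rw [← h2, Finset.mul_sum]
      exact Finset.sum_congr rfl fun j _ => by ring
    let S : Set ℕ := {n | ∃ b : Fin (s + 1) → MvPolynomial σ ℚ, b ≠ 0 ∧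
      (∀ i, ∑ j, b j * hasse (a i) (φ j) = 0) ∧ ∑ j, (b j).totalDegree = n}
    have hS : S.Nonempty := by
      obtain ⟨b, hb0, hb⟩ := Matrix.exists_mulVec_eq_zero_iff.mpr (hz 0 (by simp))
      refine ⟨_, b, hb0, fun i => ?_, rfl⟩
      have := congrFun hb i.castSucc
      simp only [Matrix.mulVec, dotProduct, Matrix.of_apply, Fin.snoc_castSucc,
        Pi.zero_apply] at this
      rw [← this]
      exact Finset.sum_congr rfl fun j _ => mul_comm _ _
    obtain ⟨b, hb0, hb, hbn⟩ := Nat.sInf_mem hS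
    have hconst : ∀ k j, pderiv k (b j) = 0 := by
      intro k
      by_contra hne
      push Not at hne
      obtain ⟨j0, hj0⟩ := hne
      have hmem : ∑ j, (pderiv k (b j)).totalDegree ∈ S := by
        refine ⟨fun j => pderiv k (b j), fun h => hj0 (congrFun h j0), fun i => ?_, rfl⟩
        have h1 := congrArg (pderiv k) (hb i)
        rw [map_sum, map_zero] at h1
        simp only [pderiv_mul, pderiv_hasse, Finset.sum_add_distrib] at h1
        have h2 : ∑ j, b j * (C ((a i k : ℚ) + 1) * hasse (a i + Finsupp.single k 1) (φ j)) = 0 := by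
          have := key b hb (a i + Finsupp.single k 1) (by
            simp only [Finsupp.add_apply, Finset.sum_add_distrib]
            have : ∑ l, (Finsupp.single k 1 : σ →₀ ℕ) l = 1 := by simp [Finsupp.single_apply]
            have := ha i
            have := i.2
            omega)
          rw [← mul_zero (C ((a i k : ℚ) + 1)), ← this, Finset.mul_sum]
          exact Finset.sum_congr rfl fun j _ => by ring
        rwa [h2, add_zero] at h1
      have hlt : ∑ j, (pderiv k (b j)).totalDegree < ∑ j, (b j).totalDegree := by
        refine Finset.sum_lt_sum (fun j _ => (totalDegree_pderiv_le k _).trans (Nat.sub_le _ _))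
          ⟨j0, Finset.mem_univ _, ?_⟩
        have h1 := totalDegree_pderiv_le k (b j0)
        have h2 : (b j0).totalDegree ≠ 0 := by
          intro h
          rw [totalDegree_eq_zero_iff_eq_C] at h
          exact hj0 (by rw [h, pderiv_C])
        omega
      rw [hbn] at hlt
      exact absurd (Nat.sInf_le hmem) (not_le.mpr hlt)
    have hC : ∀ j, b j = C (coeff 0 (b j)) := fun j => eq_C_of_pderiv_eq_zero fun k => hconst k j
    have h0 := key b hb 0 (by simp)
    have h1 := Fintype.linearIndependent_iff.mp hφ (fun j => coeff 0 (b j)) (by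
      rw [← h0]
      refine Finset.sum_congr rfl fun j _ => ?_
      rw [hasse_zero]
      conv_rhs => rw [hC j]
      rw [C_mul'])
    exact hb0 (by ext1 j; rw [hC j, h1 j]; simp)

end Wronskian

end SubspaceThm

namespace SubspaceThm

open MvPolynomial

section SumType

variable {α β R : Type*} [CommRing R]

theorem mapDomain_inl_add_mapDomain_inr (a : α →₀ ℕ) (b : β →₀ ℕ) :
    Finsupp.mapDomain Sum.inl a + Finsupp.mapDomain Sum.inr b = Finsupp.sumElim a b := by
  ext x
  cases x with
  | inl x =>
    simp [Finsupp.mapDomain_apply Sum.inl_injective, Finsupp.mapDomain_of_notMem_range]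
  | inr x =>
    simp [Finsupp.mapDomain_apply Sum.inr_injective, Finsupp.mapDomain_of_notMem_range]

theorem exists_eq_sumElim (m : α ⊕ β →₀ ℕ) : ∃ a b, m = Finsupp.sumElim a b :=
  ⟨m.comapDomain Sum.inl Sum.inl_injective.injOn, m.comapDomain Sum.inr Sum.inr_injective.injOn, by
    ext x; cases x <;> simp⟩

theorem sumElim_inj {a a' : α →₀ ℕ} {b b' : β →₀ ℕ} :
    Finsupp.sumElim a b = Finsupp.sumElim a' b' ↔ a = a' ∧ b = b' := by
  constructor
  · intro h
    exact ⟨by ext x; simpa using DFunLike.congr_fun h (Sum.inl x),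
      by ext x; simpa using DFunLike.congr_fun h (Sum.inr x)⟩
  · rintro ⟨rfl, rfl⟩; rfl

theorem coeff_rename_mul_rename (f : MvPolynomial α R) (g : MvPolynomial β R) (a : α →₀ ℕ)
    (b : β →₀ ℕ) : coeff (Finsupp.sumElim a b) (rename Sum.inl f * rename Sum.inr g) =
      coeff a f * coeff b g := by
  classical
  induction f using MvPolynomial.induction_on' with
  | add p q hp hq => simp only [map_add, add_mul, coeff_add, hp, hq]
  | monomial a' c =>
    induction g using MvPolynomial.induction_on' with
    | add p q hp hq => simp only [map_add, mul_add, coeff_add, hp, hq]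
    | monomial b' c' =>
      rw [rename_monomial, rename_monomial, monomial_mul, mapDomain_inl_add_mapDomain_inr,
        coeff_monomial, coeff_monomial, coeff_monomial]
      simp only [sumElim_inj]
      by_cases h1 : a' = a <;> by_cases h2 : b' = b <;> simp [h1, h2]

theorem ext_sum {f g : MvPolynomial (α ⊕ β) R}
    (h : ∀ a b, coeff (Finsupp.sumElim a b) f = coeff (Finsupp.sumElim a b) g) : f = g := by
  ext m
  obtain ⟨a, b, rfl⟩ := exists_eq_sumElim m
  exact h a b

theorem hasse_rename_mul_rename [Fintype α] [Fintype β] (f : MvPolynomial α R)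
    (g : MvPolynomial β R) (a : α →₀ ℕ) (b : β →₀ ℕ) :
    hasse (Finsupp.sumElim a b) (rename Sum.inl f * rename Sum.inr g) =
      rename Sum.inl (hasse a f) * rename Sum.inr (hasse b g) := by
  refine ext_sum fun a' b' => ?_
  have h : Finsupp.sumElim a' b' + Finsupp.sumElim a b = Finsupp.sumElim (a' + a) (b' + b) := by
    ext x; cases x <;> simp
  have h2 : multiChoose (Finsupp.sumElim (a' + a) (b' + b)) (Finsupp.sumElim a b) =
      multiChoose (a' + a) a * multiChoose (b' + b) b := by
    simp [multiChoose, Fintype.prod_sum_type]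
  rw [coeff_hasse, coeff_rename_mul_rename, h, coeff_rename_mul_rename, coeff_hasse, coeff_hasse,
    h2]
  push_cast
  ring

end SumType

section Slice

variable {σ τ R : Type*} [CommRing R]

/-- The polynomial whose coefficients are selected from those of `p` by the map `e` on
exponents. -/
noncomputable def slice (e : (τ →₀ ℕ) → (σ →₀ ℕ)) (he : Function.Injective e)
    (p : MvPolynomial σ R) : MvPolynomial τ R :=
  ∑ m ∈ p.support.preimage e he.injOn, monomial m (coeff (e m) p)

variable {e : (τ →₀ ℕ) → (σ →₀ ℕ)} {he : Function.Injective e}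

@[simp]
theorem coeff_slice (p : MvPolynomial σ R) (a : τ →₀ ℕ) :
    coeff a (slice e he p) = coeff (e a) p := by
  classical
  simp only [slice, coeff_sum, coeff_monomial]
  rw [Finset.sum_ite_eq']
  split_ifs with h
  · rfl
  · rw [Finset.mem_preimage] at h
    exact (notMem_support_iff.mp h).symm

theorem support_slice (p : MvPolynomial σ R) :
    (slice e he p).support = p.support.preimage e he.injOn := by
  ext a; simp

theorem lOne_slice_le (N : RingSeminorm R) (p : MvPolynomial σ R) :
    lOne N (slice e he p) ≤ lOne N p := by
  classical
  rw [lOne, lOne, support_slice]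
  simp only [coeff_slice]
  rw [Finset.sum_preimage' e p.support he.injOn fun i => N (coeff i p)]
  exact Finset.sum_le_sum_of_subset_of_nonneg (Finset.filter_subset _ _)
    fun _ _ _ => apply_nonneg N _

end Slice

section Decompose

/-- A dependent family on the left of a sum of elementary tensors allows to shorten the sum. -/
theorem exists_shorter_sum {M M' A : Type*} [AddCommGroup M] [AddCommGroup M'] [AddCommGroup A]
    [Module ℚ M] [Module ℚ M'] [Module ℚ A] (B : M →ₗ[ℚ] M' →ₗ[ℚ] A) {s : ℕ} (φ : Fin (s + 1) → M)
    (ψ : Fin (s + 1) → M') (h : ¬ LinearIndependent ℚ φ) :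
    ∃ (φ' : Fin s → M) (ψ' : Fin s → M'), ∑ j : Fin s, B (φ' j) (ψ' j) = ∑ j, B (φ j) (ψ j) := by
  rw [Fintype.linearIndependent_iff] at h
  push Not at h
  obtain ⟨g, hg, i, hi⟩ := h
  rw [Fin.sum_univ_succAbove _ i] at hg
  have hφ : φ i = ∑ j : Fin s, (-(g (i.succAbove j)) / g i) • φ (i.succAbove j) := by
    have h1 : g i • φ i = - ∑ j : Fin s, g (i.succAbove j) • φ (i.succAbove j) :=
      eq_neg_of_add_eq_zero_left hg
    have h2 : φ i = (g i)⁻¹ • (g i • φ i) := by rw [smul_smul, inv_mul_cancel₀ hi, one_smul]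
    rw [h2, h1, ← Finset.sum_neg_distrib, Finset.smul_sum]
    refine Finset.sum_congr rfl fun j _ => ?_
    rw [← neg_smul, smul_smul]
    congr 1
    ring
  refine ⟨fun j => φ (i.succAbove j), fun j => ψ (i.succAbove j) +
    (-(g (i.succAbove j)) / g i) • ψ i, ?_⟩
  rw [Fin.sum_univ_succAbove _ i]
  simp only [map_add, map_smul, Finset.sum_add_distrib]
  rw [add_comm]
  congr 1
  conv_rhs => rw [hφ]
  simp [map_sum, LinearMap.sum_apply]

theorem exists_minimal_decomposition {M M' A : Type*} [AddCommGroup M] [AddCommGroup M']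
    [AddCommGroup A] [Module ℚ M] [Module ℚ M'] [Module ℚ A] (B : M →ₗ[ℚ] M' →ₗ[ℚ] A) (P : A)
    {ι : Type*} (T : Finset ι) (f : ι → M) (g : ι → M') (hP : P = ∑ i ∈ T, B (f i) (g i)) :
    ∃ s ≤ T.card, ∃ φ : Fin s → M, ∃ ψ : Fin s → M', LinearIndependent ℚ φ ∧
      LinearIndependent ℚ ψ ∧ P = ∑ j, B (φ j) (ψ j) := by
  classical
  let S : Set ℕ := {s | ∃ φ : Fin s → M, ∃ ψ : Fin s → M', P = ∑ j, B (φ j) (ψ j)}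
  have hT : T.card ∈ S := by
    refine ⟨fun j => f (T.equivFin.symm j), fun j => g (T.equivFin.symm j), ?_⟩
    rw [hP, ← Finset.sum_coe_sort]
    exact (Equiv.sum_comp T.equivFin.symm fun i : T => B (f i) (g i)).symm
  obtain ⟨φ, ψ, hs⟩ := Nat.sInf_mem ⟨_, hT⟩
  have hmin : ∀ s ∈ S, sInf S ≤ s := fun s hs => Nat.sInf_le hs
  refine ⟨sInf S, hmin _ hT, φ, ψ, ?_, ?_, hs⟩
  · by_contra h
    generalize hn : sInf S = n at *
    cases n with
    | zero => exact h linearIndependent_empty_type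
    | succ n =>
      obtain ⟨φ', ψ', h'⟩ := exists_shorter_sum B φ ψ h
      have := hmin n ⟨φ', ψ', by rw [hs, h']⟩
      omega
  · by_contra h
    generalize hn : sInf S = n at *
    cases n with
    | zero => exact h linearIndependent_empty_type
    | succ n =>
      obtain ⟨ψ', φ', h'⟩ := exists_shorter_sum B.flip ψ φ h
      have := hmin n ⟨φ', ψ', by rw [hs]; exact h'.symm⟩
      omega

end Decompose

section Step

variable {α β : Type*}

theorem sumElim_left_injective (b : β →₀ ℕ) :
    Function.Injective fun a : α →₀ ℕ => Finsupp.sumElim a b :=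
  fun _ _ h => (sumElim_inj.mp h).1

theorem sumElim_right_injective (a : α →₀ ℕ) :
    Function.Injective fun b : β →₀ ℕ => Finsupp.sumElim a b :=
  fun _ _ h => (sumElim_inj.mp h).2

variable [Fintype α] [Fintype β]

/-- The determinant of the Hasse derivatives of `P` indexed by pairs of multi-indices. -/
noncomputable def hasseDet {R : Type*} [CommRing R] {s : ℕ} (a : Fin s → (α →₀ ℕ))
    (b : Fin s → (β →₀ ℕ)) (P : MvPolynomial (α ⊕ β) R) : MvPolynomial (α ⊕ β) R :=
  (Matrix.of fun i l => hasse (Finsupp.sumElim (a i) (b l)) P).det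

theorem exists_hasseDet_factor (P : MvPolynomial (α ⊕ β) ℤ) (hP : P ≠ 0) (T : Finset (β →₀ ℕ))
    (hT : ∀ a b, coeff (Finsupp.sumElim a b) P ≠ 0 → b ∈ T) :
    ∃ s : ℕ, 0 < s ∧ s ≤ T.card ∧ ∃ (a : Fin s → (α →₀ ℕ)) (b : Fin s → (β →₀ ℕ))
      (a₀ : α →₀ ℕ) (b₀ : β →₀ ℕ),
      (∀ i, ∑ j, a i j ≤ i) ∧ (∀ i, ∑ j, b i j ≤ i) ∧
      coeff (Finsupp.sumElim a₀ b₀) (hasseDet a b P) ≠ 0 ∧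
      C (coeff (Finsupp.sumElim a₀ b₀) (hasseDet a b P)) * hasseDet a b P =
        rename Sum.inl (slice _ (sumElim_left_injective b₀) (hasseDet a b P)) *
        rename Sum.inr (slice _ (sumElim_right_injective a₀) (hasseDet a b P)) := by
  classical
  let B : MvPolynomial α ℚ →ₗ[ℚ] MvPolynomial β ℚ →ₗ[ℚ] MvPolynomial (α ⊕ β) ℚ :=
    (LinearMap.mul ℚ (MvPolynomial (α ⊕ β) ℚ)).compl₁₂ (rename Sum.inl).toLinearMap
      (rename Sum.inr).toLinearMap
  have hB : ∀ f g, B f g = rename Sum.inl f * rename Sum.inr g := fun f g => rfl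
  let ι : ℤ →+* ℚ := Int.castRingHom ℚ
  obtain ⟨s, hsT, φ, ψ, hφ, hψ, hPs⟩ := exists_minimal_decomposition B (map ι P) T
    (fun b => slice _ (sumElim_left_injective b) (map ι P)) (fun b => monomial b 1) (by
      refine ext_sum fun a b => ?_
      simp only [hB, coeff_sum, coeff_rename_mul_rename, coeff_slice, coeff_monomial]
      simp only [mul_ite, mul_one, mul_zero, Finset.sum_ite_eq']
      split_ifs with h
      · rfl
      · rw [coeff_map]
        by_contra hne
        exact h (hT a b fun h0 => hne (by rw [h0, map_zero])))
  have hs0 : 0 < s := by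
    rcases Nat.eq_zero_or_pos s with rfl | h
    · exfalso
      rw [Fin.sum_univ_zero] at hPs
      exact hP (map_injective ι Int.cast_injective (by rw [hPs, map_zero]))
    · exact h
  obtain ⟨a, ha, hda⟩ := exists_wronskian_ne_zero s φ hφ
  obtain ⟨b, hb, hdb⟩ := exists_wronskian_ne_zero s ψ hψ
  set Φ := (Matrix.of fun i j => hasse (a i) (φ j)).det with hΦ
  set Ψ := (Matrix.of fun i j => hasse (b i) (ψ j)).det with hΨ
  have hW : map ι (hasseDet a b P) = rename Sum.inl Φ * rename Sum.inr Ψ := by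
    have h1 : map ι (hasseDet a b P) = hasseDet a b (map ι P) := by
      rw [hasseDet, RingHom.map_det, hasseDet]
      congr 1
      ext1 i l
      exact map_hasse ι _ P
    have h2 : (Matrix.of fun i l => hasse (Finsupp.sumElim (a i) (b l)) (map ι P)) =
        ((rename Sum.inl : _ →ₐ[ℚ] MvPolynomial (α ⊕ β) ℚ).toRingHom.mapMatrix
          (Matrix.of fun i j => hasse (a i) (φ j))) *
        ((rename Sum.inr : _ →ₐ[ℚ] MvPolynomial (α ⊕ β) ℚ).toRingHom.mapMatrix
          (Matrix.of fun i j => hasse (b i) (ψ j))).transpose := by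
      ext1 i l
      rw [Matrix.mul_apply, Matrix.of_apply, hPs, hasse_sum]
      exact Finset.sum_congr rfl fun j _ => hasse_rename_mul_rename _ _ _ _
    rw [h1, hasseDet, h2, Matrix.det_mul, Matrix.det_transpose, ← RingHom.map_det,
      ← RingHom.map_det]
    rfl
  have hc : ∀ a' b', ((coeff (Finsupp.sumElim a' b') (hasseDet a b P) : ℤ) : ℚ) =
      coeff a' Φ * coeff b' Ψ := by
    intro a' b'
    rw [← coeff_rename_mul_rename, ← hW, coeff_map]
    rfl
  obtain ⟨a₀, ha₀⟩ := ne_zero_iff.mp hda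
  obtain ⟨b₀, hb₀⟩ := ne_zero_iff.mp hdb
  refine ⟨s, hs0, hsT, a, b, a₀, b₀, ha, hb, ?_, ?_⟩
  · have := hc a₀ b₀
    intro h0
    rw [h0, Int.cast_zero] at this
    exact mul_ne_zero ha₀ hb₀ this.symm
  · refine ext_sum fun a' b' => ?_
    rw [coeff_C_mul, coeff_rename_mul_rename, coeff_slice, coeff_slice]
    apply Int.cast_injective (α := ℚ)
    push_cast
    rw [hc, hc, hc, hc]
    ring

end Step

end SubspaceThm

namespace SubspaceThm

open MvPolynomial

section Det

variable {σ R : Type*} [CommRing R]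

theorem lOne_det_le {N : RingSeminorm R} (hN : N 1 ≤ 1) {s : ℕ}
    (M : Matrix (Fin s) (Fin s) (MvPolynomial σ R)) (B : ℝ) (hB : ∀ i j, lOne N (M i j) ≤ B) :
    lOne N M.det ≤ s.factorial * B ^ s := by
  rw [Matrix.det_apply]
  refine (lOne_sum_le _ _ _).trans ?_
  have h : ∀ π ∈ (Finset.univ : Finset (Equiv.Perm (Fin s))),
      lOne N (Equiv.Perm.sign π • ∏ i, M (π i) i) ≤ B ^ s := by
    intro π _
    have h1 : lOne N (Equiv.Perm.sign π • ∏ i, M (π i) i) = lOne N (∏ i, M (π i) i) := by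
      rcases Int.units_eq_one_or (Equiv.Perm.sign π) with h | h
      · rw [h, one_smul]
      · rw [h, Units.neg_smul, one_smul, lOne_neg]
    rw [h1]
    refine (lOne_prod_le hN _ _).trans ?_
    refine (Finset.prod_le_prod (fun _ _ => lOne_nonneg N _) fun i _ => hB (π i) i).trans ?_
    simp
  refine (Finset.sum_le_sum h).trans ?_
  simp [Fintype.card_perm]

theorem wtGE_det [Fintype σ] {w : σ → ℝ} (hw : ∀ j, 0 ≤ w j) {s : ℕ}
    (M : Matrix (Fin s) (Fin s) (MvPolynomial σ R)) (B : Fin s → ℝ)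
    (hB : ∀ i j, WtGE w (B j) (M i j)) : WtGE w (∑ j, B j) M.det := by
  rw [Matrix.det_apply]
  refine WtGE.sum fun π _ => ?_
  have h := WtGE.prod hw (s := Finset.univ) (B := B) (f := fun i => M (π i) i)
    fun i _ => hB (π i) i
  rcases Int.units_eq_one_or (Equiv.Perm.sign π) with h' | h'
  · rwa [h', one_smul]
  · rw [h', Units.neg_smul, one_smul]
    intro i hi
    rw [support_neg] at hi
    exact h i hi

theorem degreeOf_det_le {s : ℕ} (M : Matrix (Fin s) (Fin s) (MvPolynomial σ R)) (k : σ) (r : ℕ)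
    (hB : ∀ i j, degreeOf k (M i j) ≤ r) : degreeOf k M.det ≤ s * r := by
  rw [Matrix.det_apply]
  refine (degreeOf_sum_le _ _ _).trans (Finset.sup_le fun π _ => ?_)
  have h : degreeOf k (∏ i, M (π i) i) ≤ s * r := by
    refine (degreeOf_prod_le _ _ _).trans ?_
    refine (Finset.sum_le_sum fun i _ => hB (π i) i).trans ?_
    simp
  rcases Int.units_eq_one_or (Equiv.Perm.sign π) with h' | h'
  · rwa [h', one_smul]
  · rw [h', Units.neg_smul, one_smul, degreeOf_neg]
    exact h

end Det

section OneVariable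

theorem coeff_aeval_X {R : Type*} [CommRing R] (p : MvPolynomial (Fin 1) R) (n : ℕ) :
    (aeval (fun _ => (Polynomial.X : Polynomial R)) p).coeff n =
      coeff (Finsupp.single 0 n) p := by
  classical
  induction p using MvPolynomial.induction_on' with
  | add p q hp hq => simp [hp, hq]
  | monomial a c =>
    have ha : a = Finsupp.single 0 (a 0) := by
      ext
      simp
    rw [aeval_monomial, coeff_monomial, ha]
    simp [Polynomial.coeff_C_mul, Polynomial.coeff_X_pow, eq_comm]

/-- A nonzero integral polynomial with a zero of order `k` at `p / q` has a coefficient divisible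
by `q ^ k`. -/
theorem pow_le_lOne_of_order (V : MvPolynomial (Fin 1) ℤ) (hV : V ≠ 0) (p : ℤ) (q : ℕ)
    (hq : 0 < q) (hpq : IsCoprime p q) (k : ℕ)
    (h : ∀ i ∈ (translate (fun _ => (p / q : ℚ)) (map (Int.castRingHom ℚ) V)).support, k ≤ i 0) :
    (q : ℝ) ^ k ≤ lOne (normRingSeminorm ℤ) V := by
  set ι := Int.castRingHom ℚ
  set ξ : ℚ := p / q
  set v : Polynomial ℤ := aeval (fun _ => (Polynomial.X : Polynomial ℤ)) V with hv
  set t : Polynomial ℚ := aeval (fun _ => (Polynomial.X : Polynomial ℚ))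
    (translate (fun _ => ξ) (map ι V)) with ht
  have hvι : v.map ι = aeval (fun _ => (Polynomial.X : Polynomial ℚ)) (map ι V) := by
    ext n
    rw [Polynomial.coeff_map, coeff_aeval_X, coeff_aeval_X, coeff_map]
  have hX : Polynomial.X ^ k ∣ t := by
    rw [Polynomial.X_pow_dvd_iff]
    intro d hd
    rw [ht, coeff_aeval_X]
    by_contra hne
    have := h _ (mem_support_iff.mpr hne)
    simp at this
    omega
  have htv : v.map ι = Polynomial.aeval (Polynomial.X - Polynomial.C ξ) t := by
    rw [hvι, ht]
    have : (aeval (fun _ => (Polynomial.X : Polynomial ℚ)) : MvPolynomial (Fin 1) ℚ →ₐ[ℚ] _) =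
        ((Polynomial.aeval (Polynomial.X - Polynomial.C ξ)).comp (aeval fun _ =>
          (Polynomial.X : Polynomial ℚ))).comp (translate fun _ => ξ) := by
      ext j
      simp [translate]
    exact DFunLike.congr_fun this _
  set u : Polynomial ℤ := Polynomial.C (q : ℤ) * Polynomial.X + Polynomial.C (-p) with hu
  have hq0 : (q : ℤ) ≠ 0 := by exact_mod_cast hq.ne'
  have hprim : u.IsPrimitive := by
    intro c hc
    have h1 := (Polynomial.C_dvd_iff_dvd_coeff _ _).mp hc 0
    have h2 := (Polynomial.C_dvd_iff_dvd_coeff _ _).mp hc 1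
    rw [hu, Polynomial.coeff_add, Polynomial.coeff_C_mul, Polynomial.coeff_C] at h1 h2
    simp at h1 h2
    exact hpq.isUnit_of_dvd' h1 h2
  have hprimk : ∀ k : ℕ, (u ^ k).IsPrimitive := by
    intro k
    induction k with
    | zero => simp
    | succ k ih => rw [pow_succ]; exact ih.mul hprim
  have hdvd : u ^ k ∣ v := by
    rw [Polynomial.IsPrimitive.Int.dvd_iff_map_cast_dvd_map_cast _ _ (hprimk k)]
    · obtain ⟨g, hg⟩ := hX
      have h1 : u.map ι = Polynomial.C (q : ℚ) * (Polynomial.X - Polynomial.C ξ) := by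
        have hq' : (q : ℚ) ≠ 0 := by exact_mod_cast hq.ne'
        have hp' : (p : ℚ) = q * ξ := by rw [mul_div_cancel₀ _ hq']
        have hp'' : Polynomial.C (p : ℚ) = Polynomial.C (q : ℚ) * Polynomial.C ξ := by
          rw [← Polynomial.C_mul, ← hp']
        have hu' : u.map ι = Polynomial.C (q : ℚ) * Polynomial.X - Polynomial.C (p : ℚ) := by
          simp only [hu, Polynomial.map_add, Polynomial.map_mul, Polynomial.map_C,
            Polynomial.map_X, map_neg, sub_eq_add_neg, ι]
          simp
        rw [hu', hp'', mul_sub]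
      have hunit : IsUnit (Polynomial.C (q : ℚ) ^ k) :=
        (Polynomial.isUnit_C.mpr (by simpa using hq.ne')).pow k
      change (u ^ k).map ι ∣ v.map ι
      rw [htv, hg, Polynomial.map_pow, h1, map_mul, map_pow, Polynomial.aeval_X, mul_pow,
        hunit.mul_left_dvd]
      exact dvd_mul_right _ _
  have hv0 : v ≠ 0 := by
    intro h0
    apply hV
    ext m
    have hm : m = Finsupp.single 0 (m 0) := by
      ext
      simp
    rw [hm, ← coeff_aeval_X, ← hv, h0]
    simp
  have hlc : (q : ℤ) ^ k ∣ v.leadingCoeff := by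
    obtain ⟨g, hg⟩ := hdvd
    have : u.leadingCoeff = q := Polynomial.leadingCoeff_linear hq0
    rw [hg, Polynomial.leadingCoeff_mul, Polynomial.leadingCoeff_pow, this]
    exact dvd_mul_right _ _
  have h1 := Int.le_of_dvd (abs_pos.mpr (Polynomial.leadingCoeff_ne_zero.mpr hv0))
    ((dvd_abs _ _).mpr hlc)
  have h2 := coeff_le_lOne (normRingSeminorm ℤ) V (Finsupp.single 0 v.natDegree)
  rw [← coeff_aeval_X] at h2
  refine le_trans ?_ h2
  change _ ≤ ‖v.leadingCoeff‖
  rw [Int.norm_eq_abs]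
  exact_mod_cast h1

end OneVariable

end SubspaceThm

namespace SubspaceThm

open MvPolynomial

section RothStep

theorem translate_rename {σ τ R : Type*} [CommRing R] (f : σ → τ) (ξ : τ → R)
    (p : MvPolynomial σ R) :
    translate ξ (rename f p) = rename f (translate (fun j => ξ (f j)) p) := by
  have : (translate ξ).comp (rename f) = (rename f).comp (translate fun j => ξ (f j)) := by
    ext j; simp [translate]
  exact DFunLike.congr_fun this p

/-- The lower bound for the total index of a generalized Wronskian. -/
theorem sum_max_ge {ε : ℝ} (hε : 0 < ε) (hε1 : ε ≤ 1) {s n : ℕ} (hs : s ≤ n + 1)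
    (hn : 0 < n) : s * (ε ^ 2 / 32) ≤ ∑ l : Fin s, max (ε / 2 - (l : ℝ) / n) 0 := by
  have hn' : (0 : ℝ) < n := by exact_mod_cast hn
  rw [Fin.sum_univ_eq_sum_range (fun l => max (ε / 2 - (l : ℝ) / n) 0) s]
  set k := min s (⌊ε * n / 4⌋₊ + 1) with hk
  have hk1 : (s : ℝ) * (ε / 8) ≤ k := by
    have h1 : (s : ℝ) ≤ 2 * n := by
      have : s ≤ 2 * n := by omega
      exact_mod_cast this
    rw [hk, Nat.cast_min]
    refine le_min ?_ ?_
    · have : (0 : ℝ) ≤ s := Nat.cast_nonneg s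
      nlinarith
    · push_cast
      have := Nat.lt_floor_add_one (ε * n / 4)
      nlinarith
  have h2 : ∑ l ∈ Finset.range k, (ε / 4 : ℝ) ≤
      ∑ l ∈ Finset.range k, max (ε / 2 - (l : ℝ) / n) 0 := by
    refine Finset.sum_le_sum fun l hl => le_max_of_le_left ?_
    have hl' : l ≤ ⌊ε * n / 4⌋₊ := by
      have := Finset.mem_range.mp hl
      omega
    have h3 : (l : ℝ) ≤ ε * n / 4 :=
      (Nat.cast_le.mpr hl').trans (Nat.floor_le (by positivity))
    have h4 : (l : ℝ) / n ≤ ε / 4 := by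
      rw [div_le_iff₀ hn']
      linarith
    linarith
  have h3 : ∑ l ∈ Finset.range k, max (ε / 2 - (l : ℝ) / n) 0 ≤
      ∑ l ∈ Finset.range s, max (ε / 2 - (l : ℝ) / n) 0 :=
    Finset.sum_le_sum_of_subset_of_nonneg (Finset.range_mono (min_le_left _ _))
      fun _ _ _ => le_max_right _ _
  rw [Finset.sum_const, Finset.card_range, nsmul_eq_mul] at h2
  refine le_trans ?_ (h2.trans h3)
  nlinarith

variable {α : Type*} [Fintype α]

theorem roth_step {ε : ℝ} (hε : 0 < ε) (hε1 : ε ≤ 1) (r : α → ℕ) (n : ℕ) (hr : ∀ h, 0 < r h)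
    (hn : 0 < n) (hsmall : ∀ h, (n : ℝ) ≤ ε / 2 * r h) (ξ : α → ℚ) (η : ℚ)
    (P : MvPolynomial (α ⊕ Fin 1) ℤ) (hP : P ≠ 0) (hdeg : ∀ h, degreeOf (Sum.inl h) P ≤ r h)
    (hdegn : degreeOf (Sum.inr 0) P ≤ n)
    (hw : WtGE (Sum.elim (fun h => 1 / (r h : ℝ)) fun _ => 1 / (n : ℝ)) ε
      (translate (Sum.elim ξ fun _ => η) (map (Int.castRingHom ℚ) P))) :
    ∃ s : ℕ, 0 < s ∧ s ≤ n + 1 ∧ ∃ (U : MvPolynomial α ℤ) (V : MvPolynomial (Fin 1) ℤ),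
      U ≠ 0 ∧ V ≠ 0 ∧
      lOne (normRingSeminorm ℤ) U ≤ s.factorial *
        (2 ^ (∑ h, r h + n) * lOne (normRingSeminorm ℤ) P) ^ s ∧
      lOne (normRingSeminorm ℤ) V ≤ s.factorial *
        (2 ^ (∑ h, r h + n) * lOne (normRingSeminorm ℤ) P) ^ s ∧
      (∀ h, degreeOf h U ≤ s * r h) ∧
      (WtGE (fun h => 1 / (r h : ℝ)) (s * (ε ^ 2 / 64))
          (translate ξ (map (Int.castRingHom ℚ) U)) ∨
        WtGE (fun _ => 1 / (n : ℝ)) (s * (ε ^ 2 / 64))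
          (translate (fun _ => η) (map (Int.castRingHom ℚ) V))) := by
  classical
  set ι := Int.castRingHom ℚ
  set w : α ⊕ Fin 1 → ℝ := Sum.elim (fun h => 1 / (r h : ℝ)) fun _ => 1 / (n : ℝ) with hwdef
  have hw0 : ∀ j, 0 ≤ w j := by
    rintro (j | j) <;> simp [w]
  have hn' : (0 : ℝ) < n := by exact_mod_cast hn
  let T : Finset (Fin 1 →₀ ℕ) := (Finset.range (n + 1)).image fun k => Finsupp.single 0 k
  have hT : ∀ a b, coeff (Finsupp.sumElim a b) P ≠ 0 → b ∈ T := by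
    intro a b hab
    have h1 := monomial_le_degreeOf (Sum.inr 0) (mem_support_iff.mpr hab)
    rw [Finsupp.sumElim_inr] at h1
    refine Finset.mem_image.mpr ⟨b 0, Finset.mem_range.mpr (by omega), ?_⟩
    ext
    simp
  obtain ⟨s, hs0, hsT, a, b, a₀, b₀, ha, hb, hne, hfac⟩ := exists_hasseDet_factor P hP T hT
  have hsn : s ≤ n + 1 := hsT.trans (Finset.card_image_le.trans (by simp))
  set W := hasseDet a b P with hW
  set U := slice _ (sumElim_left_injective b₀) W with hU
  set V := slice _ (sumElim_right_injective a₀) W with hV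
  have hWnorm : lOne (normRingSeminorm ℤ) W ≤ s.factorial *
        (2 ^ (∑ h, r h + n) * lOne (normRingSeminorm ℤ) P) ^ s := by
    refine lOne_det_le (by change ‖(1 : ℤ)‖ ≤ 1; simp) _ _ fun i j => ?_
    refine (lOne_hasse_le _ P (Sum.elim r fun _ => n) ?_).trans (by simp)
    rintro (h | h)
    · exact hdeg h
    · rw [Subsingleton.elim h 0]; exact hdegn
  have hWdeg : ∀ h, degreeOf (Sum.inl h) W ≤ s * r h := fun h =>
    degreeOf_det_le _ _ _ fun i j => (degreeOf_hasse_le _ _ _).trans (hdeg h)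
  refine ⟨s, hs0, hsn, U, V, ?_, ?_, (lOne_slice_le _ _).trans hWnorm,
    (lOne_slice_le _ _).trans hWnorm, ?_, ?_⟩
  · exact ne_zero_iff.mpr ⟨a₀, by rw [hU, coeff_slice]; exact hne⟩
  · exact ne_zero_iff.mpr ⟨b₀, by rw [hV, coeff_slice]; exact hne⟩
  · intro h
    rw [degreeOf_le_iff]
    intro a' ha'
    rw [hU, support_slice, Finset.mem_preimage] at ha'
    exact (monomial_le_degreeOf (Sum.inl h) ha').trans (hWdeg h)
  · have hWt : WtGE w (s * (ε ^ 2 / 32)) (translate (Sum.elim ξ fun _ => η) (map ι W)) := by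
      have h1 : translate (Sum.elim ξ fun _ => η) (map ι W) =
          (Matrix.of fun i l => hasse (Finsupp.sumElim (a i) (b l))
            (translate (Sum.elim ξ fun _ => η) (map ι P))).det := by
        rw [hW, hasseDet, RingHom.map_det, AlgHom.map_det]
        congr 1
        ext1 i l
        simp only [RingHom.mapMatrix_apply, AlgHom.mapMatrix_apply, Matrix.map_apply,
          Matrix.of_apply]
        rw [map_hasse, hasse_translate]
      rw [h1]
      refine WtGE.mono (wtGE_det hw0 _ (fun l => max (ε / 2 - (l : ℝ) / n) 0) fun i l => ?_)
        (sum_max_ge hε hε1 hsn hn)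
      rcases le_total (ε / 2 - (l : ℝ) / n) 0 with h0 | h0
      · rw [max_eq_right h0]
        exact wtGE_of_nonpos hw0 le_rfl _
      · rw [max_eq_left h0]
        refine (hw.hasse (Finsupp.sumElim (a i) (b l))).mono ?_
        rw [Fintype.sum_sum_type]
        simp only [Finsupp.sumElim_inl, Finsupp.sumElim_inr, hwdef, Sum.elim_inl, Sum.elim_inr]
        have h2 : ∑ h, (a i h : ℝ) * (1 / r h) ≤ ε / 2 := by
          have h3 : ∀ h ∈ Finset.univ, (a i h : ℝ) * (1 / r h) ≤ a i h * (ε / 2 / n) := by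
            intro h _
            refine mul_le_mul_of_nonneg_left ?_ (Nat.cast_nonneg _)
            have hr' : (0 : ℝ) < r h := by exact_mod_cast hr h
            rw [div_le_div_iff₀ hr' hn']
            linarith [hsmall h]
          refine (Finset.sum_le_sum h3).trans ?_
          rw [← Finset.sum_mul, ← Nat.cast_sum]
          have h4 : ∑ h, a i h ≤ n := (ha i).trans (by have := i.2; omega)
          calc ((∑ h, a i h : ℕ) : ℝ) * (ε / 2 / n) ≤ n * (ε / 2 / n) := by
                refine mul_le_mul_of_nonneg_right (Nat.cast_le.mpr h4) (by positivity)
            _ = ε / 2 := by field_simp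
        have h5 : ∑ h, (b l h : ℝ) * (1 / n) ≤ (l : ℝ) / n := by
          rw [← Finset.sum_mul, ← Nat.cast_sum, mul_one_div]
          exact div_le_div_of_nonneg_right (Nat.cast_le.mpr (hb l)) hn'.le
        linarith
    by_contra hcon
    push Not at hcon
    obtain ⟨hcU, hcV⟩ := hcon
    simp only [WtGE, not_forall, not_le] at hcU hcV
    obtain ⟨a', ha', hwa⟩ := hcU
    obtain ⟨b', hb', hwb⟩ := hcV
    have hprod : C (ι (coeff (Finsupp.sumElim a₀ b₀) W)) *
        translate (Sum.elim ξ fun _ => η) (map ι W) =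
        rename Sum.inl (translate ξ (map ι U)) *
          rename Sum.inr (translate (fun _ => η) (map ι V)) := by
      have h1 := congrArg (fun p => translate (Sum.elim ξ fun _ => η) (map ι p)) hfac
      simp only [map_mul, map_C, map_rename, translate_rename] at h1
      refine Eq.trans ?_ h1
      simp [translate]
    have hcoef := congrArg (coeff (Finsupp.sumElim a' b')) hprod
    rw [coeff_rename_mul_rename, coeff_C_mul] at hcoef
    have hmem : Finsupp.sumElim a' b' ∈
        (translate (Sum.elim ξ fun _ => η) (map ι W)).support := by
      rw [mem_support_iff]
      intro h0
      rw [h0, mul_zero] at hcoef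
      exact mul_ne_zero (mem_support_iff.mp ha') (mem_support_iff.mp hb') hcoef.symm
    have := hWt _ hmem
    rw [Fintype.sum_sum_type] at this
    simp only [Finsupp.sumElim_inl, Finsupp.sumElim_inr, hwdef, Sum.elim_inl, Sum.elim_inr] at this
    have hs' : (0 : ℝ) < s := by exact_mod_cast hs0
    nlinarith

end RothStep

end SubspaceThm

namespace SubspaceThm

open MvPolynomial

theorem lOne_rename_of_injective {σ τ R : Type*} [CommRing R] (N : RingSeminorm R) {f : σ → τ}
    (hf : Function.Injective f) (p : MvPolynomial σ R) : lOne N (rename f p) = lOne N p := by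
  classical
  rw [lOne, lOne, support_rename_of_injective hf, Finset.sum_image
    (Finsupp.mapDomain_injective hf).injOn]
  exact Finset.sum_congr rfl fun i _ => by rw [coeff_rename_mapDomain f hf]

theorem wtGE_rename_equiv {σ τ R : Type*} [Fintype σ] [Fintype τ] [CommRing R] (e : σ ≃ τ)
    {w : τ → ℝ} {B : ℝ} {p : MvPolynomial σ R} (h : WtGE w B (rename e p)) :
    WtGE (fun j => w (e j)) B p := by
  classical
  intro i hi
  have h1 := h (Finsupp.mapDomain e i) (by
    rw [support_rename_of_injective e.injective]
    exact Finset.mem_image_of_mem _ hi)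
  rw [← e.sum_comp] at h1
  simpa [Finsupp.mapDomain_apply e.injective] using h1

theorem one_le_lOne {σ : Type*} {p : MvPolynomial σ ℤ} (hp : p ≠ 0) :
    1 ≤ lOne (normRingSeminorm ℤ) p := by
  obtain ⟨i, hi⟩ := ne_zero_iff.mp hp
  refine le_trans ?_ (coeff_le_lOne _ p i)
  change 1 ≤ ‖coeff i p‖
  rw [Int.norm_eq_abs]
  exact_mod_cast Int.one_le_abs hi

/-- **Roth's lemma**: an integral polynomial of small height has small index at a rational point
of large height. -/
theorem roth_lemma (m : ℕ) : ∀ ε : ℝ, 0 < ε → ε ≤ 1 → ∃ ω : ℝ, 0 < ω ∧ ω ≤ 1 ∧ ∃ K : ℝ, 1 ≤ K ∧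
    ∀ (r : Fin m → ℕ) (R : ℕ) (p : Fin m → ℤ) (q : Fin m → ℕ) (Z : ℝ)
      (P : MvPolynomial (Fin m) ℤ), (∀ h, 0 < r h) → (∀ h, r h ≤ R) →
      (∀ h h', h < h' → (r h' : ℝ) ≤ ω * r h) → (∀ h, 0 < q h) → (∀ h, IsCoprime (p h) (q h)) →
      1 ≤ Z → (∀ h, Z ≤ (q h : ℝ) ^ r h) → P ≠ 0 → (∀ h, degreeOf h P ≤ r h) →
      K ^ R * lOne (normRingSeminorm ℤ) P ≤ Z ^ ω →
      ¬ WtGE (fun h => 1 / (r h : ℝ)) ε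
        (translate (fun h => (p h / q h : ℚ)) (map (Int.castRingHom ℚ) P)) := by
  induction m with
  | zero =>
    intro ε hε _
    refine ⟨1, one_pos, le_rfl, 1, le_rfl, ?_⟩
    intro r R p q Z P _ _ _ _ _ _ _ hP _ _ hw
    have hne : translate (fun h => (p h / q h : ℚ)) (map (Int.castRingHom ℚ) P) ≠ 0 := by
      intro h0
      refine hP (map_injective (Int.castRingHom ℚ) Int.cast_injective
        (translate_injective (fun h => (p h / q h : ℚ)) ?_))
      rw [h0, map_zero, map_zero]
    obtain ⟨i, hi⟩ := ne_zero_iff.mp hne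
    have := hw i (mem_support_iff.mpr hi)
    simp at this
    linarith
  | succ m ih =>
    intro ε hε hε1
    have hεs : ε ^ 2 / 64 ≤ ε / 2 := by nlinarith
    obtain ⟨ω₁, hω₁, hω₁1, K₁, hK₁, ihm⟩ := ih (ε ^ 2 / 64) (by positivity) (by nlinarith)
    refine ⟨min ω₁ (ε ^ 2 / 64), by positivity, (min_le_left _ _).trans hω₁1,
      K₁ * 2 ^ (m + 3), ?_, ?_⟩
    · exact one_le_mul_of_one_le_of_one_le hK₁ (one_le_pow₀ (by norm_num))
    intro r R p q Z P hr hR hlac hq hpq hZ hZq hP hdeg hnorm hw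
    set ω := min ω₁ (ε ^ 2 / 64) with hω
    set ι := Int.castRingHom ℚ
    let e : Fin m ⊕ Fin 1 ≃ Fin (m + 1) := finSumFinEquiv
    let rl := r (Fin.last m)
    let P' : MvPolynomial (Fin m ⊕ Fin 1) ℤ := rename e.symm P
    have heP : rename e P' = P := by simp [P', rename_rename]
    have hel : ∀ h : Fin m, e (Sum.inl h) = h.castSucc := fun h => rfl
    have her : ∀ h : Fin 1, e (Sum.inr h) = Fin.last m := fun h => by
      rw [Subsingleton.elim h 0]; rfl
    have hP' : P' ≠ 0 := by
      intro h0; apply hP; rw [← heP, h0, map_zero]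
    have hdeg' : ∀ j, degreeOf j P' ≤ r (e j) := fun j => by
      have := degreeOf_rename_of_injective (p := P') e.injective j
      rw [heP] at this
      rw [← this]
      exact hdeg _
    have hnorm' : lOne (normRingSeminorm ℤ) P' = lOne (normRingSeminorm ℤ) P :=
      lOne_rename_of_injective _ e.symm.injective P
    have hωε : ω ≤ ε / 2 := (min_le_right _ _).trans hεs
    obtain ⟨s, hs0, hsn, U, V, hU, hV, hUn, hVn, hUdeg, hUV⟩ := roth_step hε hε1
      (fun h : Fin m => r h.castSucc) rl (fun h => hr _) (hr _)
      (fun h => (hlac _ _ (Fin.castSucc_lt_last h)).trans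
        (mul_le_mul_of_nonneg_right hωε (Nat.cast_nonneg _)))
      (fun h => (p h.castSucc / q h.castSucc : ℚ)) (p (Fin.last m) / q (Fin.last m) : ℚ)
      P' hP' (fun h => hdeg' (Sum.inl h)) (hdeg' (Sum.inr 0)) (by
        rw [← heP, map_rename, translate_rename] at hw
        have h1 := wtGE_rename_equiv e hw
        convert h1 using 2
        · rename_i j
          cases j <;> simp [hel, her, rl]
        · congr 1
          ext j
          cases j <;> simp [hel, her])
    set A := lOne (normRingSeminorm ℤ) P with hA
    have hA1 : 1 ≤ A := one_le_lOne hP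
    have hR1 : 1 ≤ R := (hr (Fin.last m)).trans_le (hR _)
    have hbound : (s.factorial : ℝ) * (2 ^ (∑ h : Fin m, r h.castSucc + rl) *
        lOne (normRingSeminorm ℤ) P') ^ s ≤ (((2 : ℝ) ^ (m + 2)) ^ R * A) ^ s := by
      rw [hnorm']
      have h1 : (s.factorial : ℝ) ≤ ((2 : ℝ) ^ R) ^ s := by
        have h2 : s ≤ 2 ^ R := by
          have : rl < 2 ^ rl := Nat.lt_two_pow_self
          have h3 : 2 ^ rl ≤ 2 ^ R := Nat.pow_le_pow_right (by norm_num) (hR _)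
          omega
        calc (s.factorial : ℝ) ≤ (s : ℝ) ^ s := by exact_mod_cast Nat.factorial_le_pow s
          _ ≤ _ := by
            refine pow_le_pow_left₀ (Nat.cast_nonneg _) ?_ _
            exact_mod_cast h2
      have h4 : (2 : ℝ) ^ (∑ h : Fin m, r h.castSucc + rl) ≤ 2 ^ ((m + 1) * R) := by
        refine pow_le_pow_right₀ (by norm_num) ?_
        have : ∑ h : Fin m, r h.castSucc ≤ ∑ _h : Fin m, R := Finset.sum_le_sum fun h _ => hR _
        simp at this
        have h5 : rl ≤ R := hR _
        nlinarith
      calc (s.factorial : ℝ) * (2 ^ (∑ h : Fin m, r h.castSucc + rl) * A) ^ s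
          ≤ ((2 : ℝ) ^ R) ^ s * (2 ^ ((m + 1) * R) * A) ^ s := by gcongr
        _ = (((2 : ℝ) ^ (m + 2)) ^ R * A) ^ s := by
          rw [← mul_pow, ← mul_assoc, ← pow_add, ← pow_mul]
          ring_nf
    have hs' : (0 : ℝ) < s := by exact_mod_cast hs0
    have hZs : (1 : ℝ) ≤ Z ^ s := one_le_pow₀ hZ
    have hKbound : ∀ k : ℝ, 1 ≤ k → k ≤ K₁ * 2 → k ^ (s * R) *
        (((2 : ℝ) ^ (m + 2)) ^ R * A) ^ s ≤ (Z ^ ω) ^ s := by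
      intro k hk1 hk
      have h1 : k ^ R * (((2 : ℝ) ^ (m + 2)) ^ R * A) ≤ Z ^ ω := by
        refine le_trans ?_ hnorm
        rw [← mul_assoc, ← mul_pow]
        have h2 : k * 2 ^ (m + 2) ≤ K₁ * 2 ^ (m + 3) := by
          calc k * 2 ^ (m + 2) ≤ K₁ * 2 * 2 ^ (m + 2) := by gcongr
            _ = K₁ * 2 ^ (m + 3) := by ring
        exact mul_le_mul_of_nonneg_right (pow_le_pow_left₀ (by positivity) h2 _) (by linarith)
      calc _ = (k ^ R * (((2 : ℝ) ^ (m + 2)) ^ R * A)) ^ s := by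
            rw [mul_pow (k ^ R), ← pow_mul k, mul_comm s R]
        _ ≤ _ := by gcongr
    rcases hUV with hUV | hUV
    · refine ihm (fun h => s * r h.castSucc) (s * R) (fun h => p h.castSucc)
        (fun h => q h.castSucc) (Z ^ s) U (fun h => Nat.mul_pos hs0 (hr _))
        (fun h => Nat.mul_le_mul_left s (hR _)) (fun h h' hh => ?_) (fun h => hq _)
        (fun h => hpq _) hZs (fun h => ?_) hU hUdeg ?_ ?_
      · have h1 := hlac h.castSucc h'.castSucc (by simpa using hh)
        have h2 : ω * r h.castSucc ≤ ω₁ * r h.castSucc :=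
          mul_le_mul_of_nonneg_right (min_le_left _ _) (Nat.cast_nonneg _)
        push_cast
        nlinarith
      · rw [mul_comm, pow_mul]
        exact pow_le_pow_left₀ (by linarith) (hZq _) _
      · have h1 := hKbound K₁ hK₁ (by linarith)
        have h2 : (Z ^ ω) ^ s ≤ (Z ^ s) ^ ω₁ := by
          rw [← Real.rpow_natCast, ← Real.rpow_natCast, ← Real.rpow_mul (by linarith),
            ← Real.rpow_mul (by linarith), mul_comm]
          exact Real.rpow_le_rpow_of_exponent_le hZ
            (mul_le_mul_of_nonneg_left (min_le_left _ _) hs'.le)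
        refine le_trans ?_ (h1.trans h2)
        exact mul_le_mul_of_nonneg_left (hUn.trans hbound) (by positivity)
      · intro i hi
        have h1 := hUV i hi
        have h2 : ∑ j, (i j : ℝ) * (1 / ((s * r j.castSucc : ℕ) : ℝ)) =
            (∑ j, (i j : ℝ) * (1 / (r j.castSucc : ℝ))) / s := by
          rw [Finset.sum_div]
          refine Finset.sum_congr rfl fun j _ => ?_
          push_cast
          field_simp
        rw [h2, le_div_iff₀ hs']
        linarith
    · set θ : ℝ := s * (ε ^ 2 / 64) with hθ
      have hrl : (0 : ℝ) < rl := by exact_mod_cast hr (Fin.last m)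
      have h1 := pow_le_lOne_of_order V hV (p (Fin.last m)) (q (Fin.last m)) (hq _) (hpq _)
        ⌈θ * rl⌉₊ (fun i hi => by
          have h2 := hUV i hi
          rw [Fin.sum_univ_one, mul_one_div, le_div_iff₀ hrl] at h2
          exact Nat.ceil_le.mpr h2)
      have hq1 : (1 : ℝ) ≤ q (Fin.last m) := by exact_mod_cast hq _
      have h3 : Z ^ θ ≤ lOne (normRingSeminorm ℤ) V := by
        refine le_trans ?_ h1
        calc Z ^ θ ≤ ((q (Fin.last m) : ℝ) ^ rl) ^ θ :=
              Real.rpow_le_rpow (by linarith) (hZq _) (by positivity)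
          _ = (q (Fin.last m) : ℝ) ^ (θ * rl) := by
              rw [← Real.rpow_natCast, ← Real.rpow_mul (by linarith), mul_comm]
          _ ≤ (q (Fin.last m) : ℝ) ^ ((⌈θ * rl⌉₊ : ℕ) : ℝ) :=
              Real.rpow_le_rpow_of_exponent_le hq1 (Nat.le_ceil _)
          _ = _ := Real.rpow_natCast _ _
      have h4 := hKbound 2 (by norm_num) (by linarith)
      have h5 : (Z ^ ω) ^ s ≤ Z ^ θ := by
        rw [← Real.rpow_natCast, ← Real.rpow_mul (by linarith), mul_comm]
        exact Real.rpow_le_rpow_of_exponent_le hZ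
          (mul_le_mul_of_nonneg_left (min_le_right _ _) hs'.le)
      have h6 : (1 : ℝ) < 2 ^ (s * R) := one_lt_pow₀ (by norm_num)
        (Nat.mul_pos hs0 hR1).ne'
      have h7 : 0 < (((2 : ℝ) ^ (m + 2)) ^ R * A) ^ s := by positivity
      have h8 := hVn.trans hbound
      nlinarith

end SubspaceThm

namespace SubspaceThm

section AlgRing

attribute [local instance] Matrix.linftyOpNormedRing

theorem exists_algRing (S : Finset ℝ) (hS : ∀ x ∈ S, IsIntegral ℤ x) :
    ∃ (R : Subalgebra ℤ ℝ) (N : RingSeminorm R) (D : ℕ) (φ : R →+* Matrix (Fin D) (Fin D) ℤ),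
      (∀ x ∈ S, x ∈ R) ∧ N 1 ≤ 1 ∧ Function.Injective φ ∧
      (∀ r i j, |((φ r i j : ℤ) : ℝ)| ≤ N r) ∧
      ∃ C : ℝ, 0 < C ∧ ∀ r : R, r ≠ 0 → 1 ≤ |(r : ℝ)| * (C * max 1 (N r) ^ D) := by
  classical
  let R : Subalgebra ℤ ℝ := Algebra.adjoin ℤ (S : Set ℝ)
  have hfg : (Subalgebra.toSubmodule R).FG :=
    fg_adjoin_of_finite S.finite_toSet hS
  have : Module.Finite ℤ R := Module.Finite.iff_fg.mpr hfg
  have : Module.Free ℤ R := inferInstance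
  let D := Module.finrank ℤ R
  let b : Module.Basis (Fin D) ℤ R := Module.finBasis ℤ R
  have : Nonempty (Fin D) := b.index_nonempty
  let φ : R →+* Matrix (Fin D) (Fin D) ℤ := (Algebra.leftMulMatrix b).toRingHom
  have hφ : Function.Injective φ := Algebra.leftMulMatrix_injective b
  let N : RingSeminorm R :=
    { toFun := fun r => ‖φ r‖
      map_zero' := by simp
      add_le' := fun x y => by rw [map_add]; exact norm_add_le _ _
      neg' := fun x => by rw [map_neg, norm_neg]
      mul_le' := fun x y => by rw [map_mul]; exact norm_mul_le _ _ }
  have hN : ∀ r, N r = ‖φ r‖ := fun r => rfl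
  have hent : ∀ r i j, |((φ r i j : ℤ) : ℝ)| ≤ N r := by
    intro r i j
    rw [hN, Matrix.linfty_opNorm_def]
    have h1 : ‖φ r i j‖₊ ≤ ∑ j, ‖φ r i j‖₊ :=
      Finset.single_le_sum (f := fun j => ‖φ r i j‖₊) (fun _ _ => zero_le) (Finset.mem_univ j)
    have h2 : ∑ j, ‖φ r i j‖₊ ≤ Finset.univ.sup fun i => ∑ j, ‖φ r i j‖₊ :=
      Finset.le_sup (f := fun i => ∑ j, ‖φ r i j‖₊) (Finset.mem_univ i)
    have h3 : ((‖φ r i j‖₊ : NNReal) : ℝ) ≤ _ := NNReal.coe_le_coe.mpr (h1.trans h2)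
    rw [coe_nnnorm, Int.norm_eq_abs] at h3
    exact_mod_cast h3
  refine ⟨R, N, D, φ, fun x hx => Algebra.subset_adjoin hx, ?_, hφ, hent, ?_⟩
  · rw [hN, map_one]; simp
  · refine ⟨D * D.factorial, ?_, ?_⟩
    · have : 0 < D := Fin.pos_iff_nonempty.mpr inferInstance
      positivity
    intro r hr
    set X := max 1 (N r) with hX
    have hX1 : 1 ≤ X := le_max_left _ _
    have hdet : (φ r).det ≠ 0 := by
      have h := Algebra.norm_eq_matrix_det b r
      change _ = (φ r).det at h
      rw [← h]
      exact Algebra.norm_ne_zero_iff.mpr hr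
    let A : Matrix (Fin D) (Fin D) ℝ := (φ r).map (Int.castRingHom ℝ)
    let ω : Fin D → ℝ := fun i => ((b i : R) : ℝ)
    have hω : Matrix.vecMul ω A = (r : ℝ) • ω := by
      funext j
      have h1 : r * b j = ∑ i, φ r i j • b i := by
        rw [← b.sum_repr (r * b j)]
        refine Finset.sum_congr rfl fun i _ => ?_
        change _ = Algebra.leftMulMatrix b r i j • b i
        rw [Algebra.leftMulMatrix_eq_repr_mul]
      have h2 := congrArg (fun z : R => (z : ℝ)) h1
      simp only [MulMemClass.coe_mul, AddSubmonoidClass.coe_finsetSum] at h2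
      simp only [Matrix.vecMul, dotProduct, Pi.smul_apply, smul_eq_mul, ω, A, Matrix.map_apply]
      rw [h2]
      refine Finset.sum_congr rfl fun i _ => ?_
      simp [mul_comm]
    have hA : A.det = ((φ r).det : ℝ) := by
      rw [show ((φ r).det : ℝ) = Int.castRingHom ℝ (φ r).det from rfl, RingHom.map_det]; rfl
    have hdet1 : 1 ≤ |A.det| := by
      rw [hA]; exact_mod_cast Int.one_le_abs hdet
    have hadj : ∀ i j, |A.adjugate i j| ≤ D.factorial * X ^ D := by
      intro i j
      rw [Matrix.adjugate_apply]
      have := Matrix.det_le (A := A.updateRow j (Pi.single i 1)) (abv := AbsoluteValue.abs)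
        (x := X) (fun i' j' => by
          change |_| ≤ _
          rw [Matrix.updateRow_apply]
          split_ifs
          · rw [Pi.single_apply]
            split_ifs
            · simpa using hX1
            · simpa using zero_le_one.trans hX1
          · exact (hent r i' j').trans (le_max_right _ _))
      simpa using this
    have hkey : A.det • ω = (r : ℝ) • Matrix.vecMul ω A.adjugate := by
      rw [← Matrix.smul_vecMul, ← hω, Matrix.vecMul_vecMul, Matrix.mul_adjugate,
        Matrix.vecMul_smul, Matrix.vecMul_one]
    obtain ⟨a, -, ha⟩ := Finset.exists_max_image Finset.univ (fun i => |ω i|) Finset.univ_nonempty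
    have hωa : 0 < |ω a| := by
      refine abs_pos.mpr ?_
      simpa [ω] using b.ne_zero a
    have h1 := congrFun hkey a
    simp only [Pi.smul_apply, smul_eq_mul] at h1
    have h2 : |Matrix.vecMul ω A.adjugate a| ≤ |ω a| * (D * (D.factorial * X ^ D)) := by
      simp only [Matrix.vecMul, dotProduct]
      refine (Finset.abs_sum_le_sum_abs _ _).trans ?_
      refine (Finset.sum_le_card_nsmul _ _ (|ω a| * (D.factorial * X ^ D)) fun i _ => ?_).trans ?_
      · rw [abs_mul]
        exact mul_le_mul (ha i (Finset.mem_univ _)) (hadj _ _) (abs_nonneg _) (abs_nonneg _)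
      · simp only [Finset.card_univ, Fintype.card_fin, nsmul_eq_mul]
        apply le_of_eq; ring
    have h3 : |ω a| ≤ |A.det| * |ω a| := le_mul_of_one_le_left hωa.le hdet1
    rw [← abs_mul, h1, abs_mul] at h3
    have h4 : |ω a| * 1 ≤ |ω a| * (|(r : ℝ)| * (D * D.factorial * X ^ D)) := by
      calc |ω a| * 1 = |ω a| := mul_one _
        _ ≤ |(r : ℝ)| * (|ω a| * (D * (D.factorial * X ^ D))) :=
          h3.trans (mul_le_mul_of_nonneg_left h2 (abs_nonneg _))
        _ = _ := by ring
    exact le_of_mul_le_mul_left h4 hωa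

end AlgRing

end SubspaceThm

namespace SubspaceThm

section Chebyshev

variable {ι : Type*} [Fintype ι] [DecidableEq ι]

/-- Second moment of a sum of independent centred bounded functions on a product of finite sets. -/
theorem sum_sq_piFinset_le {η α : Type*} [Fintype η] [DecidableEq η] (J : η → Finset α)
    (f : η → α → ℝ) (M : ℝ) (h0 : ∀ h, ∑ j ∈ J h, f h j = 0) (hM : ∀ h, ∀ j ∈ J h, |f h j| ≤ M) :
    ∑ j ∈ Fintype.piFinset J, (∑ h, f h (j h)) ^ 2 ≤
      Fintype.card η * M ^ 2 * (Fintype.piFinset J).card := by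
  have hcross : ∀ h h', h ≠ h' → ∑ j ∈ Fintype.piFinset J, f h (j h) * f h' (j h') = 0 := by
    intro h h' hne
    have h1 := Finset.prod_univ_sum J
      (fun i a => (if i = h then f h a else 1) * (if i = h' then f h' a else 1))
    have h2 : ∀ j : η → α, ∏ i, ((if i = h then f h (j i) else 1) *
        (if i = h' then f h' (j i) else 1)) = f h (j h) * f h' (j h') := by
      intro j
      rw [Finset.prod_mul_distrib, Finset.prod_ite_eq' Finset.univ h (fun i => f h (j i)),
        Finset.prod_ite_eq' Finset.univ h' (fun i => f h' (j i))]
      simp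
    simp only [h2] at h1
    rw [← h1]
    refine Finset.prod_eq_zero (Finset.mem_univ h) ?_
    simp only [if_true, if_neg hne, mul_one]
    exact h0 h
  have hexp : ∑ j ∈ Fintype.piFinset J, (∑ h, f h (j h)) ^ 2 =
      ∑ h, ∑ j ∈ Fintype.piFinset J, f h (j h) ^ 2 := by
    simp_rw [sq, Finset.sum_mul_sum]
    rw [Finset.sum_comm]
    refine Finset.sum_congr rfl fun h _ => ?_
    rw [Finset.sum_comm, Finset.sum_eq_single h]
    · intro h' _ hne
      exact hcross h h' hne.symm
    · simp
  rw [hexp]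
  calc ∑ h, ∑ j ∈ Fintype.piFinset J, f h (j h) ^ 2
      ≤ ∑ h : η, ∑ j ∈ Fintype.piFinset J, M ^ 2 := by
        refine Finset.sum_le_sum fun h _ => Finset.sum_le_sum fun j hj => ?_
        exact sq_le_sq' (abs_le.mp (hM h _ (Fintype.mem_piFinset.mp hj h))).1
          (abs_le.mp (hM h _ (Fintype.mem_piFinset.mp hj h))).2
    _ = _ := by simp; ring

theorem sum_piAntidiag_apply (r : ℕ) (k : ι) :
    (Fintype.card ι : ℝ) * ∑ j ∈ Finset.piAntidiag (Finset.univ : Finset ι) r, (j k : ℝ) =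
      r * (Finset.piAntidiag (Finset.univ : Finset ι) r).card := by
  have hsymm : ∀ k', ∑ j ∈ Finset.piAntidiag (Finset.univ : Finset ι) r, (j k' : ℝ) =
      ∑ j ∈ Finset.piAntidiag (Finset.univ : Finset ι) r, (j k : ℝ) := by
    intro k'
    refine Finset.sum_bij' (fun j _ => j ∘ Equiv.swap k k') (fun j _ => j ∘ Equiv.swap k k')
      ?_ ?_ ?_ ?_ ?_
    · intro j hj
      simp only [Finset.mem_piAntidiag, Finset.mem_univ, implies_true, and_true] at hj ⊢
      rw [← hj]
      exact Equiv.sum_comp (Equiv.swap k k') j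
    · intro j hj
      simp only [Finset.mem_piAntidiag, Finset.mem_univ, implies_true, and_true] at hj ⊢
      rw [← hj]
      exact Equiv.sum_comp (Equiv.swap k k') j
    · intro j _; funext i; simp
    · intro j _; funext i; simp
    · intro j _; simp
  have h1 : ∑ k', ∑ j ∈ Finset.piAntidiag (Finset.univ : Finset ι) r, (j k' : ℝ) =
      r * (Finset.piAntidiag (Finset.univ : Finset ι) r).card := by
    rw [Finset.sum_comm]
    rw [Finset.sum_congr rfl (g := fun _ => (r : ℝ))]
    · simp; ring
    · intro j hj
      simp only [Finset.mem_piAntidiag, Finset.mem_univ, implies_true, and_true] at hj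
      exact_mod_cast congrArg (Nat.cast : ℕ → ℝ) hj
  rw [← h1, Finset.sum_congr rfl fun k' _ => hsymm k']
  simp

theorem card_piAntidiag_le (r : ℕ) :
    (Finset.piAntidiag (Finset.univ : Finset ι) r).card ≤ 2 ^ (Fintype.card ι * r) := by
  have h : Finset.piAntidiag (Finset.univ : Finset ι) r ⊆
      Fintype.piFinset fun _ : ι => Finset.range (r + 1) := by
    intro j hj
    simp only [Finset.mem_piAntidiag, Finset.mem_univ, implies_true, and_true] at hj
    simp only [Fintype.mem_piFinset, Finset.mem_range, Nat.lt_succ_iff]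
    intro k
    rw [← hj]
    exact Finset.single_le_sum (f := j) (fun _ _ => Nat.zero_le _) (Finset.mem_univ k)
  refine (Finset.card_le_card h).trans ?_
  rw [Fintype.card_piFinset]
  simp only [Finset.card_range, Finset.prod_const, Finset.card_univ]
  rw [mul_comm, pow_mul]
  exact Nat.pow_le_pow_left (Nat.lt_two_pow_self) _

theorem piAntidiag_nonempty [Nonempty ι] (r : ℕ) :
    (Finset.piAntidiag (Finset.univ : Finset ι) r).Nonempty := by
  obtain ⟨k⟩ := ‹Nonempty ι›
  exact ⟨Pi.single k r, by simp⟩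

/-- The exponents of multidegree `r`. -/
def multiIdx {m : ℕ} (r : Fin m → ℕ) : Finset (Fin m → ι → ℕ) :=
  Fintype.piFinset fun h => Finset.piAntidiag Finset.univ (r h)

theorem mem_multiIdx {m : ℕ} {r : Fin m → ℕ} {j : Fin m → ι → ℕ} :
    j ∈ multiIdx r ↔ ∀ h, ∑ k, j h k = r h := by
  simp [multiIdx, Fintype.mem_piFinset]

theorem card_multiIdx_le {m : ℕ} (r : Fin m → ℕ) :
    (multiIdx (ι := ι) r).card ≤ 2 ^ (Fintype.card ι * ∑ h, r h) := by
  rw [multiIdx, Fintype.card_piFinset, Finset.mul_sum, ← Finset.prod_pow_eq_pow_sum]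
  exact Finset.prod_le_prod' fun h _ => card_piAntidiag_le (r h)

theorem card_multiIdx_pos [Nonempty ι] {m : ℕ} (r : Fin m → ℕ) :
    0 < (multiIdx (ι := ι) r).card := by
  rw [Finset.card_pos, multiIdx, Fintype.piFinset_nonempty]
  exact fun h => piAntidiag_nonempty _

/-- For a large number of blocks, most exponents of multidegree `r` have weight close to the
mean. -/
theorem exists_card_bad_le [Nonempty ι] (c : ι → ℝ) {δ : ℝ} (hδ : 0 < δ) (hc : ∑ k, c k = -δ)
    (D : ℕ) : ∃ m : ℕ, 0 < m ∧ ∀ r : Fin m → ℕ, (∀ h, 0 < r h) →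
      2 * D * ((multiIdx r).filter fun j : Fin m → ι → ℕ =>
        ¬ ∑ h, (∑ k, c k * j h k) / r h < -(δ * m / (2 * Fintype.card ι))).card ≤
          (multiIdx (ι := ι) r).card := by
  set n : ℝ := ((Fintype.card ι : ℕ) : ℝ) with hn
  have hn0 : 0 < n := by rw [hn]; exact_mod_cast Fintype.card_pos
  set M : ℝ := ∑ k, |c k| + δ / n with hM
  have hM0 : 0 < M := by positivity
  obtain ⟨m, hm⟩ := exists_nat_ge (max 1 (8 * D * n ^ 2 * M ^ 2 / δ ^ 2))
  have hm1 : (1 : ℝ) ≤ m := (le_max_left _ _).trans hm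
  have hm2 : 8 * D * n ^ 2 * M ^ 2 ≤ m * δ ^ 2 := by
    rw [← div_le_iff₀ (by positivity)]; exact (le_max_right _ _).trans hm
  refine ⟨m, by exact_mod_cast hm1, fun r hr => ?_⟩
  set B := (multiIdx r).filter fun j : Fin m → ι → ℕ =>
    ¬ ∑ h, (∑ k, c k * j h k) / r h < -(δ * m / (2 * n)) with hB
  have hr' : ∀ h, (0 : ℝ) < r h := fun h => by exact_mod_cast hr h
  have key := sum_sq_piFinset_le (fun h => Finset.piAntidiag (Finset.univ : Finset ι) (r h))
    (fun h j => (∑ k, c k * j k) / r h + δ / n) M ?_ ?_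
  · have h1 : ∑ j ∈ B, (δ * m / (2 * n)) ^ 2 ≤ m * M ^ 2 * (multiIdx (ι := ι) r).card := by
      rw [Fintype.card_fin] at key
      refine le_trans ?_ key
      refine (Finset.sum_le_sum fun j hj => ?_).trans
        (Finset.sum_le_sum_of_subset_of_nonneg (Finset.filter_subset _ _) fun _ _ _ => sq_nonneg _)
      have h2 := not_lt.mp (Finset.mem_filter.mp hj).2
      rw [Finset.sum_add_distrib]
      simp only [Finset.sum_const, Finset.card_univ, Fintype.card_fin, nsmul_eq_mul]
      have h3 : δ * m / (2 * n) = m * (δ / n) - δ * m / (2 * n) := by field_simp; ring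
      refine pow_le_pow_left₀ (by positivity) ?_ 2
      linarith
    rw [Finset.sum_const, nsmul_eq_mul] at h1
    have h2 : (B.card : ℝ) * (8 * D * n ^ 2 * M ^ 2 * m) ≤
        (multiIdx (ι := ι) r).card * (4 * n ^ 2 * M ^ 2 * m) := by
      calc (B.card : ℝ) * (8 * D * n ^ 2 * M ^ 2 * m) ≤ B.card * (m * δ ^ 2 * m) := by gcongr
        _ = (B.card * (δ * m / (2 * n)) ^ 2) * (4 * n ^ 2) := by field_simp; ring
        _ ≤ (m * M ^ 2 * (multiIdx (ι := ι) r).card) * (4 * n ^ 2) := by gcongr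
        _ = _ := by ring
    have h3 : (2 * D * B.card : ℝ) ≤ (multiIdx (ι := ι) r).card := by
      have hp : 0 < 4 * n ^ 2 * M ^ 2 * m := by positivity
      refine le_of_mul_le_mul_right ?_ hp
      linarith
    exact_mod_cast h3
  · intro h
    rw [Finset.sum_add_distrib, ← Finset.sum_div, Finset.sum_comm]
    simp_rw [← Finset.mul_sum]
    have h1 : ∀ k, ∑ j ∈ Finset.piAntidiag (Finset.univ : Finset ι) (r h), (j k : ℝ) =
        r h * (Finset.piAntidiag (Finset.univ : Finset ι) (r h)).card / n := by
      intro k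
      rw [eq_div_iff hn0.ne', mul_comm]
      exact sum_piAntidiag_apply (r h) k
    simp_rw [h1]
    rw [← Finset.sum_mul, hc]
    have := (hr' h).ne'
    simp only [Finset.sum_const, nsmul_eq_mul]
    field_simp
    ring
  · intro h j hj
    simp only [Finset.mem_piAntidiag, Finset.mem_univ, implies_true, and_true] at hj
    refine (abs_add_le _ _).trans ?_
    rw [abs_of_pos (show 0 < δ / n by positivity)]
    refine add_le_add_left ?_ _
    rw [abs_div, abs_of_pos (hr' h), div_le_iff₀ (hr' h), Finset.sum_mul]
    refine (Finset.abs_sum_le_sum_abs _ _).trans (Finset.sum_le_sum fun k _ => ?_)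
    rw [abs_mul, Nat.abs_cast]
    refine mul_le_mul_of_nonneg_left ?_ (abs_nonneg _)
    rw [← hj]
    exact_mod_cast Finset.single_le_sum (f := j) (fun _ _ => Nat.zero_le _) (Finset.mem_univ k)

end Chebyshev

section Siegel

attribute [local instance] Matrix.seminormedAddCommGroup in
/-- Siegel's lemma for a system with at least twice as many unknowns as equations. -/
theorem exists_int_vec_of_two_mul_card_le {α β : Type*} [Fintype α] [Fintype β]
    (A : Matrix α β ℤ) (hβ : 0 < Fintype.card β) (hαβ : 2 * Fintype.card α ≤ Fintype.card β)
    (X : ℝ) (hX1 : 1 ≤ X) (hX : ∀ i j, |(A i j : ℝ)| ≤ X) :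
    ∃ t : β → ℤ, t ≠ 0 ∧ A.mulVec t = 0 ∧ ∀ j, |(t j : ℝ)| ≤ Fintype.card β * X := by
  classical
  have hβ1 : (1 : ℝ) ≤ Fintype.card β := by exact_mod_cast hβ
  have hone : 1 ≤ Fintype.card β * X := one_le_mul_of_one_le_of_one_le hβ1 hX1
  rcases Nat.eq_zero_or_pos (Fintype.card α) with h0 | hpos
  · have : IsEmpty α := Fintype.card_eq_zero_iff.mp h0
    obtain ⟨b⟩ := Fintype.card_pos_iff.mp hβ
    refine ⟨Pi.single b 1, by simp, Subsingleton.elim _ _, fun j => ?_⟩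
    rw [Pi.single_apply]
    split_ifs
    · simpa using hone
    · simpa using zero_le_one.trans hone
  · obtain ⟨t, ht0, htA, ht⟩ := Int.Matrix.exists_ne_zero_int_vec_norm_le A (by omega) hpos
    refine ⟨t, ht0, htA, fun j => ?_⟩
    have h1 : |(t j : ℝ)| ≤ ‖t‖ := by
      rw [← Int.norm_eq_abs]; exact norm_le_pi_norm t j
    refine h1.trans (ht.trans ?_)
    have hA : max 1 ‖A‖ ≤ X := by
      refine max_le hX1 ((Matrix.norm_le_iff (zero_le_one.trans hX1)).mpr fun i j => ?_)
      rw [Int.norm_eq_abs]; exact hX i j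
    have hbase : (1 : ℝ) ≤ Fintype.card β * max 1 ‖A‖ :=
      one_le_mul_of_one_le_of_one_le hβ1 (le_max_left _ _)
    have h2 : (2 * Fintype.card α : ℝ) ≤ Fintype.card β := by exact_mod_cast hαβ
    have h3 : (0 : ℝ) < Fintype.card α := by exact_mod_cast hpos
    calc _ ≤ (Fintype.card β * max 1 ‖A‖) ^ (1 : ℝ) := by
          refine Real.rpow_le_rpow_of_exponent_le hbase ?_
          rw [div_le_one (by linarith)]
          linarith
      _ = Fintype.card β * max 1 ‖A‖ := Real.rpow_one _
      _ ≤ _ := by gcongr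

end Siegel

end SubspaceThm

namespace SubspaceThm

open MvPolynomial

section LinSub

variable {ι : Type*} [Fintype ι] {m : ℕ} {R : Type*} [CommRing R]

/-- Multihomogeneity of degree `r h` in the `h`-th block of variables. -/
def MHom (r : Fin m → ℕ) (p : MvPolynomial (Fin m × ι) R) : Prop :=
  ∀ i ∈ p.support, ∀ h, ∑ k, i (h, k) = r h

theorem weight_block (i : Fin m × ι →₀ ℕ) (h : Fin m) :
    Finsupp.weight (fun hk : Fin m × ι => (Pi.single hk.1 1 : Fin m → ℕ)) i h =
      ∑ k, i (h, k) := by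
  classical
  rw [Finsupp.weight_apply, Finsupp.sum_fintype _ _ (by simp), Finset.sum_apply,
    Fintype.sum_prod_type, Finset.sum_eq_single h]
  · simp
  · intro h' _ hne
    simp [hne.symm]
  · simp

theorem mHom_iff {r : Fin m → ℕ} {p : MvPolynomial (Fin m × ι) R} :
    MHom r p ↔ IsWeightedHomogeneous (fun hk : Fin m × ι => (Pi.single hk.1 1 : Fin m → ℕ)) p r := by
  constructor
  · intro H i hi
    funext h
    rw [weight_block]
    exact H i (mem_support_iff.mpr hi) h
  · intro H i hi h
    rw [← weight_block]
    exact congrFun (H (mem_support_iff.mp hi)) h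

theorem MHom.map {S : Type*} [CommRing S] {r : Fin m → ℕ} {p : MvPolynomial (Fin m × ι) R}
    (hp : MHom r p) (f : R →+* S) : MHom r (MvPolynomial.map f p) :=
  fun i hi => hp i (support_map_subset _ _ hi)

theorem MHom.sum_eq {r : Fin m → ℕ} {p : MvPolynomial (Fin m × ι) R} (hp : MHom r p)
    {i : Fin m × ι →₀ ℕ} (hi : i ∈ p.support) : ∑ hk, i hk = ∑ h, r h := by
  rw [Fintype.sum_prod_type]
  exact Finset.sum_congr rfl fun h _ => hp i hi h

/-- Substitution of linear forms in each block. -/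
noncomputable def linSub (A : Fin m → Matrix ι ι R) :
    MvPolynomial (Fin m × ι) R →ₐ[R] MvPolynomial (Fin m × ι) R :=
  aeval fun hk => ∑ l, C (A hk.1 hk.2 l) * X (hk.1, l)

theorem linSub_X (A : Fin m → Matrix ι ι R) (hk : Fin m × ι) :
    linSub A (X hk) = ∑ l, C (A hk.1 hk.2 l) * X (hk.1, l) := by
  simp [linSub]

theorem linSub_linSub (A B : Fin m → Matrix ι ι R) (p : MvPolynomial (Fin m × ι) R) :
    linSub A (linSub B p) = linSub (fun h => B h * A h) p := by
  have : (linSub A).comp (linSub B) = linSub (fun h => B h * A h) := by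
    refine algHom_ext fun hk => ?_
    rw [AlgHom.comp_apply, linSub_X, linSub_X, map_sum]
    simp_rw [map_mul, algHom_C, linSub_X, Matrix.mul_apply, algebraMap_eq, Finset.mul_sum, map_sum,
      Finset.sum_mul, map_mul]
    rw [Finset.sum_comm]
    simp_rw [mul_assoc]
  rw [← this]; rfl

theorem map_linSub {S : Type*} [CommRing S] (f : R →+* S) (A : Fin m → Matrix ι ι R)
    (p : MvPolynomial (Fin m × ι) R) :
    MvPolynomial.map f (linSub A p) = linSub (fun h => (A h).map f) (MvPolynomial.map f p) := by
  induction p using MvPolynomial.induction_on with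
  | C a => simp [linSub]
  | add p q hp hq => simp only [map_add, hp, hq]
  | mul_X p hk hp =>
    rw [map_mul, map_mul, hp, map_mul, map_mul, linSub_X, map_X, linSub_X, map_sum]
    simp

theorem MHom.linSub {r : Fin m → ℕ} {p : MvPolynomial (Fin m × ι) R} (hp : MHom r p)
    (A : Fin m → Matrix ι ι R) : MHom r (SubspaceThm.linSub A p) := by
  rw [mHom_iff, SubspaceThm.linSub, aeval_eq_eval₂Hom, coe_eval₂Hom, eval₂_eq']
  refine IsWeightedHomogeneous.sum _ _ _ fun i hi => ?_
  rw [algebraMap_eq]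
  refine IsWeightedHomogeneous.C_mul ?_ _
  have h1 : ∑ hk : Fin m × ι, i hk • (Pi.single hk.1 1 : Fin m → ℕ) = r := by
    have h2 := mHom_iff.mp hp (mem_support_iff.mp hi)
    rwa [Finsupp.weight_apply, Finsupp.sum_fintype _ _ (by simp)] at h2
  rw [← h1]
  refine IsWeightedHomogeneous.prod _ _ _ fun hk _ => IsWeightedHomogeneous.pow ?_ _
  refine IsWeightedHomogeneous.sum _ _ _ fun l _ => IsWeightedHomogeneous.C_mul ?_ _
  exact isWeightedHomogeneous_X R _ (hk.1, l)

theorem lOne_linSub_le {N : RingSeminorm R} (hN : N 1 ≤ 1) {r : Fin m → ℕ}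
    {p : MvPolynomial (Fin m × ι) R} (hp : MHom r p) (A : Fin m → Matrix ι ι R) (B : ℝ)
    (hB : ∀ h k, ∑ l, N (A h k l) ≤ B) :
    lOne N (linSub A p) ≤ lOne N p * B ^ ∑ h, r h := by
  refine lOne_aeval_le hN _ p _ fun i hi => ?_
  rw [← hp.sum_eq hi, ← Finset.prod_pow_eq_pow_sum]
  refine Finset.prod_le_prod (fun _ _ => pow_nonneg (lOne_nonneg N _) _) fun hk _ => ?_
  refine pow_le_pow_left₀ (lOne_nonneg N _) ((lOne_sum_le N _ _).trans
    ((Finset.sum_le_sum fun l _ => ?_).trans (hB hk.1 hk.2))) _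
  refine (lOne_mul_le N _ _).trans ?_
  rw [lOne_C]
  refine mul_le_of_le_one_right (apply_nonneg N _) ?_
  rw [X, lOne_monomial]
  exact hN

theorem linSub_smul {r : Fin m → ℕ} {p : MvPolynomial (Fin m × ι) R} (hp : MHom r p)
    (A : Fin m → Matrix ι ι R) (b : R) :
    linSub (fun h => b • A h) p = C (b ^ ∑ h, r h) * linSub A p := by
  rw [linSub, linSub, aeval_eq_eval₂Hom, coe_eval₂Hom, eval₂_eq', aeval_eq_eval₂Hom, coe_eval₂Hom,
    eval₂_eq', Finset.mul_sum]
  refine Finset.sum_congr rfl fun i hi => ?_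
  have h1 : ∀ hk : Fin m × ι, (∑ l, C ((b • A hk.1) hk.2 l) * X (hk.1, l) :
      MvPolynomial (Fin m × ι) R) = C b * ∑ l, C (A hk.1 hk.2 l) * X (hk.1, l) := by
    intro hk
    rw [Finset.mul_sum]
    refine Finset.sum_congr rfl fun l _ => ?_
    simp [mul_assoc]
  simp_rw [h1, mul_pow]
  rw [Finset.prod_mul_distrib, Finset.prod_pow_eq_pow_sum, hp.sum_eq hi, map_pow]
  ring

end LinSub

end SubspaceThm

namespace SubspaceThm

open MvPolynomial

section Aux

variable {ι : Type*} [Fintype ι]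

/-- A family of exponents, as an exponent of the family of all variables. -/
noncomputable def toExp {m : ℕ} (j : Fin m → ι → ℕ) : Fin m × ι →₀ ℕ :=
  Finsupp.equivFunOnFinite.symm fun hk => j hk.1 hk.2

@[simp]
theorem toExp_apply {m : ℕ} (j : Fin m → ι → ℕ) (hk : Fin m × ι) :
    toExp j hk = j hk.1 hk.2 := rfl

theorem toExp_injective {m : ℕ} : Function.Injective (toExp : (Fin m → ι → ℕ) → _) := by
  intro i j h
  funext a k
  exact DFunLike.congr_fun h (a, k)

theorem exists_toExp {m : ℕ} (i : Fin m × ι →₀ ℕ) : ∃ j, toExp j = i :=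
  ⟨fun h k => i (h, k), by ext; rfl⟩

theorem exists_integral_multiple_matrix (A : Matrix ι ι ℝ) (hA : ∀ k l, IsAlgebraic ℚ (A k l)) :
    ∃ b : ℤ, b ≠ 0 ∧ ∀ k l, IsIntegral ℤ ((b : ℝ) * A k l) := by
  classical
  have h1 : ∀ kl : ι × ι, ∃ y : ℤ, y ≠ 0 ∧ IsIntegral ℤ ((y : ℝ) * A kl.1 kl.2) := by
    intro kl
    obtain ⟨y, hy, hi⟩ := ((IsFractionRing.isAlgebraic_iff ℤ ℚ ℝ).mpr
      (hA kl.1 kl.2)).exists_integral_multiple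
    exact ⟨y, hy, by simpa using hi⟩
  choose y hy hi using h1
  refine ⟨∏ kl, y kl, Finset.prod_ne_zero_iff.mpr fun kl _ => hy kl, fun k l => ?_⟩
  rw [← Finset.mul_prod_erase Finset.univ y (Finset.mem_univ (k, l)), Int.cast_mul, mul_comm (y _ : ℝ),
    mul_assoc]
  exact (isIntegral_algebraMap (R := ℤ) (A := ℝ) (x := ∏ x ∈ Finset.univ.erase (k, l), y x)).mul
    (hi (k, l))

theorem lOne_map_intCast {σ : Type*} (p : MvPolynomial σ ℤ) :
    lOne (normRingSeminorm ℝ) (map (Int.castRingHom ℝ) p) = lOne (normRingSeminorm ℤ) p := by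
  rw [lOne_eq_sum_of_subset _ (support_map_subset (Int.castRingHom ℝ) p)]
  refine Finset.sum_congr rfl fun i _ => ?_
  rw [coeff_map]
  change ‖((coeff i p : ℤ) : ℝ)‖ = ‖coeff i p‖
  exact Int.norm_cast_real _

/-- The auxiliary polynomial: a multihomogeneous integral polynomial of controlled height which,
after the linear substitution `A`, has only monomials of small weight. -/
theorem exists_auxPoly [Nonempty ι] (A : Matrix ι ι ℝ) (hA : ∀ k l, IsAlgebraic ℚ (A k l))
    (c : ι → ℝ) {δ : ℝ} (hδ : 0 < δ) (hc : ∑ k, c k = -δ) :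
    ∃ m : ℕ, 0 < m ∧ ∃ E : ℝ, 1 ≤ E ∧ ∀ r : Fin m → ℕ, (∀ h, 0 < r h) →
      ∃ P : MvPolynomial (Fin m × ι) ℤ, P ≠ 0 ∧ MHom r P ∧
        lOne (normRingSeminorm ℤ) P ≤ E ^ ∑ h, r h ∧
        lOne (normRingSeminorm ℝ) (linSub (fun _ => A) (map (Int.castRingHom ℝ) P)) ≤
          E ^ ∑ h, r h ∧
        ∀ j ∈ (linSub (fun _ => A) (map (Int.castRingHom ℝ) P)).support,
          ∑ h, (∑ k, c k * j (h, k)) / r h < -(δ * m / (2 * Fintype.card ι)) := by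
  classical
  obtain ⟨b, hb, hintegral⟩ := exists_integral_multiple_matrix A hA
  obtain ⟨R, N, D, φ, hR, hN1, hφ, hφN, -⟩ := exists_algRing
    (Finset.univ.image fun kl : ι × ι => (b : ℝ) * A kl.1 kl.2) (by
      intro x hx
      obtain ⟨kl, -, rfl⟩ := Finset.mem_image.mp hx
      exact hintegral _ _)
  let A' : Matrix ι ι R := fun k l => ⟨(b : ℝ) * A k l,
    hR _ (Finset.mem_image.mpr ⟨(k, l), Finset.mem_univ _, rfl⟩)⟩
  obtain ⟨m, hm, hbad⟩ := exists_card_bad_le c hδ hc (D * D)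
  let B : ℝ := 1 + ∑ k, ∑ l, N (A' k l)
  let B₀ : ℝ := 1 + ∑ k, ∑ l, |A k l|
  have hB : ∀ k, ∑ l, N (A' k l) ≤ B := by
    intro k
    have h1 : ∑ l, N (A' k l) ≤ ∑ k, ∑ l, N (A' k l) :=
      Finset.single_le_sum (f := fun k => ∑ l, N (A' k l))
        (fun _ _ => Finset.sum_nonneg fun _ _ => apply_nonneg N _) (Finset.mem_univ k)
    exact h1.trans (by simp [B])
  have hB₀ : ∀ k, ∑ l, |A k l| ≤ B₀ := by
    intro k
    have h1 : ∑ l, |A k l| ≤ ∑ k, ∑ l, |A k l| :=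
      Finset.single_le_sum (f := fun k => ∑ l, |A k l|)
        (fun _ _ => Finset.sum_nonneg fun _ _ => abs_nonneg _) (Finset.mem_univ k)
    exact h1.trans (by simp [B₀])
  have hB1 : 1 ≤ B := by
    simp only [B, le_add_iff_nonneg_right]
    exact Finset.sum_nonneg fun _ _ => Finset.sum_nonneg fun _ _ => apply_nonneg N _
  have hB₀1 : 1 ≤ B₀ := by
    simp only [B₀, le_add_iff_nonneg_right]
    exact Finset.sum_nonneg fun _ _ => Finset.sum_nonneg fun _ _ => abs_nonneg _
  let n := Fintype.card ι
  let E₁ : ℝ := 2 ^ n * (2 ^ n * B)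
  have h2n : (1 : ℝ) ≤ 2 ^ n := one_le_pow₀ (by norm_num)
  have hE₁ : 1 ≤ E₁ :=
    one_le_mul_of_one_le_of_one_le h2n (one_le_mul_of_one_le_of_one_le h2n hB1)
  refine ⟨m, hm, E₁ * B₀, one_le_mul_of_one_le_of_one_le hE₁ hB₀1, fun r hr => ?_⟩
  set s := ∑ h, r h with hs
  let J := multiIdx (ι := ι) r
  let Bd := J.filter fun j : Fin m → ι → ℕ =>
        ¬ ∑ h, (∑ k, c k * j h k) / r h < -(δ * m / (2 * Fintype.card ι))
  -- the conditions, over `R`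
  let κ : (Fin m → ι → ℕ) → (Fin m → ι → ℕ) → R := fun i j =>
    coeff (toExp j) (linSub (fun _ => A') (monomial (toExp i) (1 : R)))
  have hmono : ∀ i ∈ J, ∀ a : R, MHom r (monomial (toExp i) a) := by
    intro i hi a i' hi' h
    have := Finset.mem_singleton.mp (support_monomial_subset hi')
    subst this
    simpa using mem_multiIdx.mp hi h
  have hκ : ∀ i ∈ J, ∀ j, N (κ i j) ≤ B ^ s := by
    intro i hi j
    refine (coeff_le_lOne N _ _).trans ((lOne_linSub_le hN1 (hmono i hi 1) _ B fun _ => hB).trans ?_)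
    rw [lOne_monomial]
    exact mul_le_of_le_one_left (by positivity) hN1
  obtain ⟨t, ht0, htA, ht⟩ := exists_int_vec_of_two_mul_card_le
    (Matrix.of fun (x : ↥Bd × (Fin D × Fin D)) (i : ↥J) => φ (κ i x.1) x.2.1 x.2.2)
    (by rw [Fintype.card_coe]; exact card_multiIdx_pos r)
    (by
      rw [Fintype.card_prod, Fintype.card_coe, Fintype.card_prod, Fintype.card_fin, Fintype.card_coe]
      have := hbad r hr
      calc 2 * (Bd.card * (D * D)) = 2 * (D * D) * Bd.card := by ring
        _ ≤ _ := this)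
    (B ^ s) (one_le_pow₀ hB1) (fun x i => (hφN _ _ _).trans (hκ i i.2 _))
  rw [Fintype.card_coe] at ht
  let P : MvPolynomial (Fin m × ι) ℤ := ∑ i : ↥J, monomial (toExp (i : Fin m → ι → ℕ)) (t i)
  have hcoeff : ∀ i : ↥J, coeff (toExp (i : Fin m → ι → ℕ)) P = t i := by
    intro i
    simp only [P, coeff_sum, coeff_monomial]
    rw [Finset.sum_eq_single i]
    · simp
    · intro i' _ hne
      rw [if_neg]
      exact fun h => hne (Subtype.ext (toExp_injective h))
    · simp
  have hP0 : P ≠ 0 := by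
    intro h0
    refine ht0 (funext fun i => ?_)
    rw [← hcoeff i, h0]; simp
  have hPr : MHom r P := by
    rw [mHom_iff]
    refine IsWeightedHomogeneous.sum _ _ _ fun i _ => mHom_iff.mp ?_
    intro i' hi' h
    have := Finset.mem_singleton.mp (support_monomial_subset hi')
    subst this
    simpa using mem_multiIdx.mp i.2 h
  have hJ : (J.card : ℝ) ≤ (2 ^ n) ^ s := by
    rw [← pow_mul]
    exact_mod_cast card_multiIdx_le (ι := ι) r
  have hPl : lOne (normRingSeminorm ℤ) P ≤ E₁ ^ s := by
    refine (lOne_sum_le _ _ _).trans ?_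
    have h1 : ∀ i : ↥J, lOne (normRingSeminorm ℤ) (monomial (toExp (i : Fin m → ι → ℕ)) (t i)) ≤
        (2 ^ n * B) ^ s := by
      intro i
      rw [lOne_monomial]
      change ‖t i‖ ≤ _
      rw [Int.norm_eq_abs, mul_pow]
      exact (ht i).trans (mul_le_mul_of_nonneg_right hJ (by positivity))
    refine (Finset.sum_le_card_nsmul _ _ _ fun i _ => h1 i).trans ?_
    rw [Finset.card_univ, Fintype.card_coe, nsmul_eq_mul, show E₁ ^ s = (2 ^ n) ^ s * (2 ^ n * B) ^ s
      from mul_pow _ _ _]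
    exact mul_le_mul_of_nonneg_right hJ (by positivity)
  have hle : E₁ ^ s ≤ (E₁ * B₀) ^ s := pow_le_pow_left₀ (zero_le_one.trans hE₁)
    (le_mul_of_one_le_right (zero_le_one.trans hE₁) hB₀1) _
  have hPR := hPr.map (Int.castRingHom ℝ)
  refine ⟨P, hP0, hPr, hPl.trans hle, ?_, ?_⟩
  · refine (lOne_linSub_le (N := normRingSeminorm ℝ) (norm_one (α := ℝ)).le hPR _ B₀
      fun _ => hB₀).trans ?_
    rw [lOne_map_intCast, mul_pow]
    exact mul_le_mul_of_nonneg_right hPl (by positivity)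
  · intro j hj
    by_contra hcon
    obtain ⟨j, rfl⟩ := exists_toExp j
    have hjJ : j ∈ J := by
      rw [mem_multiIdx]
      intro h
      simpa using hPR.linSub (fun _ => A) _ hj h
    have hjB : j ∈ Bd := Finset.mem_filter.mpr ⟨hjJ, hcon⟩
    have hzero : coeff (toExp j) (linSub (fun _ => A') (map (Int.castRingHom R) P)) = 0 := by
      apply hφ
      rw [map_zero]
      ext a a'
      have h1 := congrFun htA (⟨j, hjB⟩, (a, a'))
      simp only [Matrix.mulVec, dotProduct, Matrix.of_apply, Pi.zero_apply] at h1
      rw [Matrix.zero_apply, ← h1]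
      have h2 : linSub (fun _ => A') (map (Int.castRingHom R) P) =
          ∑ i : ↥J, (t i : R) • linSub (fun _ => A') (monomial (toExp (i : Fin m → ι → ℕ)) (1 : R)) := by
        simp only [P, map_sum, map_monomial]
        refine Finset.sum_congr rfl fun i _ => ?_
        rw [← map_smul, smul_monomial]
        simp
      rw [h2, coeff_sum, map_sum, Matrix.sum_apply]
      refine Finset.sum_congr rfl fun i _ => ?_
      rw [coeff_smul, smul_eq_mul, map_mul, map_intCast]
      change _ = φ (κ i j) a a' * t i
      rw [mul_comm (φ (κ i j) a a'), ← Matrix.diagonal_intCast, Matrix.diagonal_mul, Int.cast_id]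
    refine mem_support_iff.mp hj ?_
    have hA' : ∀ h : Fin m, A'.map (algebraMap R ℝ) = (b : ℝ) • A := by
      intro h; ext k l; rfl
    have h3 : linSub (fun _ => (b : ℝ) • A) (map (Int.castRingHom ℝ) P) =
        map (algebraMap R ℝ) (linSub (fun _ => A') (map (Int.castRingHom R) P)) := by
      rw [map_linSub, map_map]
      congr 1
    have h4 := congrArg (coeff (toExp j)) h3
    rw [linSub_smul hPR, coeff_map, hzero, coeff_C_mul, map_zero] at h4
    exact (mul_eq_zero.mp h4).resolve_left (pow_ne_zero _ (by exact_mod_cast hb))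

end Aux

end SubspaceThm

namespace SubspaceThm

section Height

variable {ι : Type*} [Fintype ι] [DecidableEq ι]

/-- A determinant with one row equal to a unit vector is bounded by the entries off the
corresponding column. -/
theorem abs_det_updateRow_single_le (W : Matrix ι ι ℝ) (k k₀ : ι) (b : ι → ℝ)
    (hb : ∀ i, 0 ≤ b i) (hW : ∀ i j, j ≠ k₀ → |W i j| ≤ b i) :
    |(W.updateRow k (Pi.single k₀ 1)).det| ≤
      (Fintype.card ι).factorial * ∏ i ∈ Finset.univ.erase k, b i := by
  rw [Matrix.det_apply]
  refine (Finset.abs_sum_le_sum_abs _ _).trans ?_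
  refine (Finset.sum_le_card_nsmul _ _ (∏ i ∈ Finset.univ.erase k, b i) fun σ _ => ?_).trans ?_
  · have h1 : |Equiv.Perm.sign σ • ∏ i, W.updateRow k (Pi.single k₀ 1) (σ i) i| =
        ∏ i, |W.updateRow k (Pi.single k₀ 1) (σ i) i| := by
      rw [← Finset.abs_prod]
      rcases Int.units_eq_one_or (Equiv.Perm.sign σ) with h | h <;> simp [h]
    rw [h1]
    by_cases hσ : σ k₀ = k
    · rw [← Finset.mul_prod_erase _ _ (Finset.mem_univ k₀)]
      have h2 : |W.updateRow k (Pi.single k₀ 1) (σ k₀) k₀| = 1 := by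
        rw [hσ]; simp
      rw [h2, one_mul]
      have h3 : ∏ i ∈ Finset.univ.erase k, b i = ∏ i ∈ Finset.univ.erase k₀, b (σ i) := by
        refine (Finset.prod_bij (fun i _ => σ i) ?_ ?_ ?_ ?_).symm
        · intro i hi
          simp only [Finset.mem_erase, Finset.mem_univ, and_true] at hi ⊢
          rw [← hσ]
          exact fun h => hi (σ.injective h)
        · intro i _ j _ h; exact σ.injective h
        · intro j hj
          refine ⟨σ.symm j, ?_, by simp⟩
          simp only [Finset.mem_erase, Finset.mem_univ, and_true] at hj ⊢
          rintro h
          exact hj (by rw [← hσ, ← h]; simp)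
        · intro i _; rfl
      rw [h3]
      refine Finset.prod_le_prod (fun _ _ => abs_nonneg _) fun i hi => ?_
      have hi' : i ≠ k₀ := (Finset.mem_erase.mp hi).1
      rw [Matrix.updateRow_ne]
      · exact hW _ _ hi'
      · rw [← hσ]; exact fun h => hi' (σ.injective h)
    · rw [Finset.prod_eq_zero (Finset.mem_univ (σ.symm k))]
      · exact Finset.prod_nonneg fun i _ => hb i
      · have : σ.symm k ≠ k₀ := fun h => hσ (by rw [← h]; simp)
        simp [this]
  · rw [Finset.card_univ, Fintype.card_perm, nsmul_eq_mul]

theorem ringSeminorm_zsmul_le {R : Type*} [CommRing R] (N : RingSeminorm R) (z : ℤ) (x : R) :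
    N (z • x) ≤ |(z : ℝ)| * N x := by
  have hnat : ∀ n : ℕ, N (n • x) ≤ n * N x := by
    intro n
    induction n with
    | zero => simp
    | succ n ih =>
      rw [succ_nsmul]
      refine (map_add_le_add N _ _).trans ?_
      push_cast
      linarith
  rcases Int.natAbs_eq z with h | h
  · rw [h]; simpa using hnat z.natAbs
  · rw [h]; simpa using hnat z.natAbs

theorem exists_forall_nat_rpow_lt {C e : ℝ} (he : e < 0) :
    ∃ Q₁ : ℕ, ∀ Q : ℕ, Q₁ ≤ Q → C * (Q : ℝ) ^ e < 1 := by
  have h1 : Filter.Tendsto (fun Q : ℕ => C * (Q : ℝ) ^ e) Filter.atTop (nhds (C * 0)) := by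
    refine Filter.Tendsto.const_mul _ ?_
    have := (tendsto_rpow_neg_atTop (y := -e) (by linarith)).comp tendsto_natCast_atTop_atTop
    simpa [Function.comp_def] using this
  rw [mul_zero] at h1
  exact Filter.eventually_atTop.mp (h1.eventually (gt_mem_nhds one_pos))

/-- Either two of the rows `H Q k₀` are proportional, or their heights grow at least like a fixed
power of `Q`. -/
theorem proportional_or_height_large (L : Matrix ι ι ℝ) (hL : ∀ i j, IsAlgebraic ℚ (L⁻¹ i j))
    (hdet : L.det ≠ 0) (c : ι → ℝ) {δ : ℝ} (hδ : 0 < δ) (hc : ∑ i, c i = -δ) (S : Set ℕ)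
    (hS : S.Infinite) (G H : ℕ → Matrix ι ι ℤ) (hHG : ∀ Q ∈ S, H Q * G Q = 1) (k₀ : ι)
    (hG : ∀ Q ∈ S, ∀ i k, k ≠ k₀ →
      |(L * (G Q).map (Int.castRingHom ℝ)) i k| ≤ (Q : ℝ) ^ c i) :
    (∃ Q ∈ S, ∃ Q' ∈ S, Q ≠ Q' ∧ ∃ t : ℤ, t ≠ 0 ∧ H Q k₀ = t • H Q' k₀) ∨
      ∃ γ : ℝ, 0 < γ ∧ ∃ Q₁ : ℕ, ∀ Q ∈ S, Q₁ ≤ Q → ∃ k, (Q : ℝ) ^ γ ≤ |(H Q k₀ k : ℝ)| := by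
  have hne : Nonempty ι := ⟨k₀⟩
  obtain ⟨b, hb, hintegral⟩ := exists_integral_multiple_matrix L⁻¹ hL
  obtain ⟨R, N, D, φ, hR, hN1, -, -, C, hC, hLiou⟩ := exists_algRing
    (Finset.univ.image fun kl : ι × ι => (b : ℝ) * L⁻¹ kl.1 kl.2) (by
      intro x hx
      obtain ⟨kl, -, rfl⟩ := Finset.mem_image.mp hx
      exact hintegral _ _)
  let A' : Matrix ι ι R := fun k l => ⟨(b : ℝ) * L⁻¹ k l,
    hR _ (Finset.mem_image.mpr ⟨(k, l), Finset.mem_univ _, rfl⟩)⟩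
  let B : ℝ := 1 + ∑ k, ∑ l, N (A' l k)
  have hB1 : 1 ≤ B := by
    simp only [B, le_add_iff_nonneg_right]
    exact Finset.sum_nonneg fun _ _ => Finset.sum_nonneg fun _ _ => apply_nonneg N _
  have hB : ∀ k, ∑ l, N (A' l k) ≤ B := by
    intro k
    have h1 : ∑ l, N (A' l k) ≤ ∑ k, ∑ l, N (A' l k) :=
      Finset.single_le_sum (f := fun k => ∑ l, N (A' l k))
        (fun _ _ => Finset.sum_nonneg fun _ _ => apply_nonneg N _) (Finset.mem_univ k)
    exact h1.trans (by simp [B])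
  let γ : ℝ := δ / (4 * (D + 1))
  have hγ : 0 < γ := by positivity
  have hγD : γ * D ≤ δ / 4 := by
    simp only [γ]
    rw [div_mul_eq_mul_div, div_le_div_iff₀ (by positivity) (by norm_num)]
    nlinarith
  -- the linear form in terms of the rows of `L`
  let a : ℕ → ι → ℝ := fun Q => Matrix.vecMul (fun k => (H Q k₀ k : ℝ)) L⁻¹
  have hLinv : L⁻¹ * L = 1 := Matrix.nonsing_inv_mul L (isUnit_iff_ne_zero.mpr hdet)
  have hLinv' : L * L⁻¹ = 1 := Matrix.mul_nonsing_inv L (isUnit_iff_ne_zero.mpr hdet)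
  have hHG' : ∀ Q ∈ S, (H Q).map (Int.castRingHom ℝ) * (G Q).map (Int.castRingHom ℝ) = 1 := by
    intro Q hQ
    rw [← Matrix.map_mul, hHG Q hQ, Matrix.map_one _ (map_zero _) (map_one _)]
  let C₁ : ℝ := (Fintype.card ι).factorial / |L.det|
  have ha : ∀ Q ∈ S, 0 < Q → ∀ k, |a Q k| ≤ C₁ * (Q : ℝ) ^ (-δ - c k) := by
    intro Q hQ hQ0 k
    have hQ0' : (0 : ℝ) < Q := by exact_mod_cast hQ0
    set W := L * (G Q).map (Int.castRingHom ℝ) with hW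
    have h1 : (H Q).map (Int.castRingHom ℝ) * L⁻¹ * W = 1 := by
      rw [hW, ← Matrix.mul_assoc, Matrix.mul_assoc _ L⁻¹ L, hLinv, Matrix.mul_one, hHG' Q hQ]
    have h2 : W.det ≠ 0 := by
      intro h0
      have := congrArg Matrix.det h1
      rw [Matrix.det_mul, h0] at this
      simp at this
    have h3 : (H Q).map (Int.castRingHom ℝ) * L⁻¹ = W⁻¹ := (Matrix.inv_eq_left_inv h1).symm
    have h4 : a Q k = W⁻¹ k₀ k := by rw [← h3]; rfl
    have h5 : |W.det| = |L.det| := by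
      rw [hW, Matrix.det_mul, abs_mul]
      have h6 : IsUnit (G Q).det := by
        have := congrArg Matrix.det (hHG Q hQ)
        rw [Matrix.det_mul, Matrix.det_one, mul_comm] at this
        exact IsUnit.of_mul_eq_one _ this
      have h7 : ((G Q).map (Int.castRingHom ℝ)).det = ((G Q).det : ℝ) := by
        rw [show ((G Q).det : ℝ) = Int.castRingHom ℝ (G Q).det from rfl, RingHom.map_det]; rfl
      rw [h7]
      rcases Int.isUnit_iff.mp h6 with h | h <;> simp [h]
    rw [h4, Matrix.inv_def, Matrix.smul_apply, Matrix.adjugate_apply, Ring.inverse_eq_inv',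
      smul_eq_mul, abs_mul, abs_inv, h5]
    have h8 := abs_det_updateRow_single_le W k k₀ (fun i => (Q : ℝ) ^ c i)
      (fun i => by positivity) (fun i j hj => hG Q hQ i j hj)
    have h9 : ∏ i ∈ Finset.univ.erase k, (Q : ℝ) ^ c i = (Q : ℝ) ^ (-δ - c k) := by
      rw [← Real.rpow_sum_of_pos hQ0']
      congr 1
      rw [← hc, ← Finset.add_sum_erase _ _ (Finset.mem_univ k)]
      ring
    rw [h9] at h8
    calc |L.det|⁻¹ * _ ≤ |L.det|⁻¹ * _ := mul_le_mul_of_nonneg_left h8 (by positivity)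
      _ = _ := by simp only [C₁]; ring
  have hC₁ : 0 < C₁ := by
    have : 0 < |L.det| := abs_pos.mpr hdet
    positivity
  obtain ⟨Q₁, hQ₁⟩ := exists_forall_nat_rpow_lt (C := |(b : ℝ)| * C₁ * (C * B ^ D))
    (e := -δ / 4) (by linarith)
  by_cases hsmall : ∃ Q ∈ S, max Q₁ 1 ≤ Q ∧ ∀ k, |(H Q k₀ k : ℝ)| < (Q : ℝ) ^ γ
  swap
  · right
    push Not at hsmall
    exact ⟨γ, hγ, max Q₁ 1, hsmall⟩
  left
  obtain ⟨Q, hQS, hQ, hlow⟩ := hsmall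
  have hQ1 : 1 ≤ Q := (le_max_right _ _).trans hQ
  have hQ1' : (1 : ℝ) ≤ Q := by exact_mod_cast hQ1
  have hQpos : (0 : ℝ) < Q := by linarith
  -- vanishing of the coefficients with large exponent
  have hvan : ∀ k, -δ / 2 ≤ c k → a Q k = 0 := by
    intro k hk
    by_contra hne0
    let ρ : R := ∑ l, H Q k₀ l • A' l k
    have hρ : (ρ : ℝ) = b * a Q k := by
      simp only [ρ, a, AddSubmonoidClass.coe_finsetSum, Matrix.vecMul, dotProduct, Finset.mul_sum]
      refine Finset.sum_congr rfl fun l _ => ?_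
      simp [A']
      ring
    have hb' : (b : ℝ) ≠ 0 := by exact_mod_cast hb
    have hρ0 : ρ ≠ 0 := by
      intro h
      rw [h] at hρ
      exact (mul_ne_zero hb' hne0) (by simpa using hρ.symm)
    have hQγ : 1 ≤ (Q : ℝ) ^ γ := Real.one_le_rpow hQ1' hγ.le
    have hNρ : N ρ ≤ (Q : ℝ) ^ γ * B := by
      have h1 : N ρ ≤ ∑ l, N (H Q k₀ l • A' l k) := by
        have := Finset.le_sum_of_subadditive N (map_zero N).le (fun x y => map_add_le_add N x y)
          Finset.univ (fun l => H Q k₀ l • A' l k)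
        exact this
      refine h1.trans ((Finset.sum_le_sum fun l _ => (ringSeminorm_zsmul_le N _ _).trans
        (mul_le_mul_of_nonneg_right (hlow l).le (apply_nonneg N _))).trans ?_)
      rw [← Finset.mul_sum]
      exact mul_le_mul_of_nonneg_left (hB k) (by positivity)
    have hmax : max 1 (N ρ) ≤ (Q : ℝ) ^ γ * B :=
      max_le (one_le_mul_of_one_le_of_one_le hQγ hB1) hNρ
    have h1 := hLiou ρ hρ0
    rw [hρ, abs_mul] at h1
    have h2 : max 1 (N ρ) ^ D ≤ (Q : ℝ) ^ (δ / 4) * B ^ D := by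
      refine (pow_le_pow_left₀ (by positivity) hmax D).trans ?_
      rw [mul_pow, ← Real.rpow_natCast, ← Real.rpow_mul hQpos.le]
      gcongr
    have h3 : |a Q k| ≤ C₁ * (Q : ℝ) ^ (-δ / 2) := by
      refine (ha Q hQS hQ1 k).trans ?_
      gcongr
      linarith
    have h4 : |(b : ℝ)| * |a Q k| * (C * max 1 (N ρ) ^ D) ≤
        |(b : ℝ)| * (C₁ * (Q : ℝ) ^ (-δ / 2)) * (C * ((Q : ℝ) ^ (δ / 4) * B ^ D)) := by
      gcongr
    have h5 : (Q : ℝ) ^ (-δ / 2) * (Q : ℝ) ^ (δ / 4) = (Q : ℝ) ^ (-δ / 4) := by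
      rw [← Real.rpow_add hQpos]; congr 1; ring
    have h6 := hQ₁ Q ((le_max_left _ _).trans hQ)
    rw [← h5] at h6
    nlinarith
  -- the form `H Q k₀` kills the columns of `G Q'`
  obtain ⟨Q₂, hQ₂⟩ := exists_forall_nat_rpow_lt (C := ∑ i, |a Q i|) (e := -δ / 2) (by linarith)
  obtain ⟨Q', hQ'S, hQ'⟩ := hS.exists_gt (max Q (max Q₂ 1))
  have hQ'1 : (1 : ℝ) ≤ Q' := by
    exact_mod_cast ((le_max_right _ _).trans (le_max_right _ _)).trans hQ'.le
  have hkill : ∀ k, k ≠ k₀ → (H Q * G Q') k₀ k = 0 := by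
    intro k hk
    have h1 : (((H Q * G Q') k₀ k : ℤ) : ℝ) =
        ∑ i, a Q i * (L * (G Q').map (Int.castRingHom ℝ)) i k := by
      have h2 : (H Q).map (Int.castRingHom ℝ) * L⁻¹ * (L * (G Q').map (Int.castRingHom ℝ)) =
          (H Q * G Q').map (Int.castRingHom ℝ) := by
        rw [← Matrix.mul_assoc, Matrix.mul_assoc _ L⁻¹ L, hLinv, Matrix.mul_one, Matrix.map_mul]
      have h3 := congrFun (congrFun h2 k₀) k
      rw [Matrix.mul_apply, Matrix.map_apply] at h3
      exact h3.symm
    have h2 : |(((H Q * G Q') k₀ k : ℤ) : ℝ)| < 1 := by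
      rw [h1]
      refine lt_of_le_of_lt ((Finset.abs_sum_le_sum_abs _ _).trans ?_)
        (hQ₂ Q' (((le_max_left _ _).trans (le_max_right _ _)).trans hQ'.le))
      rw [Finset.sum_mul]
      refine Finset.sum_le_sum fun i _ => ?_
      rw [abs_mul]
      by_cases hi : -δ / 2 ≤ c i
      · rw [hvan i hi]; simp
      · refine mul_le_mul_of_nonneg_left ((hG Q' hQ'S i k hk).trans ?_) (abs_nonneg _)
        exact Real.rpow_le_rpow_of_exponent_le hQ'1 (not_le.mp hi).le
    have h3 : |(H Q * G Q') k₀ k| < 1 := by exact_mod_cast h2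
    exact Int.abs_lt_one_iff.mp h3
  refine ⟨Q, hQS, Q', hQ'S, ((le_max_left _ _).trans_lt hQ').ne, (H Q * G Q') k₀ k₀, ?_⟩
  have hGH : G Q' * H Q' = 1 := mul_eq_one_comm.mp (hHG Q' hQ'S)
  have heq : H Q k₀ = (H Q * G Q') k₀ k₀ • H Q' k₀ := by
    funext l
    have h1 : H Q = H Q * G Q' * H Q' := by rw [Matrix.mul_assoc, hGH, Matrix.mul_one]
    have h2 := congrFun (congrFun h1 k₀) l
    rw [Matrix.mul_apply, Finset.sum_eq_single k₀] at h2
    · rw [h2]; rfl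
    · intro k _ hk
      rw [hkill k hk, zero_mul]
    · simp
  refine ⟨fun h0 => ?_, heq⟩
  rw [h0, zero_smul] at heq
  have h1 := congrFun (congrFun (hHG Q hQS) k₀) k₀
  rw [Matrix.mul_apply] at h1
  simp [heq] at h1

/-- For a primitive integral vector, some quotient of coordinates has large denominator. -/
theorem exists_large_quotient (M g : ι → ℤ) (hMg : ∑ k, M k * g k = 1) (a : ι) (ha : M a ≠ 0) :
    ∃ b, |M a| ≤ (((M a).natAbs / (M a).gcd (M b) : ℕ) : ℤ) ^ Fintype.card ι := by
  let q : ι → ℕ := fun k => (M a).natAbs / (M a).gcd (M k)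
  have hdvd : ∀ l, M a ∣ (∏ k, (q k : ℤ)) * M l := by
    intro l
    rw [← Finset.mul_prod_erase _ _ (Finset.mem_univ l), mul_right_comm]
    refine Dvd.dvd.mul_right ?_ _
    rw [← Int.natAbs_dvd_natAbs, Int.natAbs_mul, Int.natAbs_natCast]
    obtain ⟨u, hu⟩ := Int.gcd_dvd_natAbs_right (M a) (M l)
    refine ⟨u, ?_⟩
    rw [hu, ← mul_assoc]
    simp only [q]
    rw [Nat.div_mul_cancel (Int.gcd_dvd_natAbs_left (M a) (M l))]
  have h1 : M a ∣ ∏ k, (q k : ℤ) := by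
    have h2 : ∏ k, (q k : ℤ) = ∑ l, (∏ k, (q k : ℤ)) * M l * g l := by
      simp_rw [mul_assoc]
      rw [← Finset.mul_sum, hMg, mul_one]
    rw [h2]
    exact Finset.dvd_sum fun l _ => (hdvd l).mul_right _
  have hqpos : ∀ k, 0 < q k := by
    intro k
    refine Nat.div_pos (Nat.le_of_dvd (Int.natAbs_pos.mpr ha) (Int.gcd_dvd_natAbs_left _ _)) ?_
    exact Int.gcd_pos_of_ne_zero_left _ ha
  have h3 : |M a| ≤ ∏ k, (q k : ℤ) := by
    refine Int.le_of_dvd (Finset.prod_pos fun k _ => by exact_mod_cast hqpos k) ?_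
    rwa [abs_dvd]
  obtain ⟨b, -, hbmax⟩ := Finset.exists_max_image Finset.univ q ⟨a, Finset.mem_univ a⟩
  refine ⟨b, h3.trans ?_⟩
  calc ∏ k, (q k : ℤ) ≤ ∏ _k : ι, (q b : ℤ) :=
        Finset.prod_le_prod (fun k _ => by positivity)
          fun k hk => by exact_mod_cast hbmax k hk
    _ = _ := by simp [q]

end Height

end SubspaceThm

namespace SubspaceThm

open MvPolynomial

section IndexF

variable {ι : Type*} [Fintype ι] [DecidableEq ι] {m : ℕ}

theorem coeff_linSub_diagonal {R : Type*} [CommRing R] (d : Fin m → ι → R)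
    (p : MvPolynomial (Fin m × ι) R) (j : Fin m × ι →₀ ℕ) :
    coeff j (linSub (fun h => Matrix.diagonal (d h)) p) =
      coeff j p * ∏ hk, d hk.1 hk.2 ^ j hk := by
  have h1 : ∀ hk : Fin m × ι, (∑ l, C (Matrix.diagonal (d hk.1) hk.2 l) * X (hk.1, l) :
      MvPolynomial (Fin m × ι) R) = C (d hk.1 hk.2) * X hk := by
    intro hk
    rw [Finset.sum_eq_single hk.2]
    · simp
    · intro l _ hl
      simp [Matrix.diagonal_apply_ne _ hl.symm]
    · simp
  rw [linSub, aeval_eq_eval₂Hom, coe_eval₂Hom, eval₂_eq', coeff_sum]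
  have h2 : ∀ i : Fin m × ι →₀ ℕ, coeff j (algebraMap R (MvPolynomial (Fin m × ι) R) (coeff i p) *
      ∏ hk : Fin m × ι, (∑ l, C (Matrix.diagonal (d hk.1) hk.2 l) * X (hk.1, l)) ^ i hk) =
      if i = j then coeff i p * ∏ hk, d hk.1 hk.2 ^ i hk else 0 := by
    intro i
    simp_rw [h1, mul_pow]
    rw [Finset.prod_mul_distrib, algebraMap_eq, coeff_C_mul]
    simp_rw [← map_pow]
    rw [← map_prod, coeff_C_mul]
    have h3 : (∏ hk, X hk ^ i hk : MvPolynomial (Fin m × ι) R) = monomial i 1 := by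
      rw [monomial_eq, Finsupp.prod_fintype _ _ (by simp)]
      simp
    rw [h3, coeff_monomial]
    split_ifs <;> simp
  simp_rw [h2]
  rw [Finset.sum_ite_eq']
  split_ifs with h
  · rfl
  · rw [notMem_support_iff.mp h, zero_mul]

theorem lOne_linSub_exp_le (W : Fin m → Matrix ι ι ℝ) (c : ι → ℝ) (ℓ : Fin m → ℝ) {C₁ B : ℝ}
    (hC₁ : 0 ≤ C₁) (hrow : ∀ h i k, |W h i k| ≤ C₁ * Real.exp (ℓ h * c i)) {r : Fin m → ℕ}
    {P : MvPolynomial (Fin m × ι) ℝ} (hP : MHom r P)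
    (hB : ∀ i ∈ P.support, ∑ hk : Fin m × ι, (i hk : ℝ) * (ℓ hk.1 * c hk.2) ≤ B) :
    lOne (normRingSeminorm ℝ) (linSub W P) ≤ lOne (normRingSeminorm ℝ) P *
      ((Fintype.card ι * C₁) ^ (∑ h, r h) * Real.exp B) := by
  refine lOne_aeval_le (norm_one (α := ℝ)).le _ P _ fun i hi => ?_
  have h1 : ∀ hk : Fin m × ι, lOne (normRingSeminorm ℝ)
      (∑ l, C (W hk.1 hk.2 l) * X (hk.1, l) :
        MvPolynomial (Fin m × ι) ℝ) ≤ Fintype.card ι * C₁ * Real.exp (ℓ hk.1 * c hk.2) := by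
    intro hk
    have h2 : ∀ l ∈ Finset.univ, lOne (normRingSeminorm ℝ) (C (W hk.1 hk.2 l) * X (hk.1, l) :
        MvPolynomial (Fin m × ι) ℝ) ≤ C₁ * Real.exp (ℓ hk.1 * c hk.2) := by
      intro l _
      refine (lOne_mul_le _ _ _).trans ?_
      rw [lOne_C, X, lOne_monomial]
      change ‖W hk.1 hk.2 l‖ * ‖(1 : ℝ)‖ ≤ _
      rw [norm_one, mul_one]
      exact hrow _ _ _
    refine (lOne_sum_le _ _ _).trans ((Finset.sum_le_card_nsmul _ _ _ h2).trans (le_of_eq ?_))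
    rw [nsmul_eq_mul, Finset.card_univ]; ring
  refine (Finset.prod_le_prod (fun hk _ => pow_nonneg (lOne_nonneg _ _) _) fun hk _ =>
    pow_le_pow_left₀ (lOne_nonneg _ _) (h1 hk) _).trans ?_
  simp_rw [mul_pow]
  rw [Finset.prod_mul_distrib, ← mul_pow]
  have h2 : ∏ hk : Fin m × ι, (Fintype.card ι : ℝ) ^ i hk * C₁ ^ i hk = (Fintype.card ι * C₁) ^ ∑ h, r h := by
    simp_rw [← mul_pow]
    rw [Finset.prod_pow_eq_pow_sum, hP.sum_eq hi]
  rw [h2]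
  refine mul_le_mul_of_nonneg_left ?_ (by positivity)
  simp_rw [← Real.exp_nat_mul]
  rw [← Real.exp_sum]
  refine Real.exp_le_exp.mpr ?_
  exact hB i hi

theorem sum_weight_le (c : ι → ℝ) {δ cb n : ℝ} (hcb : 0 < cb) (hn1 : 1 ≤ n)
    (hccb : ∀ i, |c i| ≤ cb) (r : Fin m → ℕ) (hr' : ∀ h, (0 : ℝ) < r h) (ℓ : Fin m → ℝ)
    {Λ : ℝ} (hΛ : 0 < Λ) (hΛ₁ : ∀ h, Λ ≤ r h * ℓ h)
    (hΛ₂ : ∀ h, r h * ℓ h ≤ (1 + δ / (8 * n * cb)) * Λ) (i : Fin m × ι →₀ ℕ)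
    (hi : ∀ h, ∑ k, i (h, k) = r h)
    (hwt : ∑ h, (∑ k, c k * i (h, k)) / r h < -(δ * m / (2 * n))) :
    ∑ hk : Fin m × ι, (i hk : ℝ) * (ℓ hk.1 * c hk.2) ≤ -(3 * Λ * δ * m / (8 * n)) := by
  set ε := δ / (8 * n * cb) with hε
  set u : Fin m → ℝ := fun h => (∑ k, c k * i (h, k)) / r h with hu
  have hu1 : ∑ hk : Fin m × ι, (i hk : ℝ) * (ℓ hk.1 * c hk.2) = ∑ h, (r h * ℓ h) * u h := by
    rw [Fintype.sum_prod_type]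
    refine Finset.sum_congr rfl fun h _ => ?_
    rw [hu]
    have := (hr' h).ne'
    field_simp
    rw [Finset.mul_sum]
    exact Finset.sum_congr rfl fun k _ => by ring
  have hu2 : ∀ h, |u h| ≤ cb := by
    intro h
    rw [hu, abs_div, abs_of_pos (hr' h), div_le_iff₀ (hr' h)]
    refine (Finset.abs_sum_le_sum_abs _ _).trans ?_
    have h3 : ∑ k, (i (h, k) : ℝ) = r h := by exact_mod_cast hi h
    rw [← h3, Finset.mul_sum]
    refine Finset.sum_le_sum fun k _ => ?_
    rw [abs_mul, Nat.abs_cast]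
    exact mul_le_mul_of_nonneg_right (hccb k) (by positivity)
  rw [hu1]
  have hu3 : ∀ h, (r h * ℓ h) * u h ≤ Λ * u h + ε * Λ * cb := by
    intro h
    have h4 : 0 ≤ r h * ℓ h - Λ := by linarith [hΛ₁ h]
    have h5 : r h * ℓ h - Λ ≤ ε * Λ := by linarith [hΛ₂ h]
    have h6 := (abs_le.mp (hu2 h)).2
    have h7 : (r h * ℓ h - Λ) * u h ≤ (r h * ℓ h - Λ) * cb := mul_le_mul_of_nonneg_left h6 h4
    have h8 : (r h * ℓ h - Λ) * cb ≤ ε * Λ * cb := mul_le_mul_of_nonneg_right h5 hcb.le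
    linarith
  refine (Finset.sum_le_sum fun h _ => hu3 h).trans ?_
  rw [Finset.sum_add_distrib, ← Finset.mul_sum]
  simp only [Finset.sum_const, Finset.card_univ, Fintype.card_fin, nsmul_eq_mul]
  have h9 : ∑ h, u h < -(δ * m / (2 * n)) := hwt
  have h10 : Λ * ∑ h, u h ≤ Λ * -(δ * m / (2 * n)) := mul_le_mul_of_nonneg_left h9.le hΛ.le
  have h11 : ε * Λ * cb = Λ * δ / (8 * n) := by rw [hε]; field_simp
  rw [h11]
  have h12 : Λ * -(δ * m / (2 * n)) + m * (Λ * δ / (8 * n)) = -(3 * Λ * δ * m / (8 * n)) := by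
    field_simp; ring
  linarith

theorem prod_exp_pow (k₀ : ι) (y : Fin m → ℝ) (j : Fin m × ι →₀ ℕ) :
    ∏ hk : Fin m × ι, (if hk.2 = k₀ then Real.exp (-y hk.1) else 1) ^ j hk =
      Real.exp (-(∑ h, y h * j (h, k₀))) := by
  rw [Fintype.prod_prod_type, ← Finset.sum_neg_distrib, Real.exp_sum]
  refine Finset.prod_congr rfl fun h _ => ?_
  rw [Finset.prod_eq_single k₀]
  · simp only [if_true]
    rw [← Real.exp_nat_mul]
    congr 1; ring
  · intro k _ hk; simp [hk]
  · simp

/-- A polynomial which has only monomials of small weight in the linear forms `L` has large index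
along the hyperplanes spanned by integral vectors at which the forms are small. -/
theorem wtGE_linSub_of_small [Nonempty ι] (L : Matrix ι ι ℝ) (hdet : L.det ≠ 0) (c : ι → ℝ)
    {δ cb : ℝ} (hδ : 0 < δ) (hcb : 0 < cb) (hccb : ∀ i, |c i| ≤ cb)
    (hδcb : δ ≤ 8 * Fintype.card ι * cb)
    (k₀ : ι) (r : Fin m → ℕ) (hr : ∀ h, 0 < r h) (P : MvPolynomial (Fin m × ι) ℤ) (hP : MHom r P)
    {E C₁ : ℝ} (hE : 1 ≤ E) (hC₁ : 1 ≤ C₁)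
    (hlOne : lOne (normRingSeminorm ℝ) (linSub (fun _ => L⁻¹) (map (Int.castRingHom ℝ) P)) ≤
      E ^ ∑ h, r h)
    (hwt : ∀ j ∈ (linSub (fun _ => L⁻¹) (map (Int.castRingHom ℝ) P)).support,
      ∑ h, (∑ k, c k * j (h, k)) / r h < -(δ * m / (2 * Fintype.card ι)))
    (G : Fin m → Matrix ι ι ℤ) (ℓ : Fin m → ℝ) (hℓ : ∀ h, 0 ≤ ℓ h)
    (hG : ∀ h i k, k ≠ k₀ → |(L * (G h).map (Int.castRingHom ℝ)) i k| ≤ Real.exp (ℓ h * c i))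
    (hG₀ : ∀ h i, |(L * (G h).map (Int.castRingHom ℝ)) i k₀| ≤ C₁)
    {Λ : ℝ} (hΛ : 0 < Λ) (hΛ₁ : ∀ h, Λ ≤ r h * ℓ h)
    (hΛ₂ : ∀ h, r h * ℓ h ≤ (1 + δ / (8 * Fintype.card ι * cb)) * Λ)
    (hbig : (E * (Fintype.card ι * C₁)) ^ ∑ h, r h <
      Real.exp (Λ * δ * m / (4 * Fintype.card ι))) :
    WtGE (fun hk : Fin m × ι => if hk.2 = k₀ then 1 / (r hk.1 : ℝ) else 0)
      (δ * m / (16 * Fintype.card ι * cb)) (linSub G P) := by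
  set n : ℝ := ((Fintype.card ι : ℕ) : ℝ) with hn
  have hn1 : 1 ≤ n := by rw [hn]; exact_mod_cast Fintype.card_pos
  set s := ∑ h, r h with hs
  set ε := δ / (8 * n * cb) with hε
  have hε1 : ε ≤ 1 := by rw [hε, div_le_one (by positivity)]; exact hδcb
  have hε0 : 0 < ε := by positivity
  have hr' : ∀ h, (0 : ℝ) < r h := fun h => by exact_mod_cast hr h
  set Pt := linSub (fun _ => L⁻¹) (map (Int.castRingHom ℝ) P) with hPt
  have hPtM : MHom r Pt := (hP.map _).linSub _
  intro j hj
  by_contra hcon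
  rw [not_le] at hcon
  let d : Fin m → ι → ℝ := fun h k => if k = k₀ then Real.exp (-(cb * ℓ h)) else 1
  let W : Fin m → Matrix ι ι ℝ := fun h => L * (G h).map (Int.castRingHom ℝ)
  let Fs := linSub (fun h => W h * Matrix.diagonal (d h)) Pt
  have hFs : Fs = linSub (fun h => Matrix.diagonal (d h)) (map (Int.castRingHom ℝ) (linSub G P)) := by
    have h1 : (fun h => L⁻¹ * (W h * Matrix.diagonal (d h))) =
        fun h => (G h).map (Int.castRingHom ℝ) * Matrix.diagonal (d h) := by
      funext h
      rw [← Matrix.mul_assoc, ← Matrix.mul_assoc, Matrix.nonsing_inv_mul L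
        (isUnit_iff_ne_zero.mpr hdet), Matrix.one_mul]
    rw [map_linSub, linSub_linSub, ← h1]
    exact linSub_linSub _ _ _
  have hcoeff : coeff j Fs = ((coeff j (linSub G P) : ℤ) : ℝ) * ∏ hk : Fin m × ι, d hk.1 hk.2 ^ j hk := by
    rw [hFs, coeff_linSub_diagonal, coeff_map]; rfl
  -- the size of the substituted forms
  have hrow : ∀ h i k, |(W h * Matrix.diagonal (d h)) i k| ≤ C₁ * Real.exp (ℓ h * c i) := by
    intro h i k
    rw [Matrix.mul_diagonal, abs_mul]
    by_cases hk : k = k₀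
    · subst hk
      simp only [d, if_true, Real.abs_exp]
      refine mul_le_mul (hG₀ h i) (Real.exp_le_exp.mpr ?_) (Real.exp_nonneg _) (by linarith)
      have := neg_le_of_abs_le (hccb i)
      nlinarith [hℓ h]
    · simp only [d, if_neg hk, abs_one, mul_one]
      exact (hG h i k hk).trans (le_mul_of_one_le_left (Real.exp_nonneg _) hC₁)
  have hFsle : lOne (normRingSeminorm ℝ) Fs ≤
      E ^ s * ((n * C₁) ^ s * Real.exp (-(3 * Λ * δ * m / (8 * n)))) := by
    refine (lOne_linSub_exp_le _ c ℓ (by linarith) hrow hPtM fun i hi =>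
      sum_weight_le c hcb hn1 hccb r hr' ℓ hΛ hΛ₁ hΛ₂ i (hPtM i hi) (hwt i hi)).trans ?_
    exact mul_le_mul_of_nonneg_right hlOne (by positivity)
  -- undoing the scaling
  have hsum : ∑ h, (j (h, k₀) : ℝ) / r h < δ * m / (16 * n * cb) := by
    refine lt_of_eq_of_lt ?_ hcon
    rw [Fintype.sum_prod_type]
    refine Finset.sum_congr rfl fun h _ => ?_
    rw [Finset.sum_eq_single k₀]
    · simp; ring
    · intro k _ hk; simp [hk]
    · simp
  have hprod : ∏ hk : Fin m × ι, d hk.1 hk.2 ^ j hk =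
      Real.exp (-(∑ h, cb * ℓ h * j (h, k₀))) := prod_exp_pow k₀ (fun h => cb * ℓ h) j
  have hscale : ∑ h, cb * ℓ h * j (h, k₀) ≤ Λ * δ * m / (8 * n) := by
    have h1 : ∀ h, cb * ℓ h * j (h, k₀) ≤ 2 * Λ * cb * ((j (h, k₀) : ℝ) / r h) := by
      intro h
      have h2 : r h * ℓ h ≤ 2 * Λ := (hΛ₂ h).trans (by nlinarith)
      have h3 : cb * ℓ h * j (h, k₀) = (r h * ℓ h) * (cb * ((j (h, k₀) : ℝ) / r h)) := by
        have := (hr' h).ne'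
        field_simp
      rw [h3]
      have h4 : 0 ≤ cb * ((j (h, k₀) : ℝ) / r h) := by have := hr' h; positivity
      nlinarith
    refine (Finset.sum_le_sum fun h _ => h1 h).trans ?_
    rw [← Finset.mul_sum]
    have h5 : 2 * Λ * cb * (δ * m / (16 * n * cb)) = Λ * δ * m / (8 * n) := by field_simp; ring
    rw [← h5]
    exact mul_le_mul_of_nonneg_left hsum.le (by positivity)
  have hlt : |((coeff j (linSub G P) : ℤ) : ℝ)| < 1 := by
    have h1 : |coeff j Fs| ≤ E ^ s * ((n * C₁) ^ s * Real.exp (-(3 * Λ * δ * m / (8 * n)))) :=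
      (coeff_le_lOne (normRingSeminorm ℝ) Fs j).trans hFsle
    rw [hcoeff, hprod, abs_mul, Real.abs_exp] at h1
    have h2 : |((coeff j (linSub G P) : ℤ) : ℝ)| =
        |((coeff j (linSub G P) : ℤ) : ℝ)| * Real.exp (-(∑ h, cb * ℓ h * j (h, k₀))) *
          Real.exp (∑ h, cb * ℓ h * j (h, k₀)) := by
      rw [mul_assoc, ← Real.exp_add]; simp
    rw [h2]
    calc _ ≤ E ^ s * ((n * C₁) ^ s * Real.exp (-(3 * Λ * δ * m / (8 * n)))) *
          Real.exp (Λ * δ * m / (8 * n)) := by gcongr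
      _ = (E * (n * C₁)) ^ s * Real.exp (-(Λ * δ * m / (4 * n))) := by
        have h3 : -(Λ * δ * m / (4 * n)) = -(3 * Λ * δ * m / (8 * n)) + Λ * δ * m / (8 * n) := by
          field_simp; ring
        rw [h3, Real.exp_add, mul_pow E]; ring
      _ < Real.exp (Λ * δ * m / (4 * n)) * Real.exp (-(Λ * δ * m / (4 * n))) :=
        mul_lt_mul_of_pos_right hbig (Real.exp_pos _)
      _ = 1 := by rw [← Real.exp_add]; simp
  have hlt' : |coeff j (linSub G P)| < 1 := by exact_mod_cast hlt
  exact mem_support_iff.mp hj (Int.abs_lt_one_iff.mp hlt')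

end IndexF

end SubspaceThm

namespace SubspaceThm

open MvPolynomial

section Restrict

variable {ι : Type*} [Fintype ι] [DecidableEq ι] {m : ℕ}

theorem eval₂_linSub {T : Type*} [CommRing T] (G : Fin m → Matrix ι ι ℤ) (f g : Fin m × ι → T)
    (hfg : ∀ h k, ∑ l, (G h k l : T) * g (h, l) = f (h, k)) (P : MvPolynomial (Fin m × ι) ℤ) :
    eval₂ (Int.castRingHom T) g (linSub G P) = eval₂ (Int.castRingHom T) f P := by
  have h : (eval₂Hom (Int.castRingHom T) g).comp (linSub G).toRingHom =
      eval₂Hom (Int.castRingHom T) f := by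
    refine ringHom_ext (fun n => by simp) fun hk => ?_
    have h1 := hfg hk.1 hk.2
    simp only [RingHom.comp_apply, AlgHom.toRingHom_eq_coe, RingHom.coe_coe, linSub_X, map_sum,
      map_mul, eval₂Hom_X', eq_intCast, map_intCast]
    exact h1
  exact DFunLike.congr_fun h P

theorem wtGE_coeff_eval₂ (k₀ : ι) (w : Fin m → ℝ) (hw : ∀ h, 0 ≤ w h) {c₀ : ℝ}
    (g : Fin m × ι → MvPolynomial (Fin m × ι) (MvPolynomial (Fin m) ℚ))
    (hg : ∀ h, g (h, k₀) = C (X h)) (Q : MvPolynomial (Fin m × ι) ℤ)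
    (hQ : WtGE (fun hk : Fin m × ι => if hk.2 = k₀ then w hk.1 else 0) c₀ Q)
    (ν : Fin m × ι →₀ ℕ) :
    WtGE w c₀ (coeff ν (eval₂ (Int.castRingHom _) g Q)) := by
  rw [eval₂_eq', coeff_sum]
  refine WtGE.sum fun j hj => ?_
  have h1 : ∏ hk, g hk ^ j hk = C (∏ h, X h ^ j (h, k₀)) *
      ∏ h, ∏ k ∈ Finset.univ.erase k₀, g (h, k) ^ j (h, k) := by
    rw [Fintype.prod_prod_type, map_prod, ← Finset.prod_mul_distrib]
    refine Finset.prod_congr rfl fun h _ => ?_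
    rw [← Finset.mul_prod_erase _ _ (Finset.mem_univ k₀), hg, map_pow]
  have h2 : (Int.castRingHom (MvPolynomial (Fin m × ι) (MvPolynomial (Fin m) ℚ))) (coeff j Q) =
      C ((coeff j Q : ℤ) : MvPolynomial (Fin m) ℚ) := by simp
  rw [h1, h2, coeff_C_mul, coeff_C_mul]
  have h3 : WtGE w (∑ h, (j (h, k₀) : ℝ) * w h) (∏ h, X h ^ j (h, k₀) : MvPolynomial (Fin m) ℚ) := by
    refine WtGE.prod hw fun h _ => ?_
    rw [X_pow_eq_monomial]
    intro i hi
    have := support_monomial_subset hi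
    rw [Finset.mem_singleton] at this
    subst this
    rw [Finset.sum_eq_single h]
    · simp
    · intro b _ hb; simp [hb.symm]
    · simp
  have h4 : c₀ ≤ ∑ h, (j (h, k₀) : ℝ) * w h := by
    refine (hQ j hj).trans (le_of_eq ?_)
    rw [Fintype.sum_prod_type]
    refine Finset.sum_congr rfl fun h _ => ?_
    rw [Finset.sum_eq_single k₀] <;> simp +contextual
  have h5 := (wtGE_of_nonpos hw le_rfl ((coeff j Q : ℤ) : MvPolynomial (Fin m) ℚ)).mul
    (h3.mul (wtGE_of_nonpos hw le_rfl (coeff ν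
      (∏ h, ∏ k ∈ Finset.univ.erase k₀, g (h, k) ^ j (h, k)))))
  exact h5.mono (by linarith)

/-- The part of an exponent away from two coordinates of each block. -/
noncomputable def restExp (a b : Fin m → ι) (i : Fin m × ι →₀ ℕ) : Fin m × ι →₀ ℕ :=
  Finsupp.equivFunOnFinite.symm fun hk => if hk.2 = a hk.1 ∨ hk.2 = b hk.1 then 0 else i hk

theorem restExp_apply (a b : Fin m → ι) (i : Fin m × ι →₀ ℕ) (hk : Fin m × ι) :
    restExp a b i hk = if hk.2 = a hk.1 ∨ hk.2 = b hk.1 then 0 else i hk := rfl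

/-- The exponent with given part away from two coordinates of each block, given value at one of the
coordinates, and given total degree. -/
noncomputable def fillExp (a b : Fin m → ι) (r : Fin m → ℕ) (ν : Fin m × ι →₀ ℕ)
    (α : Fin m →₀ ℕ) : Fin m × ι →₀ ℕ :=
  Finsupp.equivFunOnFinite.symm fun hk => if hk.2 = a hk.1 then α hk.1 else
    if hk.2 = b hk.1 then r hk.1 - (∑ k, ν (hk.1, k)) - α hk.1 else ν hk

theorem fillExp_apply (a b : Fin m → ι) (r : Fin m → ℕ) (ν : Fin m × ι →₀ ℕ)
    (α : Fin m →₀ ℕ) (hk : Fin m × ι) : fillExp a b r ν α hk = if hk.2 = a hk.1 then α hk.1 else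
    if hk.2 = b hk.1 then r hk.1 - (∑ k, ν (hk.1, k)) - α hk.1 else ν hk := rfl

theorem fillExp_injective (a b : Fin m → ι) (r : Fin m → ℕ) (ν : Fin m × ι →₀ ℕ) :
    Function.Injective (fillExp a b r ν) := by
  intro α β h
  ext k
  have := DFunLike.congr_fun h (k, a k)
  simpa [fillExp_apply] using this

theorem restExp_fillExp (a b : Fin m → ι) (r : Fin m → ℕ) (i : Fin m × ι →₀ ℕ)
    (α : Fin m →₀ ℕ) : restExp a b (fillExp a b r (restExp a b i) α) = restExp a b i := by
  ext hk
  simp only [restExp_apply, fillExp_apply]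
  split_ifs <;> tauto

theorem sum_restExp_add {a b : Fin m → ι} (hab : ∀ h, a h ≠ b h) (i : Fin m × ι →₀ ℕ) (h : Fin m) :
    ∑ k, restExp a b i (h, k) + i (h, a h) + i (h, b h) = ∑ k, i (h, k) := by
  have h1 : ∑ k, i (h, k) = ∑ k, (restExp a b i (h, k) + (if k = a h then i (h, a h) else 0) +
      (if k = b h then i (h, b h) else 0)) := by
    refine Finset.sum_congr rfl fun k _ => ?_
    rw [restExp_apply]
    by_cases h2 : k = a h
    · subst h2; simp [hab h]
    · by_cases h3 : k = b h
      · subst h3; simp [h2]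
      · simp [h2, h3]
  rw [h1, Finset.sum_add_distrib, Finset.sum_add_distrib]
  simp

theorem fillExp_restExp {a b : Fin m → ι} (hab : ∀ h, a h ≠ b h) {r : Fin m → ℕ}
    {i : Fin m × ι →₀ ℕ} (hi : ∀ h, ∑ k, i (h, k) = r h) :
    fillExp a b r (restExp a b i) (Finsupp.equivFunOnFinite.symm fun h => i (h, a h)) = i := by
  ext ⟨h, k⟩
  have h1 := sum_restExp_add hab i h
  have h2 := hi h
  simp only [fillExp_apply, restExp_apply (hk := (h, k)), Finsupp.coe_equivFunOnFinite_symm]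
  split_ifs with h3 h4 <;> grind

theorem prod_pow_eq_mul_monomial {S : Type*} [CommRing S] {a b : Fin m → ι}
    (f : Fin m × ι → MvPolynomial (Fin m × ι) S) (hfb : ∀ h, f (h, b h) = 1)
    (hf : ∀ h k, k ≠ a h → k ≠ b h → f (h, k) = X (h, k)) (i : Fin m × ι →₀ ℕ) :
    ∏ hk, f hk ^ i hk = (∏ h, f (h, a h) ^ i (h, a h)) * monomial (restExp a b i) 1 := by
  rw [monomial_eq, map_one, one_mul, Finsupp.prod_fintype _ _ (by simp),
    Fintype.prod_prod_type, Fintype.prod_prod_type, ← Finset.prod_mul_distrib]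
  refine Finset.prod_congr rfl fun h _ => ?_
  have h1 : ∏ k, f (h, k) ^ i (h, k) = ∏ k, ((if k = a h then f (h, a h) ^ i (h, a h) else 1) *
      X (h, k) ^ restExp a b i (h, k)) := by
    refine Finset.prod_congr rfl fun k _ => ?_
    rw [restExp_apply]
    by_cases h2 : k = a h
    · subst h2; simp
    · by_cases h3 : k = b h
      · subst h3; simp [h2, hfb]
      · simp [h2, h3, hf h k h2 h3]
  rw [h1, Finset.prod_mul_distrib]
  simp

theorem exists_coeff_eval₂_eq {a b : Fin m → ι} (hab : ∀ h, a h ≠ b h) {r : Fin m → ℕ}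
    {P : MvPolynomial (Fin m × ι) ℤ} (hP0 : P ≠ 0) (hP : MHom r P) (ξ : Fin m → ℚ)
    (f : Fin m × ι → MvPolynomial (Fin m × ι) (MvPolynomial (Fin m) ℚ))
    (hfa : ∀ h, constantCoeff (f (h, a h)) = X h + C (ξ h)) (hfb : ∀ h, f (h, b h) = 1)
    (hf : ∀ h k, k ≠ a h → k ≠ b h → f (h, k) = X (h, k)) :
    ∃ ν : Fin m × ι →₀ ℕ, ∃ p : MvPolynomial (Fin m) ℤ, p ≠ 0 ∧ (∀ h, degreeOf h p ≤ r h) ∧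
      lOne (normRingSeminorm ℤ) p ≤ lOne (normRingSeminorm ℤ) P ∧
      coeff ν (eval₂ (Int.castRingHom _) f P) = translate ξ (map (Int.castRingHom ℚ) p) := by
  obtain ⟨i₀, hi₀, hmin⟩ := Finset.exists_min_image P.support
    (fun i => ∑ hk, restExp a b i hk) (support_nonempty.mpr hP0)
  set ν := restExp a b i₀ with hν
  set e := fillExp a b r ν with he
  have hinj : Function.Injective e := fillExp_injective a b r ν
  have hfill : ∀ i ∈ P.support, restExp a b i = ν →
      e (Finsupp.equivFunOnFinite.symm fun h => i (h, a h)) = i := by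
    intro i hi h
    rw [he, ← h]
    exact fillExp_restExp hab (hP i hi)
  have hrest : ∀ α, restExp a b (e α) = ν := fun α => restExp_fillExp a b r i₀ α
  have hea : ∀ α h, e α (h, a h) = α h := fun α h => by simp [he, fillExp_apply]
  refine ⟨ν, slice e hinj P, ?_, ?_, lOne_slice_le _ _, ?_⟩
  · intro h0
    have h1 : coeff (Finsupp.equivFunOnFinite.symm fun h => i₀ (h, a h)) (slice e hinj P) = 0 := by
      rw [h0, coeff_zero]
    rw [coeff_slice, hfill i₀ hi₀ rfl] at h1
    exact mem_support_iff.mp hi₀ h1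
  · intro h
    rw [degreeOf_le_iff]
    intro α hα
    rw [support_slice, Finset.mem_preimage] at hα
    rw [← hea α h, ← hP _ hα h]
    exact Finset.single_le_sum (f := fun k => e α (h, k)) (fun _ _ => Nat.zero_le _)
      (Finset.mem_univ (a h))
  · have hterm : ∀ i ∈ P.support, coeff ν ((Int.castRingHom _) (coeff i P) * ∏ hk, f hk ^ i hk) =
        if restExp a b i = ν then
          ((coeff i P : ℤ) : MvPolynomial (Fin m) ℚ) * ∏ h, (X h + C (ξ h)) ^ i (h, a h) else 0 := by
      intro i hi
      have h2 : (Int.castRingHom (MvPolynomial (Fin m × ι) (MvPolynomial (Fin m) ℚ))) (coeff i P) =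
        C ((coeff i P : ℤ) : MvPolynomial (Fin m) ℚ) := by simp
      rw [h2, coeff_C_mul, prod_pow_eq_mul_monomial f hfb hf, coeff_mul_monomial']
      have h3 : restExp a b i ≤ ν ↔ restExp a b i = ν := by
        refine ⟨fun h => ?_, fun h => h.le⟩
        have h4 := hmin i hi
        have h5 : ∑ hk, restExp a b i hk = ∑ hk, ν hk :=
          le_antisymm (Finset.sum_le_sum fun hk _ => h hk) h4
        ext hk
        exact (Finset.sum_eq_sum_iff_of_le fun hk _ => h hk).mp h5 hk (Finset.mem_univ _)
      simp only [h3]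
      split_ifs with h6
      · rw [h6, tsub_self, mul_one]
        change _ * constantCoeff _ = _
        rw [map_prod]
        simp_rw [map_pow, hfa]
      · rw [mul_zero]
    rw [eval₂_eq', coeff_sum, Finset.sum_congr rfl hterm, ← Finset.sum_filter]
    rw [translate, aeval_eq_eval₂Hom, coe_eval₂Hom, eval₂_map, eval₂_eq', support_slice]
    symm
    refine Finset.sum_bij (fun α _ => e α) ?_ (fun _ _ _ _ h => hinj h) ?_ ?_
    · intro α hα
      rw [Finset.mem_preimage] at hα
      exact Finset.mem_filter.mpr ⟨hα, hrest α⟩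
    · intro i hi
      rw [Finset.mem_filter] at hi
      refine ⟨Finsupp.equivFunOnFinite.symm fun h => i (h, a h), ?_, hfill i hi.1 hi.2⟩
      rw [Finset.mem_preimage, hfill i hi.1 hi.2]
      exact hi.1
    · intro α _
      rw [coeff_slice]
      simp [hea]

theorem exists_updateCol_preimage {T : Type*} [CommRing T] (G H : Matrix ι ι ℤ) (hHG : H * G = 1)
    (k₀ a : ι) (f : ι → T) (x : T) (hf : ∑ k, (H k₀ k : T) * f k = (H k₀ a : T) * x) :
    ∃ g : ι → T, g k₀ = x ∧ ∀ k, ∑ l, (((G.updateCol k₀ (Pi.single a 1)) k l : ℤ) : T) * g l = f k := by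
  have hGH : ∀ k k', ∑ l, (G k l : T) * (H l k' : T) = if k = k' then 1 else 0 := by
    intro k k'
    have h0 : G * H = 1 := mul_eq_one_comm.mp hHG
    have h1 := congrFun (congrFun h0 k) k'
    rw [Matrix.mul_apply, Matrix.one_apply] at h1
    exact_mod_cast congrArg (Int.cast : ℤ → T) h1
  let g : ι → T := fun l => ∑ k, (H l k : T) * f k - (H l a : T) * x + (if l = k₀ then x else 0)
  have hg0 : g k₀ = x := by simp [g, hf]
  refine ⟨g, hg0, fun k => ?_⟩
  have h1 : ∀ l, (((G.updateCol k₀ (Pi.single a 1)) k l : ℤ) : T) * g l =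
      (∑ k', ((G k l : T) * (H l k' : T)) * f k') - ((G k l : T) * (H l a : T)) * x +
        (if l = k₀ then (if k = a then x else 0) else 0) := by
    intro l
    have h2 : ∑ k', ((G k l : T) * (H l k' : T)) * f k' = (G k l : T) * ∑ k', (H l k' : T) * f k' := by
      rw [Finset.mul_sum]
      exact Finset.sum_congr rfl fun _ _ => by ring
    rw [Matrix.updateCol_apply, h2]
    by_cases hl : l = k₀
    · subst hl
      rw [hf, hg0]
      by_cases hk : k = a
      · subst hk; simp; ring
      · simp [hk]; ring
    · simp only [g, if_neg hl, add_zero]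
      ring
  rw [Finset.sum_congr rfl fun l _ => h1 l, Finset.sum_add_distrib, Finset.sum_sub_distrib,
    Finset.sum_comm, ← Finset.sum_mul]
  simp_rw [← Finset.sum_mul, hGH]
  simp

/-- Restriction of a polynomial with large index to a line in each block of variables. -/
theorem exists_restriction {r : Fin m → ℕ} {P : MvPolynomial (Fin m × ι) ℤ} (hP0 : P ≠ 0)
    (hP : MHom r P) (G H : Fin m → Matrix ι ι ℤ) (hHG : ∀ h, H h * G h = 1) (k₀ : ι)
    {a b : Fin m → ι} (hab : ∀ h, a h ≠ b h) (ha : ∀ h, H h k₀ (a h) ≠ 0) {c₀ : ℝ}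
    (hwt : WtGE (fun hk : Fin m × ι => if hk.2 = k₀ then 1 / (r hk.1 : ℝ) else 0) c₀
      (linSub (fun h => (G h).updateCol k₀ (Pi.single (a h) 1)) P)) :
    ∃ p : MvPolynomial (Fin m) ℤ, p ≠ 0 ∧ (∀ h, degreeOf h p ≤ r h) ∧
      lOne (normRingSeminorm ℤ) p ≤ lOne (normRingSeminorm ℤ) P ∧
      WtGE (fun h => 1 / (r h : ℝ)) c₀ (translate (fun h => -((H h k₀ (b h) : ℚ) / H h k₀ (a h)))
        (map (Int.castRingHom ℚ) p)) := by
  let T := MvPolynomial (Fin m × ι) (MvPolynomial (Fin m) ℚ)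
  let ξ : Fin m → ℚ := fun h => -((H h k₀ (b h) : ℚ) / H h k₀ (a h))
  let f : Fin m × ι → T := fun hk =>
    if hk.2 = a hk.1 then C (X hk.1 + C (ξ hk.1)) - ∑ k ∈ Finset.univ.filter
      (fun k => k ≠ a hk.1 ∧ k ≠ b hk.1), C (C ((H hk.1 k₀ k : ℚ) / H hk.1 k₀ (a hk.1))) * X (hk.1, k)
    else if hk.2 = b hk.1 then 1 else X hk
  have hfa : ∀ h, f (h, a h) = C (X h + C (ξ h)) - ∑ k ∈ Finset.univ.filter
      (fun k => k ≠ a h ∧ k ≠ b h), C (C ((H h k₀ k : ℚ) / H h k₀ (a h))) * X (h, k) := fun h => by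
    simp [f]
  have hfb : ∀ h, f (h, b h) = 1 := fun h => by simp [f, (hab h).symm]
  have hf : ∀ h k, k ≠ a h → k ≠ b h → f (h, k) = X (h, k) := fun h k h1 h2 => by simp [f, h1, h2]
  have hMf : ∀ h, ∑ k, (H h k₀ k : T) * f (h, k) = (H h k₀ (a h) : T) * C (X h) := by
    intro h
    have hc : ∀ z : ℤ, (z : T) = C (C (z : ℚ)) := fun z => by simp [T]
    have hne : (H h k₀ (a h) : ℚ) ≠ 0 := by exact_mod_cast ha h
    have h1 : ∑ k, (H h k₀ k : T) * f (h, k) = (H h k₀ (a h) : T) * f (h, a h) +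
        ((H h k₀ (b h) : T) * f (h, b h) + ∑ k ∈ Finset.univ.filter
          (fun k => k ≠ a h ∧ k ≠ b h), (H h k₀ k : T) * f (h, k)) := by
      rw [← Finset.add_sum_erase _ _ (Finset.mem_univ (a h)),
        ← Finset.add_sum_erase _ _ (Finset.mem_erase.mpr ⟨(hab h).symm, Finset.mem_univ (b h)⟩)]
      congr 3
      ext k; simp [and_comm]
    have h2 : ∑ k ∈ Finset.univ.filter (fun k => k ≠ a h ∧ k ≠ b h), (H h k₀ k : T) * f (h, k) =
        (H h k₀ (a h) : T) * ∑ k ∈ Finset.univ.filter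
      (fun k => k ≠ a h ∧ k ≠ b h), C (C ((H h k₀ k : ℚ) / H h k₀ (a h))) * X (h, k) := by
      rw [Finset.mul_sum]
      refine Finset.sum_congr rfl fun k hk => ?_
      rw [Finset.mem_filter] at hk
      rw [hf h k hk.2.1 hk.2.2, hc, hc, ← mul_assoc, ← map_mul, ← map_mul, mul_div_cancel₀ _ hne]
    have h3 : (H h k₀ (a h) : T) * C (C (ξ h)) = -(H h k₀ (b h) : T) := by
      rw [hc, hc, ← map_mul, ← map_mul, ← map_neg, ← map_neg]
      congr 2
      simp only [ξ]
      field_simp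
    rw [h1, h2, hfa, hfb, map_add]
    linear_combination h3
  choose g' hg0 hfg using fun h => exists_updateCol_preimage (G h) (H h) (hHG h) k₀ (a h)
    (fun k => f (h, k)) (C (X h)) (hMf h)
  let g : Fin m × ι → T := fun hl => g' hl.1 hl.2
  have hconst : ∀ h, constantCoeff (f (h, a h)) = X h + C (ξ h) := by
    intro h
    rw [hfa]
    simp
  obtain ⟨ν, p, hp0, hdeg, hl, hν⟩ := exists_coeff_eval₂_eq hab hP0 hP ξ f hconst hfb hf
  refine ⟨p, hp0, hdeg, hl, ?_⟩
  rw [← hν, ← eval₂_linSub _ f g hfg]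
  exact wtGE_coeff_eval₂ k₀ (fun h => 1 / (r h : ℝ)) (fun h => by positivity) g hg0 _ hwt ν

end Restrict

end SubspaceThm

namespace SubspaceThm

open MvPolynomial

section Penult

variable {ι : Type*} [Fintype ι] [DecidableEq ι]

theorem exists_large_den (M g : ι → ℤ) (hMg : ∑ k, M k * g k = 1) {y : ℝ} (hy : 0 < y)
    (hM : ∃ k, Real.exp y ≤ |(M k : ℝ)|) :
    ∃ a b, a ≠ b ∧ M a ≠ 0 ∧
      Real.exp (y / Fintype.card ι) ≤ ((-((M b : ℚ) / M a)).den : ℝ) := by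
  obtain ⟨a, ha⟩ := hM
  have ha0 : M a ≠ 0 := by
    rintro h
    rw [h] at ha
    simp only [Int.cast_zero, abs_zero] at ha
    linarith [Real.exp_pos y]
  have hn : (0 : ℝ) < Fintype.card ι := by
    exact_mod_cast Fintype.card_pos_iff.mpr ⟨a⟩
  obtain ⟨b, hb⟩ := exists_large_quotient M g hMg a ha0
  have hden : (-((M b : ℚ) / M a)).den = (M a).natAbs / (M a).gcd (M b) := by
    rw [Rat.den_neg_eq_den, ← Rat.divInt_eq_div, Rat.den_divInt, if_neg ha0]
  have hb' : Real.exp y ≤ ((-((M b : ℚ) / M a)).den : ℝ) ^ Fintype.card ι := by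
    rw [hden]
    refine ha.trans ?_
    have h1 := (Int.cast_le (R := ℝ)).mpr hb
    rwa [Int.cast_abs, Int.cast_pow, Int.cast_natCast] at h1
  have hle : Real.exp (y / Fintype.card ι) ≤ ((-((M b : ℚ) / M a)).den : ℝ) := by
    refine le_of_pow_le_pow_left₀ (n := Fintype.card ι) (by exact_mod_cast hn.ne') (by positivity) ?_
    rw [← Real.exp_nat_mul, mul_div_cancel₀ _ hn.ne']
    exact hb'
  refine ⟨a, b, ?_, ha0, hle⟩
  rintro rfl
  have h1 : (-((M a : ℚ) / M a)).den = 1 := by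
    rw [div_self (by exact_mod_cast ha0)]; rfl
  rw [h1, Nat.cast_one] at hle
  have : 0 < y / Fintype.card ι := by positivity
  linarith [Real.add_one_le_exp (y / Fintype.card ι)]

/-- A sequence of elements of an infinite set of integers which grows rapidly. -/
theorem exists_rapid_seq {S : Set ℕ} (hS : S.Infinite) (T ρ : ℝ) (Q₁ : ℕ) (m : ℕ) :
    ∃ Q : Fin m → ℕ, (∀ h, Q h ∈ S) ∧ (∀ h, Q₁ ≤ Q h) ∧ (∀ h, T ≤ Real.log (Q h)) ∧
      ∀ h h', h < h' → ρ * Real.log (Q h) ≤ Real.log (Q h') := by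
  have hlarge : ∀ B : ℝ, ∃ Q ∈ S, Q₁ ≤ Q ∧ B ≤ Real.log (Q : ℝ) := by
    intro B
    obtain ⟨Q, hQ, hlt⟩ := hS.exists_gt (max Q₁ ⌈Real.exp B⌉₊)
    refine ⟨Q, hQ, (le_max_left _ _).trans hlt.le, ?_⟩
    have h1 : Real.exp B ≤ Q :=
      (Nat.le_ceil _).trans (by exact_mod_cast (le_max_right _ _).trans hlt.le)
    rw [← Real.log_exp B]
    exact Real.log_le_log (Real.exp_pos _) h1
  obtain ⟨f, hf, hr⟩ := exists_seq_of_forall_finset_exists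
    (fun Q : ℕ => Q ∈ S ∧ Q₁ ≤ Q ∧ T ≤ Real.log (Q : ℝ))
    (fun Q Q' => ρ * Real.log (Q : ℝ) ≤ Real.log (Q' : ℝ)) (by
      intro s _
      obtain ⟨B, hB⟩ := (s.finite_toSet.image fun Q : ℕ => ρ * Real.log (Q : ℝ)).bddAbove
      obtain ⟨Q, hQ, h1, h2⟩ := hlarge (max T B)
      exact ⟨Q, ⟨hQ, h1, (le_max_left _ _).trans h2⟩, fun x hx =>
        (hB (Set.mem_image_of_mem _ hx)).trans ((le_max_right _ _).trans h2)⟩)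
  exact ⟨fun h => f h, fun h => (hf h).1, fun h => (hf h).2.1, fun h => (hf h).2.2,
    fun h h' hh => hr _ _ hh⟩

theorem pow_le_exp_of_le {x y : ℝ} (hx : 1 ≤ x) (k : ℕ) {B : ℝ} (hk : (k : ℝ) ≤ B)
    (hB : B * Real.log x ≤ y) : x ^ k ≤ Real.exp y := by
  have hx0 : 0 < x := by linarith
  rw [← Real.exp_log hx0, ← Real.exp_nat_mul]
  refine Real.exp_le_exp.mpr ((mul_le_mul_of_nonneg_right hk (Real.log_nonneg hx)).trans hB)

/-- Infinitely many integral bases all but one of whose vectors are small for the forms `L` cannot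
span pairwise distinct hyperplanes. -/
theorem exists_proportional (L : Matrix ι ι ℝ) (hL : ∀ i j, IsAlgebraic ℚ (L⁻¹ i j))
    (hdet : L.det ≠ 0) (c : ι → ℝ) {δ : ℝ} (hδ : 0 < δ) (hc : ∑ i, c i = -δ) (S : Set ℕ)
    (hS : S.Infinite) (G H : ℕ → Matrix ι ι ℤ) (hHG : ∀ Q ∈ S, H Q * G Q = 1) (k₀ : ι)
    (hG : ∀ Q ∈ S, ∀ i k, k ≠ k₀ →
      |(L * (G Q).map (Int.castRingHom ℝ)) i k| ≤ (Q : ℝ) ^ c i) :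
    ∃ Q ∈ S, ∃ Q' ∈ S, Q ≠ Q' ∧ ∃ t : ℤ, t ≠ 0 ∧ H Q k₀ = t • H Q' k₀ := by
  rcases proportional_or_height_large L hL hdet c hδ hc S hS G H hHG k₀ hG with h | h
  · exact h
  exfalso
  obtain ⟨γ, hγ, Q₁, hH⟩ := h
  have hne : Nonempty ι := ⟨k₀⟩
  set n : ℝ := ((Fintype.card ι : ℕ) : ℝ) with hn
  have hn1 : 1 ≤ n := by rw [hn]; exact_mod_cast Fintype.card_pos
  set γ' := γ / n with hγ'
  have hγ'0 : 0 < γ' := by positivity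
  obtain ⟨m, hm, E, hE, hP⟩ := exists_auxPoly L⁻¹ hL c hδ hc
  set cb : ℝ := ∑ i, |c i| + δ with hcb
  have hcb0 : 0 < cb := by positivity
  have hccb : ∀ i, |c i| ≤ cb := fun i =>
    (Finset.single_le_sum (f := fun i => |c i|) (fun _ _ => abs_nonneg _) (Finset.mem_univ i)).trans
      (by linarith)
  have hδcb : δ ≤ 8 * n * cb := by
    have : δ ≤ cb := by
      have : 0 ≤ ∑ i, |c i| := by positivity
      linarith
    nlinarith
  set C₁ : ℝ := 1 + ∑ i, ∑ j, |L i j| with hC₁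
  have hC₁1 : 1 ≤ C₁ := by
    have : 0 ≤ ∑ i, ∑ j, |L i j| := by positivity
    linarith
  have hLC : ∀ i j, |L i j| ≤ C₁ := by
    intro i j
    have h1 : |L i j| ≤ ∑ j, |L i j| := Finset.single_le_sum (f := fun j => |L i j|)
      (fun _ _ => abs_nonneg _) (Finset.mem_univ j)
    have h2 : ∑ j, |L i j| ≤ ∑ i, ∑ j, |L i j| := Finset.single_le_sum
      (f := fun i => ∑ j, |L i j|) (fun _ _ => by positivity) (Finset.mem_univ i)
    linarith
  have hm' : (0 : ℝ) < m := by exact_mod_cast hm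
  set c₀ := δ * m / (16 * n * cb) with hc₀
  have hc₀0 : 0 < c₀ := by positivity
  obtain ⟨ω, hω0, hω1, K, hK, hroth⟩ := roth_lemma m (min c₀ 1) (lt_min hc₀0 one_pos)
    (min_le_right _ _)
  have hKE : 1 ≤ K * E ^ m := one_le_mul_of_one_le_of_one_le hK (one_le_pow₀ hE)
  have hEn : 1 ≤ E * (n * C₁) :=
    one_le_mul_of_one_le_of_one_le hE (one_le_mul_of_one_le_of_one_le hn1 hC₁1)
  have hlog1 := Real.log_nonneg hKE
  have hlog2 := Real.log_nonneg hEn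
  set T : ℝ := 2 * Real.log (K * E ^ m) / (γ' * ω) + 8 * n * Real.log (E * (n * C₁)) / δ + 1 with hT
  have hT1 : 2 * Real.log (K * E ^ m) ≤ T * (γ' * ω) := by
    rw [← div_le_iff₀ (by positivity)]
    have : 0 ≤ 8 * n * Real.log (E * (n * C₁)) / δ := by positivity
    linarith
  have hT2 : 8 * n * Real.log (E * (n * C₁)) < T * δ := by
    rw [← div_lt_iff₀ hδ]
    have : 0 ≤ 2 * Real.log (K * E ^ m) / (γ' * ω) := by positivity
    linarith
  have hT0 : 0 < T := by
    have : 0 ≤ 8 * n * Real.log (E * (n * C₁)) / δ := by positivity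
    have : 0 ≤ 2 * Real.log (K * E ^ m) / (γ' * ω) := by positivity
    linarith
  obtain ⟨Q, hQS, hQ1, hQT, hQgrow⟩ := exists_rapid_seq hS T (2 / ω) Q₁ m
  set ℓ : Fin m → ℝ := fun h => Real.log (Q h) with hℓ
  have hℓ0 : ∀ h, 0 < ℓ h := fun h => hT0.trans_le (hQT h)
  have hQpos : ∀ h, (0 : ℝ) < Q h := by
    intro h
    rcases Nat.eq_zero_or_pos (Q h) with h0 | h0
    · have := hℓ0 h
      simp [hℓ, h0] at this
    · exact_mod_cast h0
  have hQexp : ∀ h y, (Q h : ℝ) ^ y = Real.exp (ℓ h * y) := fun h y =>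
    Real.rpow_def_of_pos (hQpos h) y
  choose a b hab ha hden using fun h => exists_large_den (H (Q h) k₀) (fun k => G (Q h) k k₀) (by
    have := congrFun (congrFun (hHG (Q h) (hQS h)) k₀) k₀
    rwa [Matrix.mul_apply, Matrix.one_apply_eq] at this) (mul_pos (hℓ0 h) hγ) (by
      obtain ⟨k, hk⟩ := hH (Q h) (hQS h) (hQ1 h)
      exact ⟨k, by rwa [hQexp] at hk⟩)
  set ε := δ / (8 * n * cb) with hε
  have hε0 : 0 < ε := by positivity
  obtain ⟨Λ₀, hΛ₀⟩ := (Set.finite_range fun h => ℓ h / ε + ℓ h).bddAbove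
  set Λ := max Λ₀ T with hΛ
  have hΛ0 : 0 < Λ := hT0.trans_le (le_max_right _ _)
  have hΛε : ∀ h, ℓ h ≤ ε * Λ := by
    intro h
    have h1 : ℓ h / ε + ℓ h ≤ Λ := (hΛ₀ ⟨h, rfl⟩).trans (le_max_left _ _)
    rw [← div_le_iff₀' hε0]
    linarith [hℓ0 h]
  have hΛℓ : ∀ h, ℓ h ≤ Λ := by
    intro h
    have h1 : ℓ h / ε + ℓ h ≤ Λ := (hΛ₀ ⟨h, rfl⟩).trans (le_max_left _ _)
    have : 0 < ℓ h / ε := div_pos (hℓ0 h) hε0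
    linarith
  set r : Fin m → ℕ := fun h => ⌈Λ / ℓ h⌉₊ with hr
  have hr1 : ∀ h, Λ / ℓ h ≤ r h := fun h => Nat.le_ceil _
  have hr2 : ∀ h, (r h : ℝ) ≤ Λ / ℓ h + 1 := fun h =>
    (Nat.ceil_lt_add_one (div_nonneg hΛ0.le (hℓ0 h).le)).le
  have hr3 : ∀ h, (r h : ℝ) ≤ 2 * Λ / ℓ h := by
    intro h
    have : 1 ≤ Λ / ℓ h := (one_le_div (hℓ0 h)).mpr (hΛℓ h)
    have h2 := hr2 h
    rw [mul_div_assoc]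
    linarith
  have hr0 : ∀ h, 0 < r h := fun h => Nat.ceil_pos.mpr (div_pos hΛ0 (hℓ0 h))
  set R : ℕ := ⌈Λ / T⌉₊ with hR
  have hrR : ∀ h, r h ≤ R := fun h =>
    Nat.ceil_le_ceil (div_le_div_of_nonneg_left hΛ0.le hT0 (hQT h))
  have hR2 : (R : ℝ) ≤ 2 * Λ / T := by
    have h1 : (R : ℝ) ≤ Λ / T + 1 := (Nat.ceil_lt_add_one (div_nonneg hΛ0.le hT0.le)).le
    have : 1 ≤ Λ / T := (one_le_div hT0).mpr (le_max_right _ _)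
    rw [mul_div_assoc]
    linarith
  have hsumr : ∑ h, r h ≤ m * R := by
    refine (Finset.sum_le_card_nsmul _ _ R fun h _ => hrR h).trans ?_
    simp
  have hsumr' : ((∑ h, r h : ℕ) : ℝ) ≤ m * (2 * Λ / T) := by
    have : ((∑ h, r h : ℕ) : ℝ) ≤ m * R := by exact_mod_cast hsumr
    exact this.trans (mul_le_mul_of_nonneg_left hR2 hm'.le)
  obtain ⟨P, hP0, hPM, hPl, hPA, hPw⟩ := hP r hr0
  -- the index of the auxiliary polynomial
  have hwt := wtGE_linSub_of_small L hdet c hδ hcb0 hccb hδcb k₀ r hr0 P hPM hE hC₁1 hPA hPw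
    (fun h => (G (Q h)).updateCol k₀ (Pi.single (a h) 1)) ℓ (fun h => (hℓ0 h).le) (by
      intro h i k hk
      have h1 := hG (Q h) (hQS h) i k hk
      rw [hQexp, Matrix.mul_apply] at h1
      rw [Matrix.mul_apply]
      simpa [Matrix.updateCol_apply, hk] using h1) (by
      intro h i
      rw [Matrix.mul_apply, Finset.sum_eq_single (a h)]
      · simpa using hLC i (a h)
      · intro j _ hj
        simp [hj]
      · simp) hΛ0 (fun h => by
        have := hr1 h
        rwa [div_le_iff₀ (hℓ0 h)] at this) (fun h => by
        have h1 := mul_le_mul_of_nonneg_right (hr2 h) (hℓ0 h).le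
        rw [add_mul, div_mul_cancel₀ _ (hℓ0 h).ne', one_mul] at h1
        have := hΛε h
        linarith) (by
        refine (pow_le_exp_of_le hEn _ hsumr' le_rfl).trans_lt (Real.exp_lt_exp.mpr ?_)
        rw [lt_div_iff₀ (by positivity)]
        have h1 : m * (2 * Λ / T) * Real.log (E * (n * C₁)) * (4 * n) =
          (m * Λ / T) * (8 * n * Real.log (E * (n * C₁))) := by ring
        rw [h1]
        calc _ < (m * Λ / T) * (T * δ) := mul_lt_mul_of_pos_left hT2 (by positivity)
          _ = Λ * δ * m := by field_simp)
  obtain ⟨p, hp0, hdeg, hpl, hpw⟩ := exists_restriction hP0 hPM (fun h => G (Q h))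
    (fun h => H (Q h)) (fun h => hHG _ (hQS h)) k₀ hab ha hwt
  set ξ : Fin m → ℚ := fun h => -((H (Q h) k₀ (b h) : ℚ) / H (Q h) k₀ (a h)) with hξ
  refine hroth r R (fun h => (ξ h).num) (fun h => (ξ h).den) (Real.exp (γ' * Λ)) p hr0 hrR ?_
    (fun h => (ξ h).pos) ?_ (Real.one_le_exp (by positivity)) ?_ hp0 hdeg ?_ ?_
  · intro h h' hh
    have h1 := hQgrow h h' hh
    have h2 : (r h' : ℝ) * ℓ h' ≤ 2 * Λ := (le_div_iff₀ (hℓ0 h')).mp (hr3 h')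
    have h3 : Λ ≤ r h * ℓ h := (div_le_iff₀ (hℓ0 h)).mp (hr1 h)
    have h4 : 2 * ℓ h ≤ ω * ℓ h' := by
      have h5 : 2 / ω * ℓ h ≤ ℓ h' := h1
      rw [div_mul_eq_mul_div, div_le_iff₀ hω0] at h5
      linarith
    have h6 : (r h' : ℝ) * (2 * ℓ h) ≤ (ω * r h) * (2 * ℓ h) := by
      calc _ ≤ (r h' : ℝ) * (ω * ℓ h') := mul_le_mul_of_nonneg_left h4 (by positivity)
        _ = ω * (r h' * ℓ h') := by ring
        _ ≤ ω * (2 * (r h * ℓ h)) := mul_le_mul_of_nonneg_left (by linarith) hω0.le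
        _ = _ := by ring
    exact le_of_mul_le_mul_right h6 (by linarith [hℓ0 h])
  · intro h
    exact Int.isCoprime_iff_gcd_eq_one.mpr (ξ h).reduced
  · intro h
    have h1 := pow_le_pow_left₀ (Real.exp_nonneg _) (hden h) (r h)
    rw [← Real.exp_nat_mul] at h1
    refine (Real.exp_le_exp.mpr ?_).trans h1
    have h3 : Λ ≤ r h * ℓ h := (div_le_iff₀ (hℓ0 h)).mp (hr1 h)
    calc γ' * Λ ≤ γ' * (r h * ℓ h) := mul_le_mul_of_nonneg_left h3 hγ'0.le
      _ = _ := by rw [hγ']; ring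
  · have h1 : K ^ R * lOne (normRingSeminorm ℤ) p ≤ (K * E ^ m) ^ R := by
      rw [mul_pow, ← pow_mul]
      refine mul_le_mul_of_nonneg_left ((hpl.trans hPl).trans (pow_le_pow_right₀ hE hsumr))
        (by positivity)
    refine h1.trans ((pow_le_exp_of_le hKE R hR2 (y := γ' * Λ * ω) ?_).trans (le_of_eq ?_))
    · calc _ = (Λ / T) * (2 * Real.log (K * E ^ m)) := by ring
        _ ≤ (Λ / T) * (T * (γ' * ω)) := mul_le_mul_of_nonneg_left hT1 (by positivity)
        _ = _ := by field_simp
    · rw [← Real.exp_mul]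
  · have h1 : (fun h => (((ξ h).num : ℚ) / ((ξ h).den : ℚ))) = ξ := by
      funext h
      exact Rat.num_div_den (ξ h)
    rw [h1]
    exact hpw.mono (min_le_left _ _)

end Penult

end SubspaceThm

namespace SubspaceThm

section Reduce

/-- Reduction of invertible real matrices by unimodular column operations and row permutations. -/
def Reducible (ι : Type*) [Fintype ι] [DecidableEq ι] : Prop :=
  ∃ C : ℝ, 1 ≤ C ∧ ∀ M : Matrix ι ι ℝ, M.det ≠ 0 →
    ∃ U V : Matrix ι ι ℤ, U * V = 1 ∧ ∃ π : Equiv.Perm ι, ∃ μ : ι → ℝ, (∀ i, 0 < μ i) ∧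
      ∏ i, μ i = |M.det| ∧ ∀ i j, |(M * U.map (Int.castRingHom ℝ)) (π i) j| ≤ C * μ i ∧
        |(M * U.map (Int.castRingHom ℝ)) (π i) j| ≤ C * μ j

variable {ι : Type*} [Fintype ι] [DecidableEq ι]

theorem finite_int_vec_bounded (M : Matrix ι ι ℝ) (hM : M.det ≠ 0) (B : ℝ) :
    {v : ι → ℤ | ‖M.mulVec (fun i => (v i : ℝ))‖ ≤ B}.Finite := by
  let D : ℝ := ∑ i, ∑ j, |M⁻¹ i j| * B
  refine (Set.finite_Icc (fun _ : ι => -⌈D⌉) (fun _ => ⌈D⌉)).subset fun v hv => ?_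
  have hB : 0 ≤ B := (norm_nonneg _).trans hv
  have h1 : ∀ i, |(v i : ℝ)| ≤ D := by
    intro i
    have h2 : (fun i => (v i : ℝ)) = M⁻¹.mulVec (M.mulVec fun i => (v i : ℝ)) := by
      rw [Matrix.mulVec_mulVec, Matrix.nonsing_inv_mul _ (isUnit_iff_ne_zero.mpr hM),
        Matrix.one_mulVec]
    have h3 := congrFun h2 i
    rw [h3]
    refine (Finset.abs_sum_le_sum_abs _ _).trans ?_
    refine le_trans (Finset.sum_le_sum fun j _ => ?_) (Finset.single_le_sum
      (f := fun i => ∑ j, |M⁻¹ i j| * B) (fun _ _ => by positivity) (Finset.mem_univ i))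
    rw [abs_mul]
    exact mul_le_mul_of_nonneg_left ((norm_le_pi_norm _ j).trans hv) (abs_nonneg _)
  rw [Set.mem_Icc]
  constructor <;> intro i
  · have h4 := (abs_le.mp (h1 i)).1
    have h5 := Int.le_ceil D
    have : ((-⌈D⌉ : ℤ) : ℝ) ≤ v i := by push_cast; linarith
    exact_mod_cast this
  · have h4 := (abs_le.mp (h1 i)).2
    have h5 := Int.le_ceil D
    have : (v i : ℝ) ≤ ⌈D⌉ := by linarith
    exact_mod_cast this

theorem exists_minimal_column (M : Matrix ι ι ℝ) (hM : M.det ≠ 0) (k : ι) :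
    ∃ U V : Matrix ι ι ℤ, U * V = 1 ∧ ∀ U' V' : Matrix ι ι ℤ, U' * V' = 1 →
      ‖fun i => (M * U.map (Int.castRingHom ℝ)) i k‖ ≤
        ‖fun i => (M * U'.map (Int.castRingHom ℝ)) i k‖ := by
  have hcol : ∀ U : Matrix ι ι ℤ, (fun i => (M * U.map (Int.castRingHom ℝ)) i k) =
      M.mulVec fun i => (U i k : ℝ) := fun U => by
    funext i; rw [Matrix.mul_apply]; rfl
  simp_rw [hcol]
  let W : Set (ι → ℤ) := {v | (∃ U V : Matrix ι ι ℤ, U * V = 1 ∧ v = fun i => U i k) ∧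
    ‖M.mulVec (fun i => (v i : ℝ))‖ ≤ ‖M.mulVec fun i => (((1 : Matrix ι ι ℤ) i k : ℤ) : ℝ)‖}
  have hW : W.Finite := (finite_int_vec_bounded M hM _).subset fun v hv => hv.2
  have hne : W.Nonempty := ⟨fun i => (1 : Matrix ι ι ℤ) i k, ⟨1, 1, one_mul 1, rfl⟩, le_rfl⟩
  obtain ⟨v, ⟨⟨U, V, hUV, rfl⟩, hv⟩, hmin⟩ := Set.exists_min_image W
    (fun v => ‖M.mulVec (fun i => (v i : ℝ))‖) hW hne
  refine ⟨U, V, hUV, fun U' V' hU' => ?_⟩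
  by_cases h : ‖M.mulVec (fun i => (U' i k : ℝ))‖ ≤
      ‖M.mulVec fun i => (((1 : Matrix ι ι ℤ) i k : ℤ) : ℝ)‖
  · exact hmin _ ⟨⟨U', V', hU', rfl⟩, h⟩
  · exact hv.trans (not_le.mp h).le

theorem Reducible.of_equiv {κ : Type*} [Fintype κ] [DecidableEq κ] (e : κ ≃ ι) (h : Reducible ι) :
    Reducible κ := by
  obtain ⟨C, hC, h⟩ := h
  refine ⟨C, hC, fun M hM => ?_⟩
  obtain ⟨U, V, hUV, π, μ, hμ, hprod, hb⟩ := h (M.submatrix e.symm e.symm)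
    (by rwa [Matrix.det_submatrix_equiv_self])
  refine ⟨U.submatrix e e, V.submatrix e e, ?_, (e.trans π).trans e.symm, fun i => μ (e i),
    fun i => hμ _, ?_, fun i j => ?_⟩
  · rw [Matrix.submatrix_mul_equiv, hUV, Matrix.submatrix_one_equiv]
  · rw [Equiv.prod_comp e μ, hprod, Matrix.det_submatrix_equiv_self]
  · have h1 : (M * (U.submatrix e e).map (Int.castRingHom ℝ)) (((e.trans π).trans e.symm) i) j =
        (M.submatrix e.symm e.symm * U.map (Int.castRingHom ℝ)) (π (e i)) (e j) := by
      rw [Matrix.mul_apply, Matrix.mul_apply, ← Equiv.sum_comp e]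
      simp
    rw [h1]
    exact hb _ _

theorem schur_det (A : Matrix (Unit ⊕ ι) (Unit ⊕ ι) ℝ) (hA : A (Sum.inl ()) (Sum.inl ()) ≠ 0) :
    A.det = A (Sum.inl ()) (Sum.inl ()) * (Matrix.of fun i j => A (Sum.inr i) (Sum.inr j) -
      A (Sum.inr i) (Sum.inl ()) * A (Sum.inl ()) (Sum.inr j) / A (Sum.inl ()) (Sum.inl ())).det := by
  have hdet : A.toBlocks₁₁.det = A (Sum.inl ()) (Sum.inl ()) := by
    rw [Matrix.det_unique]; rfl
  have : Invertible A.toBlocks₁₁ := Matrix.invertibleOfIsUnitDet _ (by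
    rw [hdet]; exact isUnit_iff_ne_zero.mpr hA)
  conv_lhs => rw [← Matrix.fromBlocks_toBlocks A]
  rw [Matrix.det_fromBlocks₁₁, hdet]
  congr 2
  ext i j
  have h2 : (⅟A.toBlocks₁₁) () () = (A (Sum.inl ()) (Sum.inl ()))⁻¹ := by
    have h1 := congrFun (congrFun (mul_invOf_self A.toBlocks₁₁) ()) ()
    rw [Matrix.mul_apply, Matrix.one_apply_eq] at h1
    simp only [Finset.univ_unique, PUnit.default_eq_unit, Finset.sum_singleton] at h1
    exact eq_inv_of_mul_eq_one_right h1
  simp only [Matrix.sub_apply, Matrix.mul_apply, Finset.univ_unique, PUnit.default_eq_unit,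
    Finset.sum_singleton, h2, Matrix.of_apply, Matrix.toBlocks₂₂, Matrix.toBlocks₂₁,
    Matrix.toBlocks₁₂]
  ring

theorem Reducible.unit_sum (h : Reducible ι) : Reducible (Unit ⊕ ι) := by
  obtain ⟨C, hC, h⟩ := h
  refine ⟨2 * C, by linarith, fun M hM => ?_⟩
  let z : Unit ⊕ ι := Sum.inl ()
  obtain ⟨U₀, V₀, hUV₀, hmin⟩ := exists_minimal_column M hM z
  set N := M * U₀.map (Int.castRingHom ℝ) with hN
  have hcastdet : ∀ U V : Matrix (Unit ⊕ ι) (Unit ⊕ ι) ℤ, U * V = 1 →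
      |(U.map (Int.castRingHom ℝ)).det| = 1 := by
    intro U V hUV
    have h1 : U.det * V.det = 1 := by rw [← Matrix.det_mul, hUV, Matrix.det_one]
    have h2 : (U.map (Int.castRingHom ℝ)).det = (U.det : ℝ) := by
      rw [← RingHom.mapMatrix_apply, ← RingHom.map_det]; rfl
    rw [h2, ← Int.cast_abs, Int.isUnit_iff_abs_eq.mp (IsUnit.of_mul_eq_one _ h1), Int.cast_one]
  have hNdet : |N.det| = |M.det| := by
    rw [hN, Matrix.det_mul, abs_mul, hcastdet _ _ hUV₀, mul_one]
  obtain ⟨i₀, hi₀⟩ := Finite.exists_max fun i => |N i z|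
  set ρ := |N i₀ z| with hρ
  have hnorm : ‖fun i => N i z‖ = ρ := le_antisymm
    ((pi_norm_le_iff_of_nonneg (abs_nonneg _)).mpr hi₀) (norm_le_pi_norm (fun i => N i z) i₀)
  have hρ0 : 0 < ρ := by
    refine (abs_nonneg _).lt_of_ne' fun h0 => ?_
    have h1 : N.det = 0 := Matrix.det_eq_zero_of_column_eq_zero z fun i =>
      abs_nonpos_iff.mp ((hi₀ i).trans h0.le)
    rw [h1, abs_zero] at hNdet
    exact hM (abs_eq_zero.mp hNdet.symm)
  let σ : Equiv.Perm (Unit ⊕ ι) := Equiv.swap z i₀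
  let A : Matrix (Unit ⊕ ι) (Unit ⊕ ι) ℝ := N.submatrix σ id
  have hA0 : |A z z| = ρ := by simp [A, σ, hρ]
  have hAz : A z z ≠ 0 := fun h0 => by rw [h0, abs_zero] at hA0; exact hρ0.ne hA0
  have hAi : ∀ i, |A i z| ≤ ρ := fun i => hi₀ _
  have hAdet : |A.det| = |M.det| := by
    rw [← hNdet]
    simp only [A]
    rw [Matrix.det_permute, abs_mul]
    rcases Int.units_eq_one_or (Equiv.Perm.sign σ) with h1 | h1 <;> simp [h1]
  let B : Matrix ι ι ℝ := Matrix.of fun i j => A (Sum.inr i) (Sum.inr j) -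
      A (Sum.inr i) z * A z (Sum.inr j) / A z z
  have hAB : A.det = A z z * B.det := schur_det A hAz
  have hBdet : B.det ≠ 0 := by
    intro h0
    rw [hAB, h0, mul_zero, abs_zero] at hAdet
    exact hM (abs_eq_zero.mp hAdet.symm)
  obtain ⟨U', V', hUV', π', μ', hμ', hprod, hb⟩ := h B hBdet
  let t : ι → ℝ := fun j => (∑ l, A z (Sum.inr l) * (U' l j : ℝ)) / A z z
  let k : ι → ℤ := fun j => -round (t j)
  have hkt : ∀ j, |(k j : ℝ) + t j| ≤ 1 / 2 := by
    intro j
    have := abs_sub_round (t j)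
    simp only [k]
    push_cast
    rwa [neg_add_eq_sub]
  let kr : Matrix Unit ι ℤ := Matrix.of fun _ j => k j
  let W : Matrix (Unit ⊕ ι) (Unit ⊕ ι) ℤ := Matrix.fromBlocks 1 kr 0 U'
  let W' : Matrix (Unit ⊕ ι) (Unit ⊕ ι) ℤ := Matrix.fromBlocks 1 (-(kr * V')) 0 V'
  have hWW : W * W' = 1 := by
    simp only [W, W']
    rw [Matrix.fromBlocks_multiply, ← Matrix.fromBlocks_one]
    simp [hUV']
  have hUV : (U₀ * W) * (W' * V₀) = 1 := by
    rw [Matrix.mul_assoc, ← Matrix.mul_assoc W, hWW, Matrix.one_mul, hUV₀]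
  set F := M * (U₀ * W).map (Int.castRingHom ℝ) with hF
  have hFA : ∀ i j, F (σ i) j = ∑ l, A i l * (W l j : ℝ) := by
    intro i j
    rw [hF, Matrix.map_mul, ← Matrix.mul_assoc, ← hN, Matrix.mul_apply]
    rfl
  have hFz : ∀ i, F (σ i) z = A i z := by
    intro i
    rw [hFA, Fintype.sum_sum_type]
    simp [W, z]
  have hFr : ∀ i j, F (σ i) (Sum.inr j) = A i z * k j + ∑ l, A i (Sum.inr l) * (U' l j : ℝ) := by
    intro i j
    rw [hFA, Fintype.sum_sum_type]
    simp [W, z, kr]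
  have hFzr : ∀ j, |F (σ z) (Sum.inr j)| ≤ ρ / 2 := by
    intro j
    have h1 : F (σ z) (Sum.inr j) = A z z * (k j + t j) := by
      rw [hFr, mul_add]
      congr 1
      simp only [t]
      field_simp
    rw [h1, abs_mul, hA0]
    have := mul_le_mul_of_nonneg_left (hkt j) hρ0.le
    linarith
  have hFrr : ∀ i j, |F (σ (Sum.inr i)) (Sum.inr j)| ≤
      |(B * U'.map (Int.castRingHom ℝ)) i j| + ρ / 2 := by
    intro i j
    have h1 : F (σ (Sum.inr i)) (Sum.inr j) = (B * U'.map (Int.castRingHom ℝ)) i j +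
        A (Sum.inr i) z * (k j + t j) := by
      rw [hFr, Matrix.mul_apply]
      have h2 : A (Sum.inr i) z * t j =
          ∑ l, A (Sum.inr i) z * A z (Sum.inr l) / A z z * (U' l j : ℝ) := by
        simp only [t]
        rw [Finset.sum_div, Finset.mul_sum]
        exact Finset.sum_congr rfl fun l _ => by ring
      have h3 : ∑ l, B i l * (U'.map (Int.castRingHom ℝ)) l j =
          ∑ l, A (Sum.inr i) (Sum.inr l) * (U' l j : ℝ) - A (Sum.inr i) z * t j := by
        rw [h2, ← Finset.sum_sub_distrib]
        refine Finset.sum_congr rfl fun l _ => ?_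
        simp only [B, Matrix.of_apply, Matrix.map_apply, eq_intCast]
        ring
      rw [h3]; ring
    rw [h1]
    refine (abs_add_le _ _).trans (add_le_add_right ?_ _)
    rw [abs_mul]
    have := mul_le_mul (hAi (Sum.inr i)) (hkt j) (abs_nonneg _) hρ0.le
    linarith
  have hρμ : ∀ j, ρ ≤ 2 * C * μ' j := by
    intro j
    let τ : Equiv.Perm (Unit ⊕ ι) := Equiv.swap z (Sum.inr j)
    have h1 := hmin ((U₀ * W).submatrix id τ) ((W' * V₀).submatrix τ id) (by
      rw [Matrix.submatrix_mul_equiv, hUV, Matrix.submatrix_id_id])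
    rw [hnorm] at h1
    have h2 : (fun i => (M * ((U₀ * W).submatrix id τ).map (Int.castRingHom ℝ)) i z) =
        fun i => F i (Sum.inr j) := by
      funext i
      rw [hF, Matrix.mul_apply, Matrix.mul_apply]
      simp [τ]
    rw [h2] at h1
    have hCμ : 0 < C * μ' j := mul_pos (by linarith) (hμ' j)
    have h3 : ‖fun i => F i (Sum.inr j)‖ ≤ C * μ' j + ρ / 2 := by
      rw [pi_norm_le_iff_of_nonneg (by linarith)]
      intro i
      obtain ⟨i, rfl⟩ := σ.surjective i
      rcases i with i | i
      · exact (hFzr j).trans (by linarith)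
      · obtain ⟨i, rfl⟩ := π'.surjective i
        exact (hFrr _ j).trans (by linarith [(hb i j).2])
    linarith
  refine ⟨U₀ * W, W' * V₀, hUV, (Equiv.sumCongr (Equiv.refl Unit) π').trans σ,
    Sum.elim (fun _ => ρ) μ', ?_, ?_, ?_⟩
  · rintro (i | i)
    · exact hρ0
    · exact hμ' i
  · rw [Fintype.prod_sum_type]
    simp only [Sum.elim_inl, Sum.elim_inr, Finset.univ_unique, Finset.prod_singleton]
    rw [hprod, ← hAdet, hAB, abs_mul, hA0]
  · rintro (i | i) (j | j)
    · change |F (σ z) z| ≤ 2 * C * ρ ∧ |F (σ z) z| ≤ 2 * C * ρ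
      rw [hFz, hA0]
      constructor <;> nlinarith
    · change |F (σ z) (Sum.inr j)| ≤ 2 * C * ρ ∧ |F (σ z) (Sum.inr j)| ≤ 2 * C * μ' j
      have h1 := hFzr j
      exact ⟨by nlinarith, by linarith [hρμ j]⟩
    · change |F (σ (Sum.inr (π' i))) z| ≤ 2 * C * μ' i ∧ |F (σ (Sum.inr (π' i))) z| ≤ 2 * C * ρ
      rw [hFz]
      have h1 := hAi (Sum.inr (π' i))
      exact ⟨h1.trans (hρμ i), by nlinarith⟩
    · change |F (σ (Sum.inr (π' i))) (Sum.inr j)| ≤ 2 * C * μ' i ∧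
        |F (σ (Sum.inr (π' i))) (Sum.inr j)| ≤ 2 * C * μ' j
      have h1 := hFrr (π' i) j
      have h2 := hb i j
      exact ⟨by linarith [hρμ i], by linarith [hρμ j]⟩

theorem reducible_fin (n : ℕ) : Reducible (Fin n) := by
  induction n with
  | zero =>
    exact ⟨1, le_rfl, fun M _ => ⟨1, 1, one_mul 1, 1, fun _ => 1, fun _ => one_pos, by simp,
      fun i => i.elim0⟩⟩
  | succ n ih =>
    exact ih.unit_sum.of_equiv ((finSumFinEquiv (m := 1) (n := n)).symm.trans
      (Equiv.sumCongr finOneEquiv (Equiv.refl _)) |> (finCongr (Nat.add_comm n 1)).trans)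

end Reduce

end SubspaceThm

namespace SubspaceThm

section Compound

variable {n : ℕ}

/-- The matrix of all `p × p` minors, indexed by the `p`-element sets of rows and columns. -/
def compound {R : Type*} [CommRing R] (p : ℕ) (A : Matrix (Fin n) (Fin n) R) :
    Matrix (Set.powersetCard (Fin n) p) (Set.powersetCard (Fin n) p) R :=
  Matrix.of fun I J =>
    (A.submatrix (Finset.orderEmbOfFin I.1 I.2) (Finset.orderEmbOfFin J.1 J.2)).det

theorem compound_eq_toMatrix {R : Type*} [CommRing R] (p : ℕ) (A : Matrix (Fin n) (Fin n) R) :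
    compound p A = LinearMap.toMatrix ((Pi.basisFun R (Fin n)).exteriorPower p)
      ((Pi.basisFun R (Fin n)).exteriorPower p) (exteriorPower.map p (Matrix.toLin' A)) := by
  ext I J
  rw [LinearMap.toMatrix_apply, exteriorPower.basis_apply, exteriorPower.map_apply_ιMulti_family,
    exteriorPower.basis_repr_apply, exteriorPower.ιMulti_family,
    exteriorPower.ιMultiDual_apply_ιMulti, ← Matrix.det_transpose]
  refine congrArg Matrix.det (Matrix.ext fun i j => ?_)
  simp [Set.powersetCard.ofFinEmbEquiv_symm_apply]

theorem compound_mul {R : Type*} [CommRing R] (p : ℕ) (A B : Matrix (Fin n) (Fin n) R) :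
    compound p (A * B) = compound p A * compound p B := by
  rw [compound_eq_toMatrix, compound_eq_toMatrix p A, compound_eq_toMatrix p B,
    ← LinearMap.toMatrix_comp, ← exteriorPower.map_comp, Matrix.toLin'_mul]

theorem compound_one {R : Type*} [CommRing R] (p : ℕ) :
    compound p (1 : Matrix (Fin n) (Fin n) R) = 1 := by
  rw [compound_eq_toMatrix, Matrix.toLin'_one, exteriorPower.map_id, LinearMap.toMatrix_id]

theorem compound_map {R R' : Type*} [CommRing R] [CommRing R'] (f : R →+* R') (p : ℕ)
    (A : Matrix (Fin n) (Fin n) R) : compound p (A.map f) = (compound p A).map f := by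
  ext I J
  simp only [compound, Matrix.of_apply, Matrix.map_apply]
  rw [RingHom.map_det]
  rfl

theorem abs_det_le_of_row {p : ℕ} (A : Matrix (Fin p) (Fin p) ℝ) (b : Fin p → ℝ)
    (h : ∀ i j, |A i j| ≤ b i) : |A.det| ≤ p.factorial * ∏ i, b i := by
  rw [← Matrix.det_transpose, Matrix.det_apply]
  refine (Finset.abs_sum_le_sum_abs _ _).trans ?_
  have h1 : ∀ σ ∈ (Finset.univ : Finset (Equiv.Perm (Fin p))),
      |Equiv.Perm.sign σ • ∏ i, A.transpose (σ i) i| ≤ ∏ i, b i := by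
    intro σ _
    have h2 : |Equiv.Perm.sign σ • ∏ i, A.transpose (σ i) i| = |∏ i, A.transpose (σ i) i| := by
      rcases Int.units_eq_one_or (Equiv.Perm.sign σ) with h1 | h1 <;> simp [h1]
    rw [h2, Finset.abs_prod]
    exact Finset.prod_le_prod (fun _ _ => abs_nonneg _) fun i _ => h i _
  refine (Finset.sum_le_sum h1).trans ?_
  simp [Fintype.card_perm]

theorem prod_orderEmbOfFin {p : ℕ} (I : Set.powersetCard (Fin n) p) (f : Fin n → ℝ) :
    ∏ a, f (Finset.orderEmbOfFin I.1 I.2 a) = ∏ i ∈ I.1, f i := by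
  rw [← Finset.prod_image (s := Finset.univ) (g := Finset.orderEmbOfFin I.1 I.2) (f := f)
    (fun a _ b _ h => (Finset.orderEmbOfFin I.1 I.2).injective h)]
  congr 1
  exact Finset.image_orderEmbOfFin_univ I.1 I.2

theorem abs_compound_le_row {p : ℕ} (A : Matrix (Fin n) (Fin n) ℝ) (b : Fin n → ℝ)
    (h : ∀ i j, |A i j| ≤ b i) (I J : Set.powersetCard (Fin n) p) :
    |compound p A I J| ≤ p.factorial * ∏ i ∈ I.1, b i := by
  rw [← prod_orderEmbOfFin]
  exact abs_det_le_of_row _ _ fun _ _ => h _ _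

theorem abs_compound_le_col {p : ℕ} (A : Matrix (Fin n) (Fin n) ℝ) (a b : Fin n → ℝ)
    (h : ∀ i j, |A i j| ≤ a i * b j) (I J : Set.powersetCard (Fin n) p) :
    |compound p A I J| ≤ p.factorial * ((∏ i ∈ I.1, a i) * ∏ j ∈ J.1, b j) := by
  rw [← prod_orderEmbOfFin, ← prod_orderEmbOfFin]
  rw [compound, Matrix.of_apply, Matrix.det_apply]
  refine (Finset.abs_sum_le_sum_abs _ _).trans ?_
  refine (Finset.sum_le_card_nsmul _ _ ((∏ c, a (Finset.orderEmbOfFin I.1 I.2 c)) *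
    ∏ c, b (Finset.orderEmbOfFin J.1 J.2 c)) ?_).trans ?_
  · intro σ _
    have h2 : ∀ r : ℝ, |Equiv.Perm.sign σ • r| = |r| := by
      intro r
      rcases Int.units_eq_one_or (Equiv.Perm.sign σ) with h1 | h1 <;> simp [h1]
    rw [h2, Finset.abs_prod,
      ← Equiv.prod_comp σ (fun c => a (Finset.orderEmbOfFin I.1 I.2 c)), ← Finset.prod_mul_distrib]
    exact Finset.prod_le_prod (fun _ _ => abs_nonneg _) fun i _ => h _ _
  · simp [Fintype.card_perm]

/-- The vectors killed by a set of rows are determined by the minors of these rows. -/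
theorem mulVec_eq_zero_of_compound {p : ℕ} {V V' U' : Matrix (Fin n) (Fin n) ℤ} (hVU : V' * U' = 1)
    (T : Set.powersetCard (Fin n) p) {a b : ℤ} (hb : b ≠ 0)
    (h : ∀ K, a * compound p V T K = b * compound p V' T K) (x : Fin n → ℤ)
    (hx : ∀ j ∈ T.1, V.mulVec x j = 0) : ∀ j ∈ T.1, V'.mulVec x j = 0 := by
  intro j hj
  have hsum : ∀ Y : Matrix (Fin n) (Fin n) ℤ,
      a * compound p (V * Y) T T = b * compound p (V' * Y) T T := by
    intro Y
    rw [compound_mul, compound_mul, Matrix.mul_apply, Matrix.mul_apply, Finset.mul_sum,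
      Finset.mul_sum]
    exact Finset.sum_congr rfl fun K _ => by rw [← mul_assoc, h, mul_assoc]
  have hup : ∀ W : Matrix (Fin n) (Fin n) ℤ,
      W * U'.updateCol j x = (W * U').updateCol j (W.mulVec x) := by
    intro W
    ext i k
    by_cases hk : k = j
    · subst hk
      simp [Matrix.mul_apply, Matrix.mulVec, dotProduct]
    · simp [Matrix.mul_apply, Matrix.updateCol_ne hk]
  obtain ⟨c, rfl⟩ : ∃ c, Finset.orderEmbOfFin T.1 T.2 c = j := by
    have := Finset.range_orderEmbOfFin T.1 T.2
    exact (Set.ext_iff.mp this j).mpr hj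
  have key := hsum (U'.updateCol (Finset.orderEmbOfFin T.1 T.2 c) x)
  rw [hup, hup, hVU] at key
  have h1 : compound p ((V * U').updateCol (Finset.orderEmbOfFin T.1 T.2 c) (V.mulVec x)) T T
      = 0 := by
    refine Matrix.det_eq_zero_of_column_eq_zero c fun i => ?_
    simpa using hx _ (Finset.orderEmbOfFin_mem _ _ _)
  have h2 : compound p ((1 : Matrix (Fin n) (Fin n) ℤ).updateCol
      (Finset.orderEmbOfFin T.1 T.2 c) (V'.mulVec x)) T T =
      V'.mulVec x (Finset.orderEmbOfFin T.1 T.2 c) := by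
    have h3 : ((1 : Matrix (Fin n) (Fin n) ℤ).updateCol
      (Finset.orderEmbOfFin T.1 T.2 c) (V'.mulVec x)).submatrix (Finset.orderEmbOfFin T.1 T.2)
        (Finset.orderEmbOfFin T.1 T.2) = (1 : Matrix (Fin p) (Fin p) ℤ).updateCol c
          (fun e => V'.mulVec x (Finset.orderEmbOfFin T.1 T.2 e)) := by
      ext i k
      by_cases hk : k = c
      · subst hk; simp
      · have : Finset.orderEmbOfFin T.1 T.2 k ≠ Finset.orderEmbOfFin T.1 T.2 c := fun h =>
          hk ((Finset.orderEmbOfFin T.1 T.2).injective h)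
        simp [Matrix.updateCol_ne hk, Matrix.updateCol_ne this, Matrix.one_apply]
    change Matrix.det (Matrix.submatrix _ _ _) = _
    rw [h3, ← Matrix.cramer_apply, Matrix.cramer_one]
    rfl
  rw [h1, h2, mul_zero] at key
  exact (mul_eq_zero.mp key.symm).resolve_left hb

end Compound

end SubspaceThm

namespace SubspaceThm

section Param

variable {n : ℕ}

theorem cramer_bound (N : Matrix (Fin n) (Fin n) ℝ) (hN : N.det ≠ 0) {C : ℝ} (hC : 1 ≤ C)
    (μ : Fin n → ℝ) (hμ : ∀ j, 0 < μ j) (hprod : ∏ j, μ j = |N.det|)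
    (hb : ∀ i j, |N i j| ≤ C * μ j) (y : Fin n → ℝ) (hy : ∀ i, |N.mulVec y i| ≤ 1) (j : Fin n) :
    |y j| * μ j ≤ n.factorial * C ^ n := by
  have h1 : N.det * y j = (N.updateCol j (N.mulVec y)).det := by
    rw [← Matrix.cramer_apply, Matrix.cramer_eq_adjugate_mulVec, Matrix.mulVec_mulVec,
      Matrix.adjugate_mul, Matrix.smul_mulVec, Matrix.one_mulVec]
    rfl
  have h2 : |(N.updateCol j (N.mulVec y)).det| ≤
      n.factorial * ∏ l, (Function.update (fun l => C * μ l) j 1) l := by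
    rw [← Matrix.det_transpose]
    refine abs_det_le_of_row _ _ fun l i => ?_
    by_cases hl : l = j
    · subst hl; simpa using hy i
    · simpa [Matrix.updateCol_ne hl, Function.update_of_ne hl] using hb i l
  have h3 : (∏ l, (Function.update (fun l => C * μ l) j 1) l) * μ j ≤ C ^ n * |N.det| := by
    have h4 : (∏ l, (Function.update (fun l => C * μ l) j 1) l) * (C * μ j) = C ^ n * |N.det| := by
      rw [Finset.prod_update_of_mem (Finset.mem_univ j), one_mul, mul_comm,
        ← hprod, Finset.sdiff_singleton_eq_erase,
        Finset.mul_prod_erase _ (fun l => C * μ l) (Finset.mem_univ j), Finset.prod_mul_distrib]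
      simp
    rw [← h4]
    refine mul_le_mul_of_nonneg_left (le_mul_of_one_le_left (hμ j).le hC)
      (Finset.prod_nonneg fun l _ => ?_)
    by_cases hl : l = j
    · subst hl; simp
    · rw [Function.update_of_ne hl]; exact mul_nonneg (by linarith) (hμ l).le
  have hpos : 0 < |N.det| := abs_pos.mpr hN
  have h5 : |N.det| * (|y j| * μ j) ≤ |N.det| * (n.factorial * C ^ n) := by
    rw [← mul_assoc, ← abs_mul, h1]
    calc _ ≤ (n.factorial * ∏ l, (Function.update (fun l => C * μ l) j 1) l) * μ j :=
          mul_le_mul_of_nonneg_right h2 (hμ j).le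
      _ = n.factorial * ((∏ l, (Function.update (fun l => C * μ l) j 1) l) * μ j) := by ring
      _ ≤ n.factorial * (C ^ n * |N.det|) := by gcongr
      _ = _ := by ring
  exact le_of_mul_le_mul_left h5 hpos

theorem exists_gap (μ : Fin n → ℝ) (θ : ℕ → ℝ) (hθ : Monotone θ) (j₀ : Fin n) (h₀ : μ j₀ ≤ θ 0) :
    ∃ k, k < n ∧ ∀ j, μ j ≤ θ k ∨ θ (k + 1) < μ j := by
  by_contra! hcon
  have : Nonempty (Fin n) := ⟨j₀⟩
  choose! f hf using hcon
  let g : Fin n → Fin n := fun k => f k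
  have hg : ∀ k : Fin n, θ k < μ (g k) ∧ μ (g k) ≤ θ (k + 1) := fun k => hf k k.2
  have hinj : Function.Injective g := by
    have key : ∀ a b : Fin n, a < b → g a ≠ g b := by
      intro a b hab h
      have h1 := (hg a).2
      have h2 := (hg b).1
      rw [h] at h1
      have h3 : θ (a + 1) ≤ θ b := hθ (Nat.succ_le_of_lt hab)
      linarith
    intro a b h
    rcases lt_trichotomy a b with hab | hab | hab
    · exact absurd h (key a b hab)
    · exact hab
    · exact absurd h.symm (key b a hab)
  obtain ⟨k, hk⟩ := (Finite.injective_iff_surjective.mp hinj) j₀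
  have h1 := (hg k).1
  rw [hk] at h1
  have h2 : θ 0 ≤ θ k := hθ (Nat.zero_le _)
  linarith

theorem exists_lower_bound (L : Matrix (Fin n) (Fin n) ℝ) (hdet : L.det ≠ 0) :
    ∃ κ : ℝ, 0 < κ ∧ ∀ u : Fin n → ℤ, u ≠ 0 → ∃ i, κ ≤ |L.mulVec (fun i => (u i : ℝ)) i| := by
  let D : ℝ := 1 + ∑ k, ∑ i, |L⁻¹ k i|
  have hD : 0 < D := by positivity
  refine ⟨1 / D, by positivity, fun u hu => ?_⟩
  by_contra! hcon
  obtain ⟨k, hk⟩ := Function.ne_iff.mp hu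
  have h1 : (1 : ℝ) ≤ |(u k : ℝ)| := by exact_mod_cast Int.one_le_abs hk
  have h2 : (fun i => (u i : ℝ)) = L⁻¹.mulVec (L.mulVec fun i => (u i : ℝ)) := by
    rw [Matrix.mulVec_mulVec, Matrix.nonsing_inv_mul _ (isUnit_iff_ne_zero.mpr hdet),
      Matrix.one_mulVec]
  have h3 : (u k : ℝ) = ∑ i, L⁻¹ k i * L.mulVec (fun i => (u i : ℝ)) i := congrFun h2 k
  have h4 : |(u k : ℝ)| ≤ (∑ i, |L⁻¹ k i|) * (1 / D) := by
    rw [h3, Finset.sum_mul]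
    refine (Finset.abs_sum_le_sum_abs _ _).trans (Finset.sum_le_sum fun i _ => ?_)
    rw [abs_mul]
    exact mul_le_mul_of_nonneg_left (hcon i).le (abs_nonneg _)
  have h5 : ∑ i, |L⁻¹ k i| ≤ ∑ k, ∑ i, |L⁻¹ k i| :=
    Finset.single_le_sum (f := fun k => ∑ i, |L⁻¹ k i|) (fun _ _ => by positivity)
      (Finset.mem_univ k)
  have h6 : (∑ i, |L⁻¹ k i|) * (1 / D) < 1 := by
    rw [mul_one_div, div_lt_one hD]
    simp only [D]; linarith
  linarith

theorem exists_reduced (L : Matrix (Fin n) (Fin n) ℝ) (hdet : L.det ≠ 0) (c : Fin n → ℝ)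
    {δ η : ℝ} (hc : ∑ i, c i = -δ) (hη : 0 < η) (hηδ : n * (n * η) < δ) :
    ∃ C : ℝ, 1 ≤ C ∧ ∃ K Q₀ : ℝ, 0 ≤ K ∧ ∀ Q : ℕ, Q₀ ≤ Q → ∀ x : Fin n → ℤ, x ≠ 0 →
      (∀ i, |L.mulVec (fun i => (x i : ℝ)) i| ≤ (Q : ℝ) ^ c i) →
      ∃ U V : Matrix (Fin n) (Fin n) ℤ, U * V = 1 ∧ ∃ π : Equiv.Perm (Fin n), ∃ ν : Fin n → ℝ,
        ∃ T : Finset (Fin n), T.Nonempty ∧ (∀ i, (Q : ℝ) ^ (-K) ≤ ν i) ∧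
        ∏ i, ν i = (Q : ℝ) ^ δ * |L.det| ∧
        (∀ i j, |(L * U.map (Int.castRingHom ℝ)) i j| ≤ (Q : ℝ) ^ c i * (C * ν i)) ∧
        (∀ i j, |(L * U.map (Int.castRingHom ℝ)) i j| ≤ (Q : ℝ) ^ c i * (C * ν (π j))) ∧
        (∀ i ∉ T, ∀ j ∈ T, (Q : ℝ) ^ η * ν (π i) ≤ ν (π j)) ∧ ∀ j ∈ T, V.mulVec x j = 0 := by
  obtain ⟨C, hC, hred⟩ := reducible_fin n
  obtain ⟨κ, hκ, hlow⟩ := exists_lower_bound L hdet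
  let C₁ : ℝ := n.factorial * C ^ n
  have hC₁ : 1 ≤ C₁ := by
    have h1 : (1 : ℝ) ≤ n.factorial := by exact_mod_cast n.factorial_pos
    exact one_le_mul_of_one_le_of_one_le h1 (one_le_pow₀ hC)
  obtain ⟨Q₁, hQ₁⟩ := exists_forall_nat_rpow_lt (C := C₁ ^ n / |L.det|)
    (e := n * (n * η) - δ) (by linarith)
  let K : ℝ := ∑ i, |c i| + 1
  refine ⟨C, hC, K, max (max Q₁ 1) (C / κ), by positivity, fun Q hQ x hx hLx => ?_⟩
  have hQ1 : (1 : ℝ) ≤ Q := (le_max_right _ _).trans ((le_max_left _ _).trans hQ)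
  have hQ0 : (0 : ℝ) < Q := by linarith
  have hQκ : C / κ ≤ Q := (le_max_right _ _).trans hQ
  have hQQ₁ := hQ₁ Q (by exact_mod_cast (le_max_left _ _).trans ((le_max_left _ _).trans hQ))
  let Dg : Matrix (Fin n) (Fin n) ℝ := Matrix.diagonal fun i => (Q : ℝ) ^ (-c i)
  let M := Dg * L
  have hDg : Dg.det = (Q : ℝ) ^ δ := by
    rw [Matrix.det_diagonal, ← Real.rpow_sum_of_pos hQ0, Finset.sum_neg_distrib, hc, neg_neg]
  have hMdet : |M.det| = (Q : ℝ) ^ δ * |L.det| := by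
    rw [Matrix.det_mul, hDg, abs_mul, abs_of_pos (Real.rpow_pos_of_pos hQ0 _)]
  have hLpos : 0 < |L.det| := abs_pos.mpr hdet
  have hM0 : M.det ≠ 0 := abs_pos.mp (by rw [hMdet]; positivity)
  obtain ⟨U, V, hUV, π, μ, hμ, hprod, hb⟩ := hred M hM0
  have hVU : V * U = 1 := mul_eq_one_comm.mp hUV
  have hMU : ∀ i j, |(L * U.map (Int.castRingHom ℝ)) i j| =
      (Q : ℝ) ^ c i * |(M * U.map (Int.castRingHom ℝ)) i j| := by
    intro i j
    simp only [M, Dg]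
    rw [Matrix.mul_assoc, Matrix.diagonal_mul, abs_mul, abs_of_pos (Real.rpow_pos_of_pos hQ0 _),
      ← mul_assoc, ← Real.rpow_add hQ0, add_neg_cancel, Real.rpow_zero, one_mul]
  have hcol : ∀ i j, |(M * U.map (Int.castRingHom ℝ)) i j| ≤ C * μ j := by
    intro i j
    have := (hb (π.symm i) j).2
    rwa [Equiv.apply_symm_apply] at this
  -- coordinates of `x`
  have hNdet : |(M * U.map (Int.castRingHom ℝ)).det| = |M.det| := by
    rw [Matrix.det_mul, abs_mul]
    have h1 : U.det * V.det = 1 := by rw [← Matrix.det_mul, hUV, Matrix.det_one]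
    have h2 : |U.det| = 1 := Int.isUnit_iff_abs_eq.mp (IsUnit.of_mul_eq_one _ h1)
    have h3 : (U.map (Int.castRingHom ℝ)).det = (U.det : ℝ) := by
      have := RingHom.map_det (Int.castRingHom ℝ) U
      simpa [RingHom.mapMatrix_apply] using this.symm
    rw [h3, ← Int.cast_abs, h2]; simp
  have hN0 : (M * U.map (Int.castRingHom ℝ)).det ≠ 0 :=
    abs_pos.mp (by rw [hNdet]; exact abs_pos.mpr hM0)
  have hUVx : (U.map (Int.castRingHom ℝ)).mulVec (fun j => (V.mulVec x j : ℝ)) =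
      fun i => (x i : ℝ) := by
    have h1 : U.mulVec (V.mulVec x) = x := by rw [Matrix.mulVec_mulVec, hUV, Matrix.one_mulVec]
    ext i
    have h2 := congrArg (Int.cast : ℤ → ℝ) (congrFun h1 i)
    rw [← h2]
    simp [Matrix.mulVec, dotProduct]
  have hy : ∀ i, |(M * U.map (Int.castRingHom ℝ)).mulVec (fun j => (V.mulVec x j : ℝ)) i| ≤ 1 := by
    intro i
    simp only [M, Dg]
    rw [← Matrix.mulVec_mulVec, hUVx, ← Matrix.mulVec_mulVec, Matrix.mulVec_diagonal, abs_mul,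
      abs_of_pos (Real.rpow_pos_of_pos hQ0 _)]
    calc _ ≤ (Q : ℝ) ^ (-c i) * (Q : ℝ) ^ c i :=
          mul_le_mul_of_nonneg_left (hLx i) (Real.rpow_nonneg hQ0.le _)
      _ = 1 := by rw [← Real.rpow_add hQ0, neg_add_cancel, Real.rpow_zero]
  have hcoord : ∀ j, V.mulVec x j ≠ 0 → μ j ≤ C₁ := by
    intro j hj
    have h1 := cramer_bound _ hN0 hC μ hμ (hprod.trans hNdet.symm) hcol _ hy j
    have h2 : (1 : ℝ) ≤ |((V.mulVec x j : ℤ) : ℝ)| := by exact_mod_cast Int.one_le_abs hj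
    exact (le_mul_of_one_le_left (hμ j).le h2).trans h1
  have hVx : V.mulVec x ≠ 0 := by
    intro h0
    apply hx
    rw [← Matrix.one_mulVec x, ← hUV, ← Matrix.mulVec_mulVec, h0, Matrix.mulVec_zero]
  obtain ⟨j₀, hj₀⟩ := Function.ne_iff.mp hVx
  let θ : ℕ → ℝ := fun k => C₁ * (Q : ℝ) ^ (k * η)
  have hθ : Monotone θ := by
    intro a b hab
    have h1 : (a : ℝ) ≤ b := by exact_mod_cast hab
    exact mul_le_mul_of_nonneg_left (Real.rpow_le_rpow_of_exponent_le hQ1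
      (mul_le_mul_of_nonneg_right h1 hη.le)) (by linarith)
  have hθ0 : θ 0 = C₁ := by simp [θ]
  obtain ⟨k, hk, hgap⟩ := exists_gap μ θ hθ j₀ (by rw [hθ0]; exact hcoord j₀ hj₀)
  let T : Finset (Fin n) := Finset.univ.filter fun j => θ (k + 1) < μ j
  refine ⟨U, V, hUV, π, fun i => μ (π.symm i), T, ?_, ?_, ?_, ?_, ?_, ?_, ?_⟩
  · by_contra hT
    rw [Finset.not_nonempty_iff_eq_empty] at hT
    have h1 : ∀ j, μ j ≤ θ n := by
      intro j
      have : j ∉ T := by rw [hT]; simp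
      simp only [T, Finset.mem_filter, Finset.mem_univ, true_and, not_lt] at this
      exact this.trans (hθ hk)
    have h2 : ∏ j, μ j ≤ θ n ^ n := by
      calc _ ≤ ∏ _j : Fin n, θ n := Finset.prod_le_prod (fun j _ => (hμ j).le) fun j _ => h1 j
        _ = _ := by simp
    have h3 : θ n ^ n = C₁ ^ n * (Q : ℝ) ^ ((n : ℝ) * (n * η)) := by
      simp only [θ]
      rw [mul_pow, ← Real.rpow_natCast ((Q : ℝ) ^ ((n : ℝ) * η)), ← Real.rpow_mul hQ0.le]
      congr 2; ring
    rw [hprod, hMdet, h3] at h2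
    rw [Real.rpow_sub hQ0] at hQQ₁
    have h4 : (0 : ℝ) < (Q : ℝ) ^ δ := Real.rpow_pos_of_pos hQ0 _
    rw [div_mul_div_comm, div_lt_one (by positivity)] at hQQ₁
    linarith
  · intro i
    have hucol : (fun l => U l (π.symm i)) ≠ 0 := by
      intro h0
      have h1 := congrFun (congrFun hVU (π.symm i)) (π.symm i)
      rw [Matrix.mul_apply, Matrix.one_apply_eq] at h1
      rw [Finset.sum_eq_zero fun l _ => by rw [congrFun h0 l]; simp] at h1
      exact zero_ne_one h1
    obtain ⟨l, hl⟩ := hlow _ hucol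
    have h1 : κ ≤ (Q : ℝ) ^ c l * (C * μ (π.symm i)) := by
      refine hl.trans ?_
      calc _ = |(L * U.map (Int.castRingHom ℝ)) l (π.symm i)| := rfl
        _ ≤ _ := by rw [hMU]; exact mul_le_mul_of_nonneg_left (hcol _ _) (by positivity)
    have h2 : (Q : ℝ) ^ c l ≤ (Q : ℝ) ^ (∑ i, |c i|) :=
      Real.rpow_le_rpow_of_exponent_le hQ1 ((le_abs_self _).trans
        (Finset.single_le_sum (f := fun i => |c i|) (fun _ _ => abs_nonneg _) (Finset.mem_univ l)))
    have hμi := hμ (π.symm i)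
    have h3 : κ ≤ (Q : ℝ) ^ (∑ i, |c i|) * (κ * Q * μ (π.symm i)) := by
      refine h1.trans ?_
      have : C ≤ κ * Q := by rwa [div_le_iff₀' hκ] at hQκ
      gcongr
    have h4 : 1 ≤ (Q : ℝ) ^ K * μ (π.symm i) := by
      simp only [K]
      rw [Real.rpow_add hQ0, Real.rpow_one]
      refine le_of_mul_le_mul_left ?_ hκ
      linarith
    rw [Real.rpow_neg hQ0.le, inv_le_iff_one_le_mul₀ (by positivity)]
    linarith
  · rw [Equiv.prod_comp π.symm μ, hprod, hMdet]
  · intro i j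
    rw [hMU]
    have := (hb (π.symm i) j).1
    rw [Equiv.apply_symm_apply] at this
    exact mul_le_mul_of_nonneg_left this (by positivity)
  · intro i j
    simp only [hMU, Equiv.symm_apply_apply]
    exact mul_le_mul_of_nonneg_left (hcol i j) (by positivity)
  · intro i hi j hj
    simp only [Equiv.symm_apply_apply]
    simp only [T, Finset.mem_filter, Finset.mem_univ, true_and] at hi hj
    have h1 := (hgap i).resolve_right hi
    calc (Q : ℝ) ^ η * μ i ≤ (Q : ℝ) ^ η * θ k := by gcongr
      _ = θ (k + 1) := by
        simp only [θ]
        push_cast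
        rw [add_mul, one_mul, Real.rpow_add hQ0]; ring
      _ ≤ _ := hj.le
  · intro j hj
    simp only [T, Finset.mem_filter, Finset.mem_univ, true_and] at hj
    by_contra h0
    have h1 := hcoord j h0
    have h2 : θ 0 ≤ θ (k + 1) := hθ (Nat.zero_le _)
    rw [hθ0] at h2
    linarith

end Param

end SubspaceThm

namespace SubspaceThm

section Param

variable {n : ℕ}

theorem mul_prod_le_prod_of_gap {α : Type*} [DecidableEq α] {J T : Finset α} (hcard : J.card = T.card)
    (hJT : J ≠ T) {μ : α → ℝ} (hμ : ∀ i, 0 < μ i) {q : ℝ} (hq : 1 ≤ q)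
    (hgap : ∀ i ∉ T, ∀ j ∈ T, q * μ i ≤ μ j) : q * ∏ j ∈ J, μ j ≤ ∏ j ∈ T, μ j := by
  have hq0 : 0 < q := by linarith
  have hm : (J \ T).card = (T \ J).card := Finset.card_sdiff_comm hcard
  have hne : (J \ T).Nonempty := by
    rw [Finset.nonempty_iff_ne_empty, Ne, Finset.sdiff_eq_empty_iff_subset]
    exact fun h => hJT (Finset.eq_of_subset_of_card_le h hcard.ge)
  have hne' : (T \ J).Nonempty := by rw [← Finset.card_pos, ← hm, Finset.card_pos]; exact hne
  obtain ⟨t, ht, htmin⟩ := Finset.exists_min_image (T \ J) μ hne'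
  have h1 : q * ∏ j ∈ J \ T, μ j ≤ ∏ j ∈ T \ J, μ j := by
    calc q * ∏ j ∈ J \ T, μ j ≤ q ^ (J \ T).card * ∏ j ∈ J \ T, μ j := by
          refine mul_le_mul_of_nonneg_right (le_self_pow₀ hq hne.card_pos.ne')
            (Finset.prod_nonneg fun i _ => (hμ i).le)
      _ = ∏ j ∈ J \ T, (q * μ j) := by rw [Finset.prod_mul_distrib, Finset.prod_const]
      _ ≤ ∏ _j ∈ J \ T, μ t := Finset.prod_le_prod
          (fun i _ => mul_nonneg hq0.le (hμ i).le)
          fun i hi => hgap i (Finset.mem_sdiff.mp hi).2 t (Finset.mem_sdiff.mp ht).1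
      _ = ∏ _j ∈ T \ J, μ t := by rw [Finset.prod_const, Finset.prod_const, hm]
      _ ≤ _ := Finset.prod_le_prod (fun _ _ => (hμ t).le) htmin
  rw [← Finset.prod_sdiff (Finset.inter_subset_left (s₁ := J) (s₂ := T)),
    ← Finset.prod_sdiff (Finset.inter_subset_right (s₁ := J) (s₂ := T)), ← mul_assoc,
    Finset.sdiff_inter_self_left, Finset.sdiff_inter_self_right]
  exact mul_le_mul_of_nonneg_right h1 (Finset.prod_nonneg fun i _ => (hμ i).le)

theorem exists_exponent {Q ν ε : ℝ} (hQ : 1 < Q) (hν : 0 < ν) (hε : 0 < ε) :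
    ∃ a : ℤ, ν ≤ Q ^ (ε * a) ∧ Q ^ (ε * a) ≤ ν * Q ^ ε := by
  have hQ0 : 0 < Q := by linarith
  refine ⟨⌈Real.logb Q ν / ε⌉, ?_, ?_⟩
  · have h1 := Int.le_ceil (Real.logb Q ν / ε)
    rw [div_le_iff₀' hε] at h1
    calc ν = Q ^ Real.logb Q ν := (Real.rpow_logb hQ0 hQ.ne' hν).symm
      _ ≤ _ := Real.rpow_le_rpow_of_exponent_le hQ.le h1
  · have h1 := (Int.ceil_lt_add_one (Real.logb Q ν / ε)).le
    have h2 : ε * (⌈Real.logb Q ν / ε⌉ : ℝ) ≤ Real.logb Q ν + ε := by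
      calc _ ≤ ε * (Real.logb Q ν / ε + 1) := by gcongr
        _ = _ := by field_simp
    calc _ ≤ Q ^ (Real.logb Q ν + ε) := Real.rpow_le_rpow_of_exponent_le hQ.le h2
      _ = _ := by rw [Real.rpow_add hQ0, Real.rpow_logb hQ0 hQ.ne' hν]

theorem exists_forall_le_rpow (C : ℝ) {ε : ℝ} (hε : 0 < ε) :
    ∃ Q₁ : ℕ, ∀ Q : ℕ, Q₁ ≤ Q → C ≤ (Q : ℝ) ^ ε := by
  obtain ⟨Q₁, h⟩ := exists_forall_nat_rpow_lt (C := C) (e := -ε) (by linarith)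
  refine ⟨max Q₁ 1, fun Q hQ => ?_⟩
  have h1 := h Q ((le_max_left _ _).trans hQ)
  have h0 : (0 : ℝ) < Q := by exact_mod_cast (le_max_right _ _).trans hQ
  rw [Real.rpow_neg h0.le, ← div_eq_mul_inv, div_lt_one (by positivity)] at h1
  exact h1.le

theorem exists_compound_bound (L : Matrix (Fin n) (Fin n) ℝ) (hdet : L.det ≠ 0) (c : Fin n → ℝ)
    {δ η ε : ℝ} (hc : ∑ i, c i = -δ) (hη : 0 < η) (hηδ : n * (n * η) < δ) (hε : 0 < ε) :
    ∃ B Q₀ : ℕ, ∀ Q : ℕ, Q₀ ≤ Q → ∀ x : Fin n → ℤ, x ≠ 0 →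
      (∀ i, |L.mulVec (fun i => (x i : ℝ)) i| ≤ (Q : ℝ) ^ c i) →
      ∃ U V : Matrix (Fin n) (Fin n) ℤ, U * V = 1 ∧ ∃ π : Equiv.Perm (Fin n), ∃ a : Fin n → ℤ,
        ∃ T : Finset (Fin n), T.Nonempty ∧ (∀ i, |a i| ≤ B) ∧
        ∑ i, ε * a i ≤ δ + (n + 1) * ε ∧ (∀ j ∈ T, V.mulVec x j = 0) ∧
        ∀ I J : Set.powersetCard (Fin n) T.card, J.1 ≠ T →
          |compound T.card (L * U.map (Int.castRingHom ℝ)) I J| ≤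
            (Q : ℝ) ^ (∑ i ∈ I.1, (c i + ε * a i) + ε -
              if I.1 = T.map π.toEmbedding then η else 0) := by
  obtain ⟨C, hC, K, Q₁, hK, hred⟩ := exists_reduced L hdet c hc hη hηδ
  obtain ⟨Q₂, hQ₂⟩ := exists_forall_le_rpow (n.factorial * C ^ n) hε
  obtain ⟨Q₃, hQ₃⟩ := exists_forall_le_rpow |L.det| hε
  have hδ : 0 < δ := lt_of_le_of_lt (by positivity) hηδ
  refine ⟨⌈(δ + (n + 1) * ε + n * K) / ε⌉₊, max (max 2 ⌈Q₁⌉₊) (max Q₂ Q₃),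
    fun Q hQ x hx hLx => ?_⟩
  have hQ2 : 2 ≤ Q := (le_max_left _ _).trans ((le_max_left _ _).trans hQ)
  have hQQ₁ : Q₁ ≤ Q := (Nat.le_ceil _).trans
    (by exact_mod_cast (le_max_right _ _).trans ((le_max_left _ _).trans hQ))
  have hQQ₂ := hQ₂ Q ((le_max_left _ _).trans ((le_max_right _ _).trans hQ))
  have hQQ₃ := hQ₃ Q ((le_max_right _ _).trans ((le_max_right _ _).trans hQ))
  have hQ1 : (1 : ℝ) < Q := by exact_mod_cast hQ2
  have hQ0 : (0 : ℝ) < Q := by linarith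
  obtain ⟨U, V, hUV, π, ν, T, hT, hνlow, hprod, hrow, hcol, hgap, hVx⟩ := hred Q hQQ₁ x hx hLx
  have hν : ∀ i, 0 < ν i := fun i => (Real.rpow_pos_of_pos hQ0 _).trans_le (hνlow i)
  choose a ha ha' using fun i => exists_exponent hQ1 (hν i) hε
  have hsum : ∑ i, ε * a i ≤ δ + (n + 1) * ε := by
    rw [← Real.rpow_le_rpow_left_iff hQ1, Real.rpow_sum_of_pos hQ0]
    calc ∏ i, (Q : ℝ) ^ (ε * a i) ≤ ∏ i, (ν i * (Q : ℝ) ^ ε) :=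
          Finset.prod_le_prod (fun i _ => by positivity) fun i _ => ha' i
      _ = (Q : ℝ) ^ δ * |L.det| * ((Q : ℝ) ^ ε) ^ n := by
          rw [Finset.prod_mul_distrib, hprod]; simp
      _ ≤ (Q : ℝ) ^ δ * (Q : ℝ) ^ ε * ((Q : ℝ) ^ ε) ^ n := by gcongr
      _ = _ := by
          rw [← Real.rpow_natCast, ← Real.rpow_mul hQ0.le, ← Real.rpow_add hQ0,
            ← Real.rpow_add hQ0]
          congr 1; ring
  have halow : ∀ i, -K ≤ ε * a i := fun i =>
    (Real.rpow_le_rpow_left_iff hQ1).mp ((hνlow i).trans (ha i))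
  have hapow : ∀ I : Finset (Fin n), ∏ i ∈ I, ν i ≤ (Q : ℝ) ^ (∑ i ∈ I, ε * a i) := by
    intro I
    rw [Real.rpow_sum_of_pos hQ0]
    exact Finset.prod_le_prod (fun i _ => (hν i).le) fun i _ => ha i
  have hconst : (T.card.factorial : ℝ) * C ^ T.card ≤ (Q : ℝ) ^ ε := by
    refine le_trans ?_ hQQ₂
    have h1 : T.card ≤ n := by simpa using T.card_le_univ
    have h2 : (T.card.factorial : ℝ) ≤ n.factorial := by exact_mod_cast Nat.factorial_le h1
    have h3 : C ^ T.card ≤ C ^ n := pow_le_pow_right₀ hC h1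
    have h4 : 0 ≤ C ^ T.card := by positivity
    gcongr
  refine ⟨U, V, hUV, π, a, T, hT, fun i => ?_, hsum, hVx, fun I J hJ => ?_⟩
  · have hup : ε * a i ≤ δ + (n + 1) * ε + n * K := by
      have h1 : ε * a i + K ≤ ∑ j, (ε * a j + K) :=
        Finset.single_le_sum (f := fun j => ε * a j + K) (fun j _ => by linarith [halow j])
          (Finset.mem_univ i)
      rw [Finset.sum_add_distrib] at h1
      simp only [Finset.sum_const, Finset.card_univ, Fintype.card_fin, nsmul_eq_mul] at h1
      linarith
    have hlo : -(δ + (n + 1) * ε + n * K) ≤ ε * a i := by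
      have h1 := halow i
      have h2 : (1 : ℝ) ≤ n := by exact_mod_cast i.pos
      have h3 : K ≤ n * K := le_mul_of_one_le_left hK h2
      have h4 : 0 ≤ (n + 1) * ε := by positivity
      linarith
    have h1 : |(a i : ℝ)| ≤ (δ + (n + 1) * ε + n * K) / ε := by
      rw [le_div_iff₀ hε, ← abs_of_pos hε, ← abs_mul, abs_of_pos hε, mul_comm]
      exact abs_le.mpr ⟨hlo, hup⟩
    have h2 := h1.trans (Nat.le_ceil _)
    exact_mod_cast h2
  · have hsplit : ∑ i ∈ I.1, (c i + ε * a i) = ∑ i ∈ I.1, c i + ∑ i ∈ I.1, ε * a i :=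
      Finset.sum_add_distrib
    have hcI : ∏ i ∈ I.1, (Q : ℝ) ^ c i = (Q : ℝ) ^ (∑ i ∈ I.1, c i) :=
      (Real.rpow_sum_of_pos hQ0 _ _).symm
    have hIcard : I.1.card = T.card := I.2
    have hJcard : J.1.card = T.card := J.2
    split_ifs with hI
    · have h1 := abs_compound_le_col _ (fun i => (Q : ℝ) ^ c i) (fun j => C * ν (π j)) hcol I J
      refine h1.trans ?_
      have h2 : (Q : ℝ) ^ η * ∏ j ∈ J.1, ν (π j) ≤ ∏ i ∈ I.1, ν i := by
        rw [hI, Finset.prod_map]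
        exact mul_prod_le_prod_of_gap (μ := fun j => ν (π j)) hJcard hJ (fun i => hν _)
          (Real.one_le_rpow hQ1.le hη.le) hgap
      have h3 : ∏ j ∈ J.1, ν (π j) ≤ (Q : ℝ) ^ (∑ i ∈ I.1, ε * a i - η) := by
        rw [Real.rpow_sub hQ0, le_div_iff₀' (by positivity)]
        exact h2.trans (hapow _)
      rw [Finset.prod_mul_distrib, Finset.prod_const, hJcard, hcI]
      calc _ = ((T.card.factorial : ℝ) * C ^ T.card) * (Q : ℝ) ^ (∑ i ∈ I.1, c i) *
              ∏ j ∈ J.1, ν (π j) := by ring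
        _ ≤ (Q : ℝ) ^ ε * (Q : ℝ) ^ (∑ i ∈ I.1, c i) *
              (Q : ℝ) ^ (∑ i ∈ I.1, ε * a i - η) := by
            have : 0 ≤ ∏ j ∈ J.1, ν (π j) := Finset.prod_nonneg fun _ _ => (hν _).le
            gcongr
        _ = _ := by
            rw [← Real.rpow_add hQ0, ← Real.rpow_add hQ0, hsplit]
            congr 1; ring
    · have h1 := abs_compound_le_row _ (fun i => (Q : ℝ) ^ c i * (C * ν i)) hrow I J
      refine h1.trans ?_
      rw [Finset.prod_mul_distrib, Finset.prod_mul_distrib, Finset.prod_const, hIcard, hcI]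
      calc _ = ((T.card.factorial : ℝ) * C ^ T.card) * (Q : ℝ) ^ (∑ i ∈ I.1, c i) *
              ∏ j ∈ I.1, ν j := by ring
        _ ≤ (Q : ℝ) ^ ε * (Q : ℝ) ^ (∑ i ∈ I.1, c i) *
              (Q : ℝ) ^ (∑ i ∈ I.1, ε * a i) := by
            have : 0 ≤ ∏ j ∈ I.1, ν j := Finset.prod_nonneg fun _ _ => (hν _).le
            have := hapow I.1
            gcongr
        _ = _ := by
            rw [← Real.rpow_add hQ0, ← Real.rpow_add hQ0, hsplit]
            congr 1; ring

end Param

end SubspaceThm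

namespace SubspaceThm

section Param

variable {n : ℕ}

theorem exists_sum_powersetCard_eq (n p : ℕ) : ∃ m : ℕ, m ≤ 2 ^ n ∧ ∀ b : Fin n → ℝ,
    ∑ I : Set.powersetCard (Fin n) p, ∑ i ∈ I.1, b i = m * ∑ i, b i := by
  let N : Fin n → ℕ := fun i =>
    (Finset.univ.filter fun I : Set.powersetCard (Fin n) p => i ∈ I.1).card
  have hle : ∀ i j, N i ≤ N j := by
    intro i j
    refine Finset.card_le_card_of_injOn
      (fun I => ⟨I.1.map (Equiv.swap i j).toEmbedding, ?_⟩) ?_ ?_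
    · exact (Finset.card_map _).trans I.2
    · intro I hI
      simp only [Finset.coe_filter, Finset.mem_univ, true_and, Set.mem_ofPred_eq] at hI ⊢
      exact Finset.mem_map.mpr ⟨i, hI, by simp⟩
    · intro I _ J _ h
      have h1 := congrArg Subtype.val h
      exact Subtype.ext (Finset.map_injective _ h1)
  have hsum : ∀ b : Fin n → ℝ,
      ∑ I : Set.powersetCard (Fin n) p, ∑ i ∈ I.1, b i = ∑ i, (N i : ℝ) * b i := by
    intro b
    have h1 : ∀ I : Set.powersetCard (Fin n) p,
        ∑ i ∈ I.1, b i = ∑ i, if i ∈ I.1 then b i else 0 := by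
      intro I; simp
    simp_rw [h1]
    rw [Finset.sum_comm]
    refine Finset.sum_congr rfl fun i _ => ?_
    rw [← Finset.sum_filter, Finset.sum_const, nsmul_eq_mul]
  rcases n with _ | n
  · exact ⟨0, by simp, fun b => by rw [hsum]; simp⟩
  · refine ⟨N 0, ?_, fun b => ?_⟩
    · refine (Finset.card_le_univ _).trans ?_
      calc _ ≤ Fintype.card (Finset (Fin (n + 1))) :=
            Fintype.card_le_of_injective (fun I => I.1) Subtype.val_injective
        _ = _ := by simp
    · rw [hsum, Finset.mul_sum]
      refine Finset.sum_congr rfl fun i _ => ?_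
      rw [le_antisymm (hle i 0) (hle 0 i)]

theorem exists_infinite_fiber {α β : Type*} {S : Set α} (hS : S.Infinite) {F : Set β}
    (hF : F.Finite) (R : α → β → Prop) (h : ∀ a ∈ S, ∃ b ∈ F, R a b) :
    ∃ b ∈ F, {a ∈ S | R a b}.Infinite := by
  by_contra! hcon
  refine hS ((hF.biUnion fun b hb => hcon b hb).subset fun a ha => ?_)
  obtain ⟨b, hb, hab⟩ := h a ha
  exact Set.mem_biUnion hb ⟨ha, hab⟩

theorem exists_infinite_injOn {α β : Type*} {S : Set α} (hS : S.Infinite) (f : α → β)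
    (h : ∀ a ∈ S, {b ∈ S | f b = f a}.Finite) : ∃ S' ⊆ S, S'.Infinite ∧ Set.InjOn f S' := by
  obtain ⟨S', hS', hbij⟩ := Set.exists_subset_bijOn S f
  refine ⟨S', hS', fun hfin => ?_, hbij.injOn⟩
  have himg : (f '' S).Finite := by rw [← hbij.image_eq]; exact hfin.image f
  obtain ⟨b, ⟨a, ha, rfl⟩, hb⟩ := exists_infinite_fiber hS himg (fun a b => f a = b)
    fun a ha => ⟨f a, Set.mem_image_of_mem f ha, rfl⟩
  exact hb (h a ha)

theorem isAlgebraic_det {m : Type*} [Fintype m] [DecidableEq m] (A : Matrix m m ℝ)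
    (hA : ∀ i j, IsAlgebraic ℚ (A i j)) : IsAlgebraic ℚ A.det := by
  have h : A = (algebraMap (integralClosure ℚ ℝ) ℝ).mapMatrix
      (Matrix.of fun i j => (⟨A i j, (hA i j).isIntegral⟩ : integralClosure ℚ ℝ)) := by
    ext i j; rfl
  rw [h, ← RingHom.map_det]
  exact IsIntegral.isAlgebraic (Subtype.property _)

theorem isAlgebraic_inv {m : Type*} [Fintype m] [DecidableEq m] (A : Matrix m m ℝ)
    (hA : ∀ i j, IsAlgebraic ℚ (A i j)) (i j : m) : IsAlgebraic ℚ (A⁻¹ i j) := by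
  rw [Matrix.inv_def, Matrix.smul_apply, Ring.inverse_eq_inv', smul_eq_mul]
  refine (isAlgebraic_det A hA).inv.mul ?_
  rw [Matrix.adjugate_apply]
  refine isAlgebraic_det _ fun k l => ?_
  rw [Matrix.updateRow_apply]
  split_ifs
  · rw [Pi.single_apply]
    split_ifs
    · exact isAlgebraic_one
    · exact isAlgebraic_zero
  · exact hA k l

/-- A parametric form of the subspace theorem. -/
theorem parametric_subspace (L : Matrix (Fin n) (Fin n) ℝ) (hL : ∀ i j, IsAlgebraic ℚ (L i j))
    (hdet : L.det ≠ 0) (c : Fin n → ℝ) (hc : ∑ i, c i < 0) (S : Set ℕ) (hS : S.Infinite)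
    (x : ℕ → Fin n → ℤ) (hx : ∀ Q ∈ S, x Q ≠ 0)
    (hLx : ∀ Q ∈ S, ∀ i, |L.mulVec (fun i => (x Q i : ℝ)) i| ≤ (Q : ℝ) ^ c i) :
    ∃ h : Fin n → ℤ, h ≠ 0 ∧ {Q ∈ S | ∑ i, h i * x Q i = 0}.Infinite := by
  by_contra! hcon
  set δ := -∑ i, c i with hδ
  have hδ0 : 0 < δ := by linarith
  let η := δ / (n * n + 1)
  have hη : 0 < η := by positivity
  have hηδ : n * (n * η) < δ := by
    have : n * (n * η) = δ * ((n * n) / (n * n + 1)) := by simp only [η]; ring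
    rw [this]
    refine mul_lt_of_lt_one_right hδ0 ?_
    rw [div_lt_one (by positivity)]; linarith
  let ε := η / (2 ^ n * (n + 2) + 1)
  have hε : 0 < ε := by positivity
  have hεη : 2 ^ n * (n + 2) * ε < η := by
    have : 2 ^ n * (n + 2) * ε = η * ((2 ^ n * (n + 2)) / (2 ^ n * (n + 2) + 1)) := by
      simp only [ε]; ring
    rw [this]
    refine mul_lt_of_lt_one_right hη ?_
    rw [div_lt_one (by positivity)]; linarith
  obtain ⟨B, Q₀, hdata⟩ := exists_compound_bound L hdet c (by rw [hδ, neg_neg]) hη hηδ hε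
  let S₁ : Set ℕ := S \ Set.Iio Q₀
  have hS₁ : S₁.Infinite := hS.sdiff (Set.finite_Iio Q₀)
  let F : Set (Equiv.Perm (Fin n) × Finset (Fin n) × (Fin n → ℤ)) :=
    Set.univ ×ˢ (Set.univ ×ˢ Set.Icc (fun _ => -(B : ℤ)) (fun _ => (B : ℤ)))
  have hF : F.Finite := Set.finite_univ.prod (Set.finite_univ.prod (Set.finite_Icc _ _))
  obtain ⟨⟨π, T, a⟩, -, hS₂⟩ := exists_infinite_fiber hS₁ hF
    (fun Q d => ∃ U V : Matrix (Fin n) (Fin n) ℤ, U * V = 1 ∧ d.2.1.Nonempty ∧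
        ∑ i, ε * d.2.2 i ≤ δ + (n + 1) * ε ∧ (∀ j ∈ d.2.1, V.mulVec (x Q) j = 0) ∧
        ∀ I J : Set.powersetCard (Fin n) d.2.1.card, J.1 ≠ d.2.1 →
          |compound d.2.1.card (L * U.map (Int.castRingHom ℝ)) I J| ≤
            (Q : ℝ) ^ (∑ i ∈ I.1, (c i + ε * d.2.2 i) + ε -
              if I.1 = d.2.1.map d.1.toEmbedding then η else 0)) (by
      intro Q hQ
      obtain ⟨U, V, hUV, π, a, T, hT, ha, hsum, hV, hbd⟩ := hdata Q (not_lt.mp hQ.2) (x Q)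
        (hx Q hQ.1) (hLx Q hQ.1)
      refine ⟨(π, T, a), ⟨trivial, trivial, ?_⟩, U, V, hUV, hT, hsum, hV, hbd⟩
      exact ⟨fun i => (abs_le.mp (ha i)).1, fun i => (abs_le.mp (ha i)).2⟩)
  set S₂ := {Q ∈ S₁ | _} with hS₂def
  have hS₂' : ∀ Q ∈ S₂, Q ∈ S := fun Q hQ => hQ.1.1
  obtain ⟨hT, hasum⟩ : T.Nonempty ∧ ∑ i, ε * a i ≤ δ + (n + 1) * ε := by
    obtain ⟨Q, -, U, V, -, h1, h2, -⟩ := hS₂.nonempty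
    exact ⟨h1, h2⟩
  have hex : ∀ Q ∈ S₂, ∃ U V : Matrix (Fin n) (Fin n) ℤ, U * V = 1 ∧
      (∀ j ∈ T, V.mulVec (x Q) j = 0) ∧ ∀ I J : Set.powersetCard (Fin n) T.card, J.1 ≠ T →
          |compound T.card (L * U.map (Int.castRingHom ℝ)) I J| ≤
            (Q : ℝ) ^ (∑ i ∈ I.1, (c i + ε * a i) + ε -
              if I.1 = T.map π.toEmbedding then η else 0) := by
    rintro Q ⟨-, U, V, hUV, -, -, h1, h2⟩
    exact ⟨U, V, hUV, h1, h2⟩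
  choose! U V hUV hVx hbd using hex
  have hVU : ∀ Q ∈ S₂, V Q * U Q = 1 := fun Q hQ => mul_eq_one_comm.mp (hUV Q hQ)
  let W : ℕ → Set (Fin n → ℤ) := fun Q => {y | ∀ j ∈ T, (V Q).mulVec y j = 0}
  obtain ⟨j₁, hj₁⟩ := hT
  obtain ⟨S₃, hS₃, hS₃inf, hinj⟩ := exists_infinite_injOn hS₂ W (by
    intro Q hQ
    have hrow : (fun i => V Q j₁ i) ≠ 0 := by
      intro h0
      have h1 := congrFun (congrFun (hVU Q hQ) j₁) j₁
      rw [Matrix.mul_apply, Matrix.one_apply_eq,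
        Finset.sum_eq_zero fun l _ => by rw [congrFun h0 l]; simp] at h1
      exact zero_ne_one h1
    refine (hcon _ hrow).subset ?_
    rintro Q' ⟨hQ', hW⟩
    have h1 : x Q' ∈ W Q' := hVx Q' hQ'
    rw [hW] at h1
    exact ⟨hS₂' Q' hQ', h1 j₁ hj₁⟩)
  let T' : Set.powersetCard (Fin n) T.card := ⟨T, rfl⟩
  let πT : Set.powersetCard (Fin n) T.card := ⟨T.map π.toEmbedding, Finset.card_map _⟩
  let c' : Set.powersetCard (Fin n) T.card → ℝ := fun I =>
    ∑ i ∈ I.1, (c i + ε * a i) + ε - if I.1 = T.map π.toEmbedding then η else 0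
  have hc' : ∑ I, c' I < 0 := by
    obtain ⟨m, hm, hmsum⟩ := exists_sum_powersetCard_eq n T.card
    have h1 : ∑ I : Set.powersetCard (Fin n) T.card,
        (if I.1 = T.map π.toEmbedding then η else 0) = η := by
      rw [Finset.sum_eq_single πT]
      · simp [πT]
      · intro I _ hI
        rw [if_neg fun h => hI (Subtype.ext h)]
      · simp
    have h2 : (Fintype.card (Set.powersetCard (Fin n) T.card) : ℝ) ≤ 2 ^ n := by
      have : Fintype.card (Set.powersetCard (Fin n) T.card) ≤ Fintype.card (Finset (Fin n)) :=
        Fintype.card_le_of_injective (fun I => I.1) Subtype.val_injective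
      rw [Fintype.card_finset, Fintype.card_fin] at this
      exact_mod_cast this
    simp only [c']
    rw [Finset.sum_sub_distrib, Finset.sum_add_distrib, h1, hmsum, Finset.sum_add_distrib]
    simp only [Finset.sum_const, Finset.card_univ, nsmul_eq_mul]
    have h3 : ∑ i, c i + ∑ i, ε * a i ≤ (n + 1) * ε := by linarith
    have h4 : (m : ℝ) ≤ 2 ^ n := by exact_mod_cast hm
    have h5 : (m : ℝ) * (∑ i, c i + ∑ i, ε * a i) ≤ 2 ^ n * ((n + 1) * ε) := by
      calc _ ≤ (m : ℝ) * ((n + 1) * ε) := by gcongr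
        _ ≤ _ := by gcongr
    have h6 : (Fintype.card (Set.powersetCard (Fin n) T.card) : ℝ) * ε ≤ 2 ^ n * ε := by gcongr
    linarith
  have hcompinv : compound T.card L * compound T.card L⁻¹ = 1 := by
    rw [← compound_mul, Matrix.mul_nonsing_inv _ (isUnit_iff_ne_zero.mpr hdet), compound_one]
  obtain ⟨Q, hQ, Q', hQ', hne, t, ht, hprop⟩ := exists_proportional (compound T.card L)
    (by
      rw [Matrix.inv_eq_right_inv hcompinv]
      intro I J
      exact isAlgebraic_det _ fun i j => isAlgebraic_inv L hL _ _)
    (by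
      intro h0
      have := congrArg Matrix.det hcompinv
      rw [Matrix.det_mul, h0, zero_mul, Matrix.det_one] at this
      exact zero_ne_one this)
    c' (δ := -∑ I, c' I) (by linarith) (neg_neg _).symm S₃ hS₃inf
    (fun Q => compound T.card (U Q)) (fun Q => compound T.card (V Q))
    (fun Q hQ => by rw [← compound_mul, hVU Q (hS₃ hQ), compound_one]) T'
    (by
      intro Q hQ I J hJ
      rw [← compound_map, ← compound_mul]
      exact hbd Q (hS₃ hQ) I J fun h => hJ (Subtype.ext h))
  refine hne (hinj hQ hQ' (Set.ext fun y => ⟨?_, ?_⟩))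
  · intro hy
    exact mulVec_eq_zero_of_compound (hVU Q' (hS₃ hQ')) T' (a := 1) (b := t) ht
      (fun K => by simpa using congrFun hprop K) y hy
  · intro hy
    exact mulVec_eq_zero_of_compound (hVU Q (hS₃ hQ)) T' (a := t) (b := 1) one_ne_zero
      (fun K => by simpa using (congrFun hprop K).symm) y hy

end Param

end SubspaceThm

namespace SubspaceThm

section Final

theorem isAlgebraic_re {z : ℂ} (hz : IsAlgebraic ℚ z) : IsAlgebraic ℚ z.re := by
  have hconj : IsAlgebraic ℚ ((starRingEnd ℂ) z) :=
    hz.algHom ((Complex.conjAe : ℂ →ₐ[ℝ] ℂ).restrictScalars ℚ)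
  have h1 : ((z.re : ℝ) : ℂ) = (2 : ℚ)⁻¹ • (z + (starRingEnd ℂ) z) := by
    rw [Complex.add_conj, Rat.smul_def]
    push_cast
    ring
  have h2 : IsAlgebraic ℚ ((z.re : ℝ) : ℂ) := by
    rw [h1]
    exact (hz.add hconj).smul _
  exact (isAlgebraic_algebraMap_iff (A := ℂ) (algebraMap ℝ ℂ).injective).mp h2

theorem isAlgebraic_I : IsAlgebraic ℚ Complex.I := by
  refine (IsAlgebraic.of_pow (n := 2) two_pos ?_)
  rw [Complex.I_sq]
  exact isAlgebraic_one.neg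

/-- The matrix with first row `(σ, -ξ)` whose other rows are those of the identity matrix. -/
def formMatrix {d : ℕ} (σ : ℝ) (ξ : Fin d → ℝ) : Matrix (Fin (d + 1)) (Fin (d + 1)) ℝ :=
  Matrix.of (Fin.cons (Fin.cons σ fun i => -ξ i) fun i => Pi.single i.succ 1)

theorem formMatrix_det {d : ℕ} (σ : ℝ) (ξ : Fin d → ℝ) : (formMatrix σ ξ).det = σ := by
  rw [Matrix.det_of_isUpperTriangular]
  · rw [Fin.prod_univ_succ]
    simp [formMatrix]
  · intro i j hij
    refine Fin.cases ?_ (fun i hij => ?_) i hij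
    · intro h; exact absurd h (Fin.not_lt_zero _)
    · have : j ≠ i.succ := (show j < i.succ from hij).ne
      simp [formMatrix, this]

theorem formMatrix_mulVec_zero {d : ℕ} (σ : ℝ) (ξ : Fin d → ℝ) (y : Fin (d + 1) → ℝ) :
    (formMatrix σ ξ).mulVec y 0 = σ * y 0 - ∑ i, ξ i * y (Fin.succ i) := by
  simp [formMatrix, Matrix.mulVec, dotProduct, Fin.sum_univ_succ, sub_eq_add_neg]

theorem formMatrix_mulVec_succ {d : ℕ} (σ : ℝ) (ξ : Fin d → ℝ) (y : Fin (d + 1) → ℝ)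
    (i : Fin d) : (formMatrix σ ξ).mulVec y i.succ = y i.succ := by
  simp [formMatrix, Matrix.mulVec]

/-- Infinitely many solutions of the inequality satisfy a common linear relation. -/
theorem exists_relation {d : ℕ} (x : Fin d → ℂ) (s : ℂ) (hx : ∀ i, IsAlgebraic ℚ (x i))
    (hs : IsAlgebraic ℚ s) (hs0 : s ≠ 0) {C δ : ℝ} (hδ : 0 < δ) (S : Set ℕ)
    (hS : S.Infinite) (p : ℕ → Fin d → ℤ) (hp : ∀ q ∈ S, 1 ≤ q ∧
      (∀ i, |(p q i : ℝ)| ≤ (q : ℝ) ^ C) ∧ ‖(q : ℂ) * s - ∑ i, (p q i : ℂ) * x i‖ *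
        ∏ i, max 1 |(p q i : ℝ)| < (q : ℝ) ^ (-δ)) (hC : 0 < C) :
    ∃ h : Fin (d + 1) → ℤ, h ≠ 0 ∧
      {q ∈ S | h 0 * q + ∑ i, h (Fin.succ i) * p q i = 0}.Infinite := by
  obtain ⟨u, hu, hunorm, hus⟩ : ∃ u : ℂ, IsAlgebraic ℚ u ∧ ‖u‖ = 1 ∧ (u * s).re ≠ 0 := by
    by_cases h : s.re = 0
    · refine ⟨Complex.I, isAlgebraic_I, Complex.norm_I, ?_⟩
      simp only [Complex.I_mul_re, ne_eq, neg_eq_zero]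
      exact fun h' => hs0 (Complex.ext h h')
    · exact ⟨1, isAlgebraic_one, norm_one, by simpa using h⟩
  let σ : ℝ := (u * s).re
  let ξ : Fin d → ℝ := fun i => (u * x i).re
  have hform : ∀ q : ℕ, |σ * q - ∑ i, ξ i * p q i| ≤ ‖(q : ℂ) * s - ∑ i, (p q i : ℂ) * x i‖ := by
    intro q
    have h1 : σ * q - ∑ i, ξ i * p q i = (u * ((q : ℂ) * s - ∑ i, (p q i : ℂ) * x i)).re := by
      rw [mul_sub, Complex.sub_re, Finset.mul_sum, Complex.re_sum]
      congr 1
      · rw [show u * ((q : ℂ) * s) = ((q : ℝ) : ℂ) * (u * s) by push_cast; ring,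
          Complex.re_ofReal_mul, mul_comm]
      · refine Finset.sum_congr rfl fun i _ => ?_
        rw [show u * ((p q i : ℂ) * x i) = ((p q i : ℝ) : ℂ) * (u * x i) by push_cast; ring,
          Complex.re_ofReal_mul, mul_comm]
    rw [h1]
    refine (Complex.abs_re_le_norm _).trans ?_
    rw [norm_mul, hunorm, one_mul]
  let ε : ℝ := δ / (d + 1)
  have hε : 0 < ε := by positivity
  let B : ℕ := ⌈(C + ε) / ε⌉₊
  have hS₁ : (S \ Set.Iio 2).Infinite := hS.sdiff (Set.finite_Iio 2)
  obtain ⟨a, -, hS₂⟩ := exists_infinite_fiber hS₁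
    (Set.finite_Icc (fun _ : Fin d => (0 : ℤ)) (fun _ => (B : ℤ)))
    (fun q a => ∀ i, max 1 |(p q i : ℝ)| ≤ (q : ℝ) ^ (ε * a i) ∧
      (q : ℝ) ^ (ε * a i) ≤ max 1 |(p q i : ℝ)| * (q : ℝ) ^ ε) (by
      intro q hq
      have hq1 : (1 : ℝ) < q := by
        have : 2 ≤ q := not_lt.mp hq.2
        exact_mod_cast this
      choose a ha ha' using fun i : Fin d =>
        exists_exponent hq1 (lt_max_of_lt_left one_pos : 0 < max 1 |(p q i : ℝ)|) hε
      refine ⟨a, ⟨fun i => ?_, fun i => ?_⟩, fun i => ⟨ha i, ha' i⟩⟩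
      · have h1 : (q : ℝ) ^ (0 : ℝ) ≤ (q : ℝ) ^ (ε * a i) := by
          rw [Real.rpow_zero]; exact (le_max_left _ _).trans (ha i)
        have h2 := (Real.rpow_le_rpow_left_iff hq1).mp h1
        have h3 : (0 : ℝ) ≤ a i := nonneg_of_mul_nonneg_right h2 hε
        exact_mod_cast h3
      · have h1 : (q : ℝ) ^ (ε * a i) ≤ (q : ℝ) ^ (C + ε) := by
          rw [Real.rpow_add (by linarith)]
          refine (ha' i).trans (mul_le_mul_of_nonneg_right ?_ (by positivity))
          exact max_le (Real.one_le_rpow hq1.le hC.le) ((hp q hq.1).2.1 i)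
        have h2 := (Real.rpow_le_rpow_left_iff hq1).mp h1
        rw [← le_div_iff₀' hε] at h2
        have h3 := h2.trans (Nat.le_ceil _)
        exact_mod_cast h3)
  let c : Fin (d + 1) → ℝ := Fin.cons (-δ + d * ε - ∑ i, ε * a i) fun i => ε * a i
  have hcsum : ∑ i, c i < 0 := by
    rw [Fin.sum_univ_succ]
    simp only [c, Fin.cons_zero, Fin.cons_succ, sub_add_cancel]
    have : ε * (d + 1) = δ := by simp only [ε]; field_simp
    linarith
  obtain ⟨h, hh, hinf⟩ := parametric_subspace (formMatrix σ ξ) (by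
      intro i j
      refine Fin.cases ?_ (fun i => ?_) i
      · refine Fin.cases ?_ (fun j => ?_) j
        · exact isAlgebraic_re (hu.mul hs)
        · exact (isAlgebraic_re (hu.mul (hx j))).neg
      · simp only [formMatrix, Matrix.of_apply, Fin.cons_succ, Pi.single_apply]
        split_ifs
        · exact isAlgebraic_one
        · exact isAlgebraic_zero)
    (by rw [formMatrix_det]; exact hus) c hcsum _ hS₂
    (fun q => Fin.cons (q : ℤ) (p q)) (by
      intro q hq h0
      have h1 := congrFun h0 0
      have h2 := (hp q hq.1.1).1
      simp at h1
      omega) (by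
      intro q hq i
      have hq2 : 2 ≤ q := not_lt.mp hq.1.2
      have hq0 : (0 : ℝ) < q := by exact_mod_cast (by omega : 0 < q)
      refine Fin.cases ?_ (fun i => ?_) i
      · rw [formMatrix_mulVec_zero]
        simp only [Fin.cons_zero, Fin.cons_succ, c, Int.cast_natCast]
        refine (hform q).trans ?_
        have h1 := (hp q hq.1.1).2.2
        have hP : 0 < ∏ i, max 1 |(p q i : ℝ)| :=
          Finset.prod_pos fun i _ => lt_max_of_lt_left one_pos
        rw [← lt_div_iff₀ hP] at h1
        refine h1.le.trans ?_
        rw [div_le_iff₀ hP, Real.rpow_sub hq0, Real.rpow_add hq0]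
        have h2 : (q : ℝ) ^ (∑ i, ε * a i) ≤ (∏ i, max 1 |(p q i : ℝ)|) * (q : ℝ) ^ (d * ε) := by
          rw [Real.rpow_sum_of_pos hq0]
          calc _ ≤ ∏ i, (max 1 |(p q i : ℝ)| * (q : ℝ) ^ ε) :=
                Finset.prod_le_prod (fun _ _ => by positivity) fun i _ => (hq.2 i).2
            _ = _ := by
                rw [Finset.prod_mul_distrib, mul_comm (d : ℝ), Real.rpow_mul hq0.le,
                  Real.rpow_natCast]
                simp
        have h3 : 0 < (q : ℝ) ^ (-δ) := by positivity
        have h4 : 0 < (q : ℝ) ^ (∑ i, ε * a i) := by positivity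
        rw [div_mul_eq_mul_div, le_div_iff₀ h4]
        calc _ ≤ (q : ℝ) ^ (-δ) * ((∏ i, max 1 |(p q i : ℝ)|) * (q : ℝ) ^ (d * ε)) := by gcongr
          _ = _ := by ring
      · rw [formMatrix_mulVec_succ]
        simp only [Fin.cons_succ, c]
        exact (le_max_right _ _).trans (hq.2 i).1)
  refine ⟨h, hh, hinf.mono ?_⟩
  rintro q ⟨hq, hrel⟩
  refine ⟨hq.1.1, ?_⟩
  rw [Fin.sum_univ_succ] at hrel
  simpa using hrel

theorem not_infinite_solutions (d : ℕ) : ∀ (x : Fin d → ℂ) (s : ℂ),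
    (∀ i, IsAlgebraic ℚ (x i)) → IsAlgebraic ℚ s →
    (¬ ∃ q : Fin d → ℚ, s = ∑ i, (q i : ℂ) * x i) →
    ∀ (C δ : ℝ), 0 < C → 0 < δ → ∀ (S : Set ℕ) (p : ℕ → Fin d → ℤ), (∀ q ∈ S, 1 ≤ q ∧
      (∀ i, |(p q i : ℝ)| ≤ (q : ℝ) ^ C) ∧ ‖(q : ℂ) * s - ∑ i, (p q i : ℂ) * x i‖ *
        ∏ i, max 1 |(p q i : ℝ)| < (q : ℝ) ^ (-δ)) → ¬ S.Infinite := by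
  induction d with
  | zero =>
    intro x s hx hs hspan C δ hC hδ S p hp hS
    have hs0 : s ≠ 0 := fun h => hspan ⟨fun _ => 0, by simp [h]⟩
    obtain ⟨h, hh, hinf⟩ := exists_relation x s hx hs hs0 hδ S hS p hp hC
    obtain ⟨q, hq, hrel⟩ := hinf.nonempty
    have h1 := (hp q hq).1
    simp only [Finset.univ_eq_empty, Finset.sum_empty, add_zero, mul_eq_zero] at hrel
    rcases hrel with h0 | h0
    · exact hh (funext fun j => Fin.cases h0 (fun i => i.elim0) j)
    · have : q = 0 := by exact_mod_cast h0
      omega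
  | succ d ih =>
    intro x s hx hs hspan C δ hC hδ S p hp hS
    have hs0 : s ≠ 0 := fun h => hspan ⟨fun _ => 0, by simp [h]⟩
    obtain ⟨h, hh, hinf⟩ := exists_relation x s hx hs hs0 hδ S hS p hp hC
    obtain ⟨i, hi⟩ : ∃ i : Fin (d + 1), h (Fin.succ i) ≠ 0 := by
      by_contra! hcon
      obtain ⟨q, hq, hrel⟩ := hinf.nonempty
      have h1 := (hp q hq).1
      simp only [hcon, zero_mul, Finset.sum_const_zero, add_zero, mul_eq_zero] at hrel
      rcases hrel with h0 | h0
      · exact hh (funext fun j => Fin.cases h0 hcon j)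
      · have : q = 0 := by exact_mod_cast h0
        omega
    let r : Fin (d + 2) → ℚ := fun j => (h j : ℚ) / h i.succ
    have hiC : (h i.succ : ℂ) ≠ 0 := by exact_mod_cast hi
    have hrC : ∀ j, ((r j : ℚ) : ℂ) = (h j : ℂ) / h i.succ := fun j => by simp [r]
    refine ih (fun j => x (i.succAbove j) - (r (i.succAbove j).succ : ℂ) * x i)
      (s + (r 0 : ℂ) * x i) (fun j => (hx _).sub ((isAlgebraic_algebraMap _).mul (hx i)))
      (hs.add ((isAlgebraic_algebraMap _).mul (hx i))) ?_ C δ hC hδ _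
      (fun q j => p q (i.succAbove j)) ?_ hinf
    · rintro ⟨t, ht⟩
      refine hspan ⟨i.insertNth (-r 0 - ∑ j, t j * r (i.succAbove j).succ) t, ?_⟩
      rw [Fin.sum_univ_succAbove _ i]
      simp only [Fin.insertNth_apply_same, Fin.insertNth_apply_succAbove]
      rw [eq_sub_of_add_eq ht]
      simp only [mul_sub, Finset.sum_sub_distrib]
      push_cast
      rw [sub_mul, Finset.sum_mul]
      simp only [mul_assoc]
      ring
    · rintro q ⟨hq, hrel⟩
      obtain ⟨h1, h2, h3⟩ := hp q hq
      refine ⟨h1, fun j => h2 _, lt_of_le_of_lt ?_ h3⟩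
      have hpi : (p q i : ℂ) = -((r 0 : ℂ) * q) -
          ∑ j, (r (i.succAbove j).succ : ℂ) * p q (i.succAbove j) := by
        rw [Fin.sum_univ_succAbove _ i] at hrel
        have hrel' : (h 0 : ℂ) * q + (h i.succ * p q i +
          ∑ j, (h (i.succAbove j).succ : ℂ) * p q (i.succAbove j)) = 0 := by exact_mod_cast hrel
        simp only [hrC, div_mul_eq_mul_div, ← Finset.sum_div]
        field_simp
        linear_combination hrel'
      have heq : (q : ℂ) * (s + (r 0 : ℂ) * x i) - ∑ j, (p q (i.succAbove j) : ℂ) *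
          (x (i.succAbove j) - (r (i.succAbove j).succ : ℂ) * x i) =
          (q : ℂ) * s - ∑ i, (p q i : ℂ) * x i := by
        rw [Fin.sum_univ_succAbove _ i, hpi]
        simp only [mul_sub, Finset.sum_sub_distrib]
        rw [sub_mul, Finset.sum_mul]
        have : ∀ j, (p q (i.succAbove j) : ℂ) * ((r (i.succAbove j).succ : ℂ) * x i) =
            (r (i.succAbove j).succ : ℂ) * p q (i.succAbove j) * x i := fun j => by ring
        simp only [this]
        ring
      rw [heq]
      refine mul_le_mul_of_nonneg_left ?_ (norm_nonneg _)
      rw [Fin.prod_univ_succAbove _ i]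
      exact le_mul_of_one_le_left (Finset.prod_nonneg fun _ _ => by positivity) (le_max_left _ _)

end Final

end SubspaceThm

open Filter

/-- (Lemma `appliedSubspace`, an application of Schmidt's Subspace
Theorem.) If `s` is algebraic and not in the ℚ-span of the algebraic numbers
`x_1, …, x_d`, then for any `C, δ > 0` only finitely many `(p, q) ∈ ℤ^d × ℕ` with
`q ≥ 1` and `|p_i| ≤ q^C` satisfy
`|q s − Σ p_i x_i| · ∏ max{1,|p_i|} < q^(−δ)`. -/
theorem stmt_14 (d : ℕ) (x : Fin d → ℂ) (s : ℂ)
    (hx : ∀ i, IsAlgebraic ℚ (x i)) (hs : IsAlgebraic ℚ s)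
    (hspan : ¬ ∃ q : Fin d → ℚ, s = ∑ i, (q i : ℂ) * x i)
    (C δ : ℝ) (hC : 0 < C) (hδ : 0 < δ) :
    {pq : (Fin d → ℤ) × ℕ | 1 ≤ pq.2 ∧ (∀ i, |(pq.1 i : ℝ)| ≤ (pq.2 : ℝ) ^ C) ∧
      ‖(pq.2 : ℂ) * s - ∑ i, (pq.1 i : ℂ) * x i‖ *
        ∏ i, max 1 |(pq.1 i : ℝ)| < (pq.2 : ℝ) ^ (-δ)}.Finite := by
  by_contra hinf
  obtain ⟨A, hA, hAinf, hinj⟩ := SubspaceThm.exists_infinite_injOn hinf Prod.snd (by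
    rintro ⟨p, q⟩ -
    refine (((Set.finite_Icc (fun _ : Fin d => -⌈(q : ℝ) ^ C⌉) fun _ => ⌈(q : ℝ) ^ C⌉).prod
      (Set.finite_singleton q))).subset ?_
    rintro ⟨p', q'⟩ ⟨⟨-, hp', -⟩, hq' : q' = q⟩
    subst hq'
    refine ⟨⟨fun i => ?_, fun i => ?_⟩, rfl⟩
    · have h1 := (abs_le.mp (hp' i)).1
      have h2 := Int.le_ceil ((q' : ℝ) ^ C)
      have : ((-⌈(q' : ℝ) ^ C⌉ : ℤ) : ℝ) ≤ p' i := by push_cast; linarith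
      exact_mod_cast this
    · have h1 := (abs_le.mp (hp' i)).2
      have h2 := h1.trans (Int.le_ceil ((q' : ℝ) ^ C))
      exact_mod_cast h2)
  have hex : ∀ q ∈ Prod.snd '' A, ∃ p, (p, q) ∈ A := by
    rintro _ ⟨⟨p, q⟩, h, rfl⟩
    exact ⟨p, h⟩
  choose! p hp using hex
  exact SubspaceThm.not_infinite_solutions d x s hx hs hspan C δ hC hδ (Prod.snd '' A) p
    (fun q hq => hA (hp q hq)) (hAinf.image hinj)
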